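/- arXiv:1803.10832 — 3 statements merged into one kernel-verified Lean document; each statement's English description precedes it below -/
import Mathlib

section
/- Let p ≥ 1 be an integer and let f ∈ C^{2p}([0,1]) satisfy f^{(j)}(0) = f^{(j)}(1) = 0 for all 0 ≤ j ≤ p−1. Then for every x ∈ [0,1]: (−1)^p ∫₀^1 G_p(x,t) f^{(2p)}(t) dt = f(x). -/
open MeasureTheory Filter

/-- The Green kernel `G_p` associated to `(-1)^p d^{2p}/dx^{2p}` on `[0,1]` with Dirichlet-type
boundary conditions. -/
noncomputable def GreenK (p : ℕ) (x y : ℝ) : ℝ :=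
  if x = 0 ∧ y = 0 then 0
  else
    x ^ p * y ^ p / ((Nat.factorial (p - 1) : ℝ)) ^ 2 *
      ∫ t in (max x y)..1, (t - x) ^ (p - 1) * (t - y) ^ (p - 1) / t ^ (2 * p)

/-- Taylor's formula with integral remainder, for a chain of functions each of which is the
derivative of the previous one. -/
theorem taylor_chain (Φ : ℕ → ℝ → ℝ) (a b : ℝ) (n : ℕ)
    (hc : ∀ k ≤ n + 1, Continuous (Φ k))
    (hd : ∀ k ≤ n, ∀ t ∈ Set.Ioo (min a b) (max a b), HasDerivAt (Φ k) (Φ (k + 1) t) t) :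
    Φ 0 a = ∑ j ∈ Finset.range (n + 1), (a - b) ^ j / (Nat.factorial j : ℝ) * Φ j b +
      (-1) ^ (n + 1) * ∫ t in a..b, (t - a) ^ n / (Nat.factorial n : ℝ) * Φ (n + 1) t := by
  induction n with
  | zero =>
    have h := intervalIntegral.integral_mul_deriv_eq_deriv_mul_of_hasDerivAt
      (a := a) (b := b) (u := fun _ => (1 : ℝ)) (u' := fun _ => 0) (v := Φ 0) (v' := Φ 1)
      (by fun_prop) (hc 0 (by simp)).continuousOn (fun t _ => hasDerivAt_const t 1)
      (hd 0 le_rfl) (by simp) ((hc 1 le_rfl).intervalIntegrable _ _)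
    simp at h ⊢
    linarith
  | succ n ih =>
    rw [ih (fun k hk => hc k (by omega)) (fun k hk => hd k (by omega)),
      Finset.sum_range_succ _ (n + 1)]
    have hu : ∀ t : ℝ, HasDerivAt (fun t => (t - a) ^ (n + 1) / (Nat.factorial (n + 1) : ℝ))
        ((t - a) ^ n / (Nat.factorial n : ℝ)) t := by
      intro t
      have h := (((hasDerivAt_id t).sub_const a).pow (n + 1)).div_const
        (Nat.factorial (n + 1) : ℝ)
      refine h.congr_deriv ?_
      rw [Nat.factorial_succ]
      push_cast
      have : (Nat.factorial n : ℝ) ≠ 0 := by positivity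
      simp
      field_simp
    have h := intervalIntegral.integral_mul_deriv_eq_deriv_mul_of_hasDerivAt
      (a := a) (b := b) (u := fun t => (t - a) ^ (n + 1) / (Nat.factorial (n + 1) : ℝ))
      (v := Φ (n + 1)) (v' := Φ (n + 2))
      (by fun_prop) (hc (n + 1) (by omega)).continuousOn (fun t _ => hu t)
      (hd (n + 1) le_rfl) (Continuous.intervalIntegrable (by fun_prop) _ _)
      ((hc (n + 2) le_rfl).intervalIntegrable _ _)
    have e : (a - b) ^ (n + 1) = (-1) ^ (n + 1) * (b - a) ^ (n + 1) := by
      rw [← mul_pow]; ring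
    rw [e, h]
    simp only [sub_self]
    ring

/-- Repeated integration by parts of a polynomial against the last member of a chain of
derivatives, when all boundary terms vanish. -/
theorem integral_polynomial_mul_chain_eq_zero (Φ : ℕ → ℝ → ℝ) (a b : ℝ) (n : ℕ)
    (hc : ∀ k ≤ n, Continuous (Φ k))
    (hd : ∀ k < n, ∀ t ∈ Set.Ioo (min a b) (max a b), HasDerivAt (Φ k) (Φ (k + 1) t) t)
    (P : Polynomial ℝ) (hP : Polynomial.derivative^[n] P = 0)
    (ha : ∀ k < n, (Polynomial.derivative^[k] P).eval a * Φ (n - 1 - k) a = 0)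
    (hb : ∀ k < n, (Polynomial.derivative^[k] P).eval b * Φ (n - 1 - k) b = 0) :
    ∫ t in a..b, P.eval t * Φ n t = 0 := by
  induction n generalizing P with
  | zero =>
    have : P = 0 := hP
    simp [this]
  | succ n ih =>
    have h := intervalIntegral.integral_mul_deriv_eq_deriv_mul_of_hasDerivAt
      (a := a) (b := b) (u := fun t => P.eval t) (v := Φ n) (v' := Φ (n + 1))
      P.continuous.continuousOn (hc n (by omega)).continuousOn (fun t _ => P.hasDerivAt t)
      (hd n (by omega)) (P.derivative.continuous.intervalIntegrable _ _)
      ((hc (n + 1) le_rfl).intervalIntegrable _ _)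
    have ha0 := ha 0 (by omega)
    have hb0 := hb 0 (by omega)
    simp only [Function.iterate_zero, id_eq, Nat.add_sub_cancel, Nat.sub_zero] at ha0 hb0
    rw [h, ha0, hb0, ih (fun k hk => hc k (by omega)) (fun k hk => hd k (by omega)) _ hP]
    · simp
    · intro k hk
      have := ha (k + 1) (by omega)
      rwa [Function.iterate_succ_apply, show n + 1 - 1 - (k + 1) = n - 1 - k by omega] at this
    · intro k hk
      have := hb (k + 1) (by omega)
      rwa [Function.iterate_succ_apply, show n + 1 - 1 - (k + 1) = n - 1 - k by omega] at this

theorem eval_iterate_derivative_eq_zero_of_pow_dvd {P Q : Polynomial ℝ} {c : ℝ} {k n : ℕ}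
    (hQ : Q.eval c = 0) (h : Q ^ n ∣ P) (hk : k < n) :
    (Polynomial.derivative^[k] P).eval c = 0 := by
  obtain ⟨R, hR⟩ := Polynomial.pow_sub_dvd_iterate_derivative_of_pow_dvd k h
  rw [hR, Polynomial.eval_mul, Polynomial.eval_pow, hQ, zero_pow (by omega), zero_mul]

theorem hasDerivAt_dilate {F : ℕ → ℝ → ℝ} {k : ℕ} (m : ℕ) {u t : ℝ}
    (h : HasDerivAt (F k) (F (k + 1) (t * u)) (t * u)) :
    HasDerivAt (fun t => u ^ m * F k (t * u)) (u ^ (m + 1) * F (k + 1) (t * u)) t := by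
  have h2 := (h.comp t ((hasDerivAt_id t).mul_const u)).const_mul (u ^ m)
  refine h2.congr_deriv ?_
  ring

section chain

variable {F : ℕ → ℝ → ℝ} {q : ℕ}

theorem chain_eq_integral_dilate (hc : ∀ k ≤ q + 1, Continuous (F k))
    (hd : ∀ k < q + 1, ∀ t ∈ Set.Ioo (0 : ℝ) 1, HasDerivAt (F k) (F (k + 1) t) t)
    (h0 : ∀ k < q + 1, F k 0 = 0) {x : ℝ} (hx : x ∈ Set.Ioo (0 : ℝ) 1) :
    F 0 x = x ^ (q + 1) / (Nat.factorial q : ℝ) *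
      ∫ u in (0 : ℝ)..1, (1 - u) ^ q * F (q + 1) (u * x) := by
  have h := taylor_chain (fun k t => x ^ k * F k (t * x)) 1 0 q
    (fun k hk => by have := hc k hk; fun_prop)
    (fun k hk t ht => by
      refine hasDerivAt_dilate k (hd k (by omega) _ ?_)
      simp at ht
      exact ⟨mul_pos ht.1 hx.1, by nlinarith [hx.1, hx.2]⟩)
  rw [Finset.sum_eq_zero, intervalIntegral.integral_symm] at h
  · simp only [pow_zero, one_mul] at h
    rw [h, ← intervalIntegral.integral_neg, ← intervalIntegral.integral_const_mul, zero_add,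
      ← intervalIntegral.integral_const_mul]
    congr 1
    ext u
    have : (1 - u) ^ q = (-1) ^ q * (u - 1) ^ q := by rw [← mul_pow]; ring
    rw [this]
    ring
  · intro j hj
    simp [h0 j (by simpa using hj)]

theorem integral_moment_eq_zero (hc : ∀ k ≤ 2 * (q + 1), Continuous (F k))
    (hd : ∀ k < 2 * (q + 1), ∀ t ∈ Set.Ioo (0 : ℝ) 1, HasDerivAt (F k) (F (k + 1) t) t)
    (h0 : ∀ k < q + 1, F k 0 = 0) (h1 : ∀ k < q + 1, F k 1 = 0) {j : ℕ} (hj : j < q + 1) :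
    ∫ u in (0 : ℝ)..1, (1 - u) ^ q * u ^ j * F (q + 1 + j) u = 0 := by
  have h := integral_polynomial_mul_chain_eq_zero F 0 1 (q + 1 + j)
    (fun k hk => hc k (by omega)) (fun k hk => by simpa using hd k (by omega))
    ((1 - Polynomial.X) ^ q * Polynomial.X ^ j) ?_ ?_ ?_
  · simpa using h
  · apply Polynomial.iterate_derivative_eq_zero
    have : ((1 - Polynomial.X : Polynomial ℝ) ^ q * Polynomial.X ^ j).natDegree ≤ q * 1 + j := by
      refine Polynomial.natDegree_mul_le_of_le (Polynomial.natDegree_pow_le_of_le q ?_)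
        (Polynomial.natDegree_X_pow_le j)
      exact (Polynomial.natDegree_sub_le _ _).trans (by simp)
    omega
  · intro k hk
    rcases lt_or_ge k j with h | h
    · rw [eval_iterate_derivative_eq_zero_of_pow_dvd (by simp) (dvd_mul_left _ _) h, zero_mul]
    · rw [h0 _ (by omega), mul_zero]
  · intro k hk
    rcases lt_or_ge k q with h | h
    · rw [eval_iterate_derivative_eq_zero_of_pow_dvd (by simp) (dvd_mul_right _ _) h, zero_mul]
    · rw [h1 _ (by omega), mul_zero]

theorem chain_eq_iterated_integral (hc : ∀ k ≤ 2 * (q + 1), Continuous (F k))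
    (hd : ∀ k < 2 * (q + 1), ∀ t ∈ Set.Ioo (0 : ℝ) 1, HasDerivAt (F k) (F (k + 1) t) t)
    (h0 : ∀ k < q + 1, F k 0 = 0) (h1 : ∀ k < q + 1, F k 1 = 0)
    {x : ℝ} (hx : x ∈ Set.Ioo (0 : ℝ) 1) :
    F 0 x = (-1) ^ (q + 1) * (x ^ (q + 1) / (Nat.factorial q : ℝ) ^ 2) *
      ∫ u in (0 : ℝ)..1, ∫ t in x..1,
        (1 - u) ^ q * u ^ (q + 1) * (t - x) ^ q * F (2 * (q + 1)) (t * u) := by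
  have hc2 := hc _ le_rfl
  rw [chain_eq_integral_dilate (fun k hk => hc k (by omega)) (fun k hk => hd k (by omega)) h0 hx]
  have key : ∀ u ∈ Set.Ioc (0 : ℝ) 1, (1 - u) ^ q * F (q + 1) (u * x) =
      ∑ j ∈ Finset.range (q + 1), (x - 1) ^ j / (Nat.factorial j : ℝ) *
        ((1 - u) ^ q * u ^ j * F (q + 1 + j) u) +
      (-1) ^ (q + 1) / (Nat.factorial q : ℝ) * ∫ t in x..1,
        (1 - u) ^ q * u ^ (q + 1) * (t - x) ^ q * F (2 * (q + 1)) (t * u) := by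
    intro u hu
    have h := taylor_chain (fun k t => u ^ k * F (q + 1 + k) (t * u)) x 1 q
      (fun k hk => by have := hc (q + 1 + k) (by omega); fun_prop)
      (fun k hk t ht => by
        refine hasDerivAt_dilate k (hd (q + 1 + k) (by omega) _ ?_)
        rw [min_eq_left hx.2.le, max_eq_right hx.2.le] at ht
        have : 0 < t := hx.1.trans ht.1
        exact ⟨mul_pos this hu.1, by nlinarith [hu.1, hu.2, ht.2]⟩)
    simp only [pow_zero, one_mul, add_zero] at h
    rw [mul_comm u x, h, mul_add, Finset.mul_sum, ← intervalIntegral.integral_const_mul,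
      ← intervalIntegral.integral_const_mul, ← intervalIntegral.integral_const_mul]
    congr 1
    · exact Finset.sum_congr rfl fun j _ => by ring
    · congr 1
      ext t
      rw [show q + 1 + (q + 1) = 2 * (q + 1) by ring]
      ring
  have hcont : Continuous fun u : ℝ => ∫ t in x..1,
      (1 - u) ^ q * u ^ (q + 1) * (t - x) ^ q * F (2 * (q + 1)) (t * u) :=
    intervalIntegral.continuous_parametric_intervalIntegral_of_continuous' (by fun_prop) _ _
  have hsum : ∀ j ∈ Finset.range (q + 1), Continuous fun u : ℝ =>
      (x - 1) ^ j / (Nat.factorial j : ℝ) * ((1 - u) ^ q * u ^ j * F (q + 1 + j) u) := by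
    intro j hj
    have := hc (q + 1 + j) (by have := Finset.mem_range.1 hj; omega)
    fun_prop
  rw [intervalIntegral.integral_congr_ae (g := fun u =>
      ∑ j ∈ Finset.range (q + 1), (x - 1) ^ j / (Nat.factorial j : ℝ) *
        ((1 - u) ^ q * u ^ j * F (q + 1 + j) u) +
      (-1) ^ (q + 1) / (Nat.factorial q : ℝ) * ∫ t in x..1,
        (1 - u) ^ q * u ^ (q + 1) * (t - x) ^ q * F (2 * (q + 1)) (t * u))
      (ae_of_all _ fun u hu => key u (by rwa [Set.uIoc_of_le zero_le_one] at hu)),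
    intervalIntegral.integral_add
      ((continuous_finsetSum _ hsum).intervalIntegrable _ _)
      ((hcont.const_mul _).intervalIntegrable _ _),
    intervalIntegral.integral_finsetSum fun j hj => (hsum j hj).intervalIntegrable _ _,
    Finset.sum_eq_zero, intervalIntegral.integral_const_mul]
  · ring
  · intro j hj
    rw [intervalIntegral.integral_const_mul,
      integral_moment_eq_zero hc hd h0 h1 (Finset.mem_range.1 hj), mul_zero]

end chain

theorem integral_beta_dilate (q : ℕ) (g : ℝ → ℝ) {t : ℝ} (ht : 0 < t) :
    ∫ u in (0 : ℝ)..1, (1 - u) ^ q * u ^ (q + 1) * g (t * u) =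
      ∫ y in (0 : ℝ)..t, (t - y) ^ q * y ^ (q + 1) * g y / t ^ (2 * (q + 1)) := by
  have h := intervalIntegral.integral_comp_mul_left (a := 0) (b := 1)
    (fun y => (t - y) ^ q * y ^ (q + 1) * g y / t ^ (2 * (q + 1))) ht.ne'
  rw [mul_zero, mul_one, smul_eq_mul, eq_inv_mul_iff_mul_eq₀ ht.ne',
    ← intervalIntegral.integral_const_mul] at h
  rw [← h]
  congr 1
  ext u
  have : t - t * u = t * (1 - u) := by ring
  rw [this, mul_pow, mul_pow]
  field_simp
  ring

theorem integral_greenK_mul (q : ℕ) {g : ℝ → ℝ} (hg : Continuous g) {x : ℝ}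
    (hx : x ∈ Set.Ioo (0 : ℝ) 1) :
    ∫ y in (0 : ℝ)..1, GreenK (q + 1) x y * g y =
      x ^ (q + 1) / (Nat.factorial q : ℝ) ^ 2 *
      ∫ u in (0 : ℝ)..1, ∫ t in x..1,
        (1 - u) ^ q * u ^ (q + 1) * (t - x) ^ q * g (t * u) := by
  set h : ℝ → ℝ → ℝ := fun t y =>
    (t - x) ^ q * ((t - y) ^ q * y ^ (q + 1) * g y / t ^ (2 * (q + 1))) with hh
  have hcont : ContinuousOn (Function.uncurry h) (Set.Icc x 1 ×ˢ Set.Icc 0 1) := by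
    have : ∀ z ∈ Set.Icc x 1 ×ˢ Set.Icc (0 : ℝ) 1, z.1 ^ (2 * (q + 1)) ≠ 0 := fun z hz =>
      pow_ne_zero _ (hx.1.trans_le hz.1.1).ne'
    exact ContinuousOn.mul (by fun_prop) (ContinuousOn.div (by fun_prop) (by fun_prop) this)
  have hS : MeasurableSet {z : ℝ × ℝ | z.2 ≤ z.1} := measurableSet_le measurable_snd measurable_fst
  have hswap : ∫ t in x..1, ∫ y in (0 : ℝ)..1, (if y ≤ t then h t y else 0) =
      ∫ y in (0 : ℝ)..1, ∫ t in x..1, (if y ≤ t then h t y else 0) := by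
    refine intervalIntegral_intervalIntegral_swap
      (F := fun t y => if y ≤ t then h t y else 0) ?_
    rw [Set.uIoc_of_le hx.2.le, Set.uIoc_of_le zero_le_one]
    have hi := (hcont.integrableOn_compact (μ := volume) (isCompact_Icc.prod isCompact_Icc)).mono_set
      (Set.prod_mono Set.Ioc_subset_Icc_self Set.Ioc_subset_Icc_self)
    exact hi.indicator hS
  have hinner : ∀ t ∈ Set.Icc x 1, ∫ y in (0 : ℝ)..1, (if y ≤ t then h t y else 0) =
      (t - x) ^ q * ∫ u in (0 : ℝ)..1, (1 - u) ^ q * u ^ (q + 1) * g (t * u) := by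
    intro t ht
    have ht0 : 0 < t := hx.1.trans_le ht.1
    rw [integral_beta_dilate q g ht0, ← intervalIntegral.integral_const_mul]
    exact intervalIntegral.integral_indicator ⟨ht0.le, ht.2⟩
  have houter : ∀ y ∈ Set.Icc (0 : ℝ) 1, ∫ t in x..1, (if y ≤ t then h t y else 0) =
      ∫ t in (max x y)..1, h t y := by
    intro y hy
    rw [intervalIntegral.integral_of_le hx.2.le,
      intervalIntegral.integral_of_le (max_le hx.2.le hy.2), ← integral_Icc_eq_integral_Ioc,
      ← integral_Icc_eq_integral_Ioc]
    have : Set.Icc (max x y) 1 = Set.Icc x 1 ∩ Set.Ici y := by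
      ext t; simp; tauto
    rw [this, ← setIntegral_indicator measurableSet_Ici]
    rfl
  have e1 : ∫ u in (0 : ℝ)..1, ∫ t in x..1,
      (1 - u) ^ q * u ^ (q + 1) * (t - x) ^ q * g (t * u) =
      ∫ t in x..1, ∫ y in (0 : ℝ)..1, (if y ≤ t then h t y else 0) := by
    rw [intervalIntegral_intervalIntegral_swap]
    · refine intervalIntegral.integral_congr fun t ht => ?_
      rw [Set.uIcc_of_le hx.2.le] at ht
      rw [hinner t ht, ← intervalIntegral.integral_const_mul]
      congr 1
      ext u
      ring
    · refine (ContinuousOn.integrableOn_compact (K := Set.uIcc 0 1 ×ˢ Set.uIcc x 1)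
        (isCompact_uIcc.prod isCompact_uIcc) ?_).mono_set
        (Set.prod_mono Set.uIoc_subset_uIcc Set.uIoc_subset_uIcc)
      apply Continuous.continuousOn
      unfold Function.uncurry
      fun_prop
  rw [e1, hswap, ← intervalIntegral.integral_const_mul]
  refine intervalIntegral.integral_congr fun y hy => ?_
  rw [Set.uIcc_of_le zero_le_one] at hy
  rw [houter y hy, GreenK, if_neg (fun h => hx.1.ne' h.1), ← intervalIntegral.integral_const_mul,
    mul_comm, ← intervalIntegral.integral_const_mul, ← intervalIntegral.integral_const_mul]
  congr 1
  ext t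
  simp only [hh, Nat.add_sub_cancel]
  ring

/-- For `f ∈ C^{2p}([0,1])` with `f^{(j)}(0) = f^{(j)}(1) = 0` for `0 ≤ j ≤ p-1`, we have
`(-1)^p ∫₀^1 G_p(x,t) f^{(2p)}(t) dt = f(x)` for every `x ∈ [0,1]`. -/
theorem greenK_reproduces (p : ℕ) (hp : 1 ≤ p) (f : ℝ → ℝ)
    (hf : ContDiffOn ℝ (2 * p) f (Set.Icc (0 : ℝ) 1))
    (hbc : ∀ j < p,
      iteratedDerivWithin j f (Set.Icc (0 : ℝ) 1) 0 = 0 ∧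
      iteratedDerivWithin j f (Set.Icc (0 : ℝ) 1) 1 = 0)
    (x : ℝ) (hx : x ∈ Set.Icc (0 : ℝ) 1) :
    (-1 : ℝ) ^ p *
      ∫ t in (0 : ℝ)..1, GreenK p x t * iteratedDerivWithin (2 * p) f (Set.Icc (0 : ℝ) 1) t
      = f x := by
  obtain ⟨q, rfl⟩ : ∃ q, p = q + 1 := ⟨p - 1, by omega⟩
  have hI : UniqueDiffOn ℝ (Set.Icc (0 : ℝ) 1) := uniqueDiffOn_Icc zero_lt_one
  have m0 : (0 : ℝ) ∈ Set.Icc (0 : ℝ) 1 := by simp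
  have m1 : (1 : ℝ) ∈ Set.Icc (0 : ℝ) 1 := by simp
  set D : ℕ → ℝ → ℝ := fun k => iteratedDerivWithin k f (Set.Icc (0 : ℝ) 1) with hD
  set F : ℕ → ℝ → ℝ := fun k =>
    Set.IccExtend (zero_le_one (α := ℝ)) ((Set.Icc (0 : ℝ) 1).domRestrict (D k))
  have hFD : ∀ k, ∀ t ∈ Set.Icc (0 : ℝ) 1, F k t = D k t := fun k t ht =>
    Set.IccExtend_of_mem _ _ ht
  have hc : ∀ k ≤ 2 * (q + 1), Continuous (F k) := by
    intro k hk
    have := hf.continuousOn_iteratedDerivWithin (m := k) (by exact_mod_cast hk) hI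
    exact (continuousOn_iff_continuous_domRestrict.1 this).Icc_extend'
  have hd : ∀ k < 2 * (q + 1), ∀ t ∈ Set.Ioo (0 : ℝ) 1, HasDerivAt (F k) (F (k + 1) t) t := by
    intro k hk t ht
    have htI := Set.Ioo_subset_Icc_self ht
    have hn : Set.Icc (0 : ℝ) 1 ∈ nhds t := Icc_mem_nhds ht.1 ht.2
    have h1 := (hf.differentiableOn_iteratedDerivWithin (m := k) (by exact_mod_cast hk) hI
      t htI).hasDerivWithinAt.hasDerivAt hn
    rw [← iteratedDerivWithin_succ] at h1
    rw [hFD _ t htI]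
    exact h1.congr_of_eventuallyEq (eventually_of_mem hn (hFD k))
  have h0 : ∀ k < q + 1, F k 0 = 0 := fun k hk => (hFD k 0 m0).trans (hbc k hk).1
  have h1 : ∀ k < q + 1, F k 1 = 0 := fun k hk => (hFD k 1 m1).trans (hbc k hk).2
  have hF0 : ∀ t ∈ Set.Icc (0 : ℝ) 1, F 0 t = f t := fun t ht => by
    rw [hFD 0 t ht, hD]; simp
  have hint : ∫ t in (0 : ℝ)..1, GreenK (q + 1) x t * D (2 * (q + 1)) t =
      ∫ t in (0 : ℝ)..1, GreenK (q + 1) x t * F (2 * (q + 1)) t := by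
    refine intervalIntegral.integral_congr fun t ht => ?_
    rw [Set.uIcc_of_le zero_le_one] at ht
    simp only [hFD _ t ht]
  change _ * ∫ t in (0 : ℝ)..1, GreenK (q + 1) x t * D (2 * (q + 1)) t = _
  rw [hint, ← hF0 x hx]
  rcases hx.1.eq_or_lt with rfl | hx0
  · rw [h0 0 (by omega)]
    simp [GreenK]
  rcases hx.2.eq_or_lt with rfl | hx1
  · rw [h1 0 (by omega), intervalIntegral.integral_congr (g := fun _ => (0 : ℝ))]
    · simp
    · intro t ht
      rw [Set.uIcc_of_le zero_le_one] at ht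
      simp [GreenK, max_eq_left ht.2]
  · rw [integral_greenK_mul q (hc _ le_rfl) ⟨hx0, hx1⟩,
      chain_eq_iterated_integral hc hd h0 h1 ⟨hx0, hx1⟩]
    ring
end

section
/- Let α ∈ (0,1), let a < b be real numbers, and let f : (a,b) → ℝ be Lipschitz on every closed subinterval of (a,b) and suppose there exists γ ∈ [0,1−α] such that f(a+h) = O(h^{−γ}) and f(b−h) = O(h^{−γ}) as h → 0⁺. Then for every x ∈ (a,b) the limit lim_{N→∞} N^α Σ_{l=0}^{N} φ̂_α(k − l) · X^{a,b}_{N,l}, with k = ⌊N(x−a)/(b−a)⌋, exists and equals (b−a)^α · (2^α/Γ(−α)) · ( ∫_a^x (x−u)^{−α−1} (f(u) − f(x)) du − f(x) · (x−a)^{−α}/α ); that is, D_{α,a,b}(f)(x) admits this integral expression. -/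
open MeasureTheory Filter Asymptotics

/-- The `n`-th Fourier coefficient of `φ_α(θ) = (1-e^{iθ})^α (1+e^{-iθ})^α`. -/
noncomputable def phiHat (α : ℝ) (n : ℤ) : ℂ :=
  (1 / (2 * (Real.pi : ℂ))) * ∫ θ in (-Real.pi)..Real.pi,
    (1 - Complex.exp ((θ : ℂ) * Complex.I)) ^ (α : ℂ) *
      (1 + Complex.exp (-(θ : ℂ) * Complex.I)) ^ (α : ℂ) *
      Complex.exp (-(n : ℂ) * (θ : ℂ) * Complex.I)

/-- The discretization vector on `[a,b]`: `f(a + (b-a)l/N)` for `0 < l < N`, `0` at endpoints. -/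
noncomputable def XvecAB (f : ℝ → ℝ) (a b : ℝ) (N l : ℕ) : ℝ :=
  if l = 0 ∨ l = N then 0 else f (a + (b - a) * (l : ℝ) / (N : ℝ))

open scoped Topology

/-- The `n`-th Taylor coefficient of `(1 - z) ^ α` at `0`. -/
noncomputable def binomCoeff (α : ℝ) (n : ℕ) : ℝ := (-1) ^ n * Ring.choose α n

lemma binomCoeff_zero (α : ℝ) : binomCoeff α 0 = 1 := by
  simp [binomCoeff]

lemma binomCoeff_succ (α : ℝ) (n : ℕ) :
    binomCoeff α (n + 1) = binomCoeff α n * ((-α + n) / (n + 1)) := by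
  have h := Ring.choose_smul_choose α (Nat.le_succ n)
  simp only [Nat.succ_eq_add_one, Nat.choose_succ_self_right, nsmul_eq_mul,
    Nat.add_sub_cancel_left, Ring.choose_one_right] at h
  push_cast at h
  have hn : (n : ℝ) + 1 ≠ 0 := by positivity
  unfold binomCoeff
  rw [← mul_right_inj' hn]
  field_simp
  rw [pow_succ]
  linear_combination (-1 : ℝ) * (-1) ^ n * h

lemma binomCoeff_succ_eq_prod (α : ℝ) (n : ℕ) :
    binomCoeff α (n + 1) =
      (∏ j ∈ Finset.range (n + 1), (-α + j)) / ((n + 1) * (n.factorial : ℝ)) := by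
  induction n with
  | zero => simp [binomCoeff_succ, binomCoeff_zero]
  | succ n ih =>
    rw [binomCoeff_succ, ih, Finset.prod_range_succ _ (n + 1), Nat.factorial_succ]
    push_cast
    field_simp

lemma tendsto_binomCoeff {α : ℝ} (hα : α ∈ Set.Ioo (0 : ℝ) 1) :
    Tendsto (fun n : ℕ => (n : ℝ) ^ (1 + α) * binomCoeff α n) atTop
      (𝓝 (Real.Gamma (-α))⁻¹) := by
  have hne : ∀ m : ℕ, -α ≠ -m := by
    intro m h
    have h1 : α = (m : ℝ) := by linarith
    rcases Nat.eq_zero_or_pos m with rfl | hm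
    · have := hα.1; simp_all
    · have := hα.2
      have : (1 : ℝ) ≤ m := by exact_mod_cast hm
      linarith
  have hG : Real.Gamma (-α) ≠ 0 := Real.Gamma_ne_zero hne
  have h1 : Tendsto (fun n : ℕ => (Real.GammaSeq (-α) n)⁻¹) atTop
      (𝓝 (Real.Gamma (-α))⁻¹) := (Real.GammaSeq_tendsto_Gamma (-α)).inv₀ hG
  rw [← tendsto_add_atTop_iff_nat 1]
  have h2 : Tendsto (fun n : ℕ => (((n : ℝ) + 1) / n) ^ α) atTop (𝓝 1) := by
    have : Tendsto (fun n : ℕ => (((n : ℝ) + 1) / n)) atTop (𝓝 1) := by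
      have h3 : Tendsto (fun n : ℕ => 1 + 1 / (n : ℝ)) atTop (𝓝 (1 + 0)) :=
        tendsto_const_nhds.add tendsto_one_div_atTop_nhds_zero_nat
      rw [add_zero] at h3
      refine h3.congr' ?_
      filter_upwards [eventually_gt_atTop 0] with n hn
      have : (n : ℝ) ≠ 0 := by positivity
      field_simp
    simpa using this.rpow_const (p := α) (Or.inl one_ne_zero)
  have h3 := h2.mul h1
  rw [one_mul] at h3
  refine h3.congr' ?_
  filter_upwards [eventually_gt_atTop 0] with n hn
  have hn' : (0 : ℝ) < n := by exact_mod_cast hn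
  rw [binomCoeff_succ_eq_prod, Real.GammaSeq, Real.div_rpow (by positivity) hn'.le,
    Real.rpow_neg hn'.le]
  push_cast
  rw [Real.rpow_add (by positivity), Real.rpow_one]
  have := Real.rpow_pos_of_pos hn' α
  have hf : (n.factorial : ℝ) ≠ 0 := by positivity
  rw [inv_div]
  field_simp

/-- A sequence with a power-law limit is bounded by the corresponding power. -/
lemma exists_abs_le_of_tendsto_rpow_mul {p L : ℝ} (hp : 0 ≤ p) {u : ℕ → ℝ}
    (h : Tendsto (fun n : ℕ => (n : ℝ) ^ p * u n) atTop (𝓝 L)) :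
    ∃ C : ℝ, 0 < C ∧ ∀ n : ℕ, |u n| ≤ C * (1 + (n : ℝ)) ^ (-p) := by
  obtain ⟨B, hB⟩ := h.abs.bddAbove_range
  have hB' : ∀ n : ℕ, |(n : ℝ) ^ p * u n| ≤ B := fun n => hB ⟨n, rfl⟩
  have hB0 : 0 ≤ B := (abs_nonneg _).trans (hB' 0)
  refine ⟨2 ^ p * B + |u 0| + 1, by positivity, fun n => ?_⟩
  rcases Nat.eq_zero_or_pos n with rfl | hn
  · simp
    have : 0 ≤ 2 ^ p * B := by positivity
    linarith
  · have hn' : (1 : ℝ) ≤ n := by exact_mod_cast hn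
    have h0 : (0 : ℝ) < (1 + (n : ℝ)) ^ p := by positivity
    rw [Real.rpow_neg (by positivity), ← div_eq_mul_inv, le_div_iff₀ h0]
    have h1 : (1 + (n : ℝ)) ^ p ≤ 2 ^ p * (n : ℝ) ^ p := by
      rw [← Real.mul_rpow (by norm_num) (by positivity)]
      exact Real.rpow_le_rpow (by positivity) (by linarith) hp
    have h2 := hB' n
    rw [abs_mul, abs_of_nonneg (by positivity)] at h2
    calc |u n| * (1 + (n : ℝ)) ^ p ≤ |u n| * (2 ^ p * (n : ℝ) ^ p) := by gcongr
      _ = 2 ^ p * ((n : ℝ) ^ p * |u n|) := by ring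
      _ ≤ 2 ^ p * B := by gcongr
      _ ≤ _ := by linarith [abs_nonneg (u 0)]

lemma summable_one_add_rpow_neg {p : ℝ} (hp : 1 < p) :
    Summable (fun n : ℕ => (1 + (n : ℝ)) ^ (-p)) := by
  have := (summable_nat_add_iff 1).2 (Real.summable_nat_rpow.2 (by linarith : -p < -1))
  refine this.congr fun n => ?_
  push_cast
  rw [add_comm]

lemma exists_abs_binomCoeff_le {α : ℝ} (hα : α ∈ Set.Ioo (0 : ℝ) 1) :
    ∃ C : ℝ, 0 < C ∧ ∀ n : ℕ, |binomCoeff α n| ≤ C * (1 + (n : ℝ)) ^ (-(1 + α)) :=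
  exists_abs_le_of_tendsto_rpow_mul (by linarith [hα.1]) (tendsto_binomCoeff hα)

lemma summable_abs_binomCoeff {α : ℝ} (hα : α ∈ Set.Ioo (0 : ℝ) 1) :
    Summable (fun n : ℕ => |binomCoeff α n|) := by
  obtain ⟨C, _, hC⟩ := exists_abs_binomCoeff_le hα
  exact Summable.of_nonneg_of_le (fun _ => abs_nonneg _) hC
    ((summable_one_add_rpow_neg (by linarith [hα.1])).mul_left C)

lemma hasSum_binomCoeff_of_norm_lt_one (α : ℝ) {z : ℂ} (hz : ‖z‖ < 1) :
    HasSum (fun n : ℕ => (binomCoeff α n : ℂ) * z ^ n) ((1 - z) ^ (α : ℂ)) := by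
  have h := (Complex.one_add_cpow_hasFPowerSeriesOnBall_zero (a := (α : ℂ))).hasSum
    (y := -z) (by simpa [enorm_eq_nnnorm, ← NNReal.coe_lt_coe] using hz)
  rw [zero_add, ← sub_eq_add_neg] at h
  refine h.congr_fun fun n => ?_
  rw [binomialSeries_apply, List.ofFn_const, List.prod_replicate, binomCoeff, neg_pow,
    smul_eq_mul, ← Complex.ofReal_choose]
  push_cast
  ring

lemma continuousAt_one_sub_cpow {α : ℝ} (hα : 0 < α) {z : ℂ} (hz : ‖z‖ ≤ 1) :
    ContinuousAt (fun w : ℂ => (1 - w) ^ (α : ℂ)) z := by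
  rcases eq_or_ne z 1 with rfl | h1
  · have := (Complex.continuousAt_cpow_zero_of_re_pos (z := (α : ℂ)) (by simpa using hα))
    have h2 : ContinuousAt (fun w : ℂ => ((1 - w), (α : ℂ))) 1 := by fun_prop
    have h3 : ContinuousAt (fun x : ℂ × ℂ => x.1 ^ x.2) ((1 : ℂ) - 1, (α : ℂ)) := by
      simpa using this
    exact ContinuousAt.comp (f := fun w : ℂ => ((1 - w), (α : ℂ))) (x := 1) h3 h2
  · refine ContinuousAt.cpow (by fun_prop) continuousAt_const ?_
    left
    have h2 : z.re ≤ 1 := (Complex.re_le_norm z).trans hz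
    rcases h2.lt_or_eq with h2 | h2
    · simpa using h2
    · exfalso
      apply h1
      have h3 := Complex.sq_norm z
      rw [Complex.normSq_apply, h2] at h3
      have h4 : ‖z‖ ^ 2 ≤ 1 := by nlinarith [norm_nonneg z]
      have : z.im = 0 := by nlinarith [mul_self_nonneg z.im]
      exact Complex.ext (by simpa using h2) (by simpa using this)

lemma hasSum_binomCoeff {α : ℝ} (hα : α ∈ Set.Ioo (0 : ℝ) 1) {z : ℂ} (hz : ‖z‖ ≤ 1) :
    HasSum (fun n : ℕ => (binomCoeff α n : ℂ) * z ^ n) ((1 - z) ^ (α : ℂ)) := by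
  have hb : ∀ w : ℂ, ‖w‖ ≤ 1 → ∀ n : ℕ, ‖(binomCoeff α n : ℂ) * w ^ n‖ ≤ |binomCoeff α n| := by
    intro w hw n
    rw [norm_mul, norm_pow, Complex.norm_real, Real.norm_eq_abs]
    exact mul_le_of_le_one_right (abs_nonneg _) (pow_le_one₀ (norm_nonneg _) hw)
  have hs : Summable (fun n : ℕ => (binomCoeff α n : ℂ) * z ^ n) :=
    Summable.of_norm_bounded (summable_abs_binomCoeff hα) (hb z hz)
  have h1 : Tendsto (fun r : ℝ => ((r : ℂ) * z)) (𝓝[<] 1) (𝓝 z) := by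
    have : ContinuousAt (fun r : ℝ => ((r : ℂ) * z)) 1 := by fun_prop
    have := this.tendsto
    simp only [Complex.ofReal_one, one_mul] at this
    exact this.mono_left nhdsWithin_le_nhds
  have hlt : ∀ᶠ r : ℝ in 𝓝[<] 1, 0 < r ∧ r < 1 := Ioo_mem_nhdsLT zero_lt_one
  have hnorm : ∀ r : ℝ, 0 < r ∧ r < 1 → ‖(r : ℂ) * z‖ < 1 := by
    intro r hr
    rw [norm_mul, Complex.norm_real, Real.norm_eq_abs, abs_of_pos hr.1]
    nlinarith [norm_nonneg z]
  have h2 : Tendsto (fun r : ℝ => ∑' n : ℕ, (binomCoeff α n : ℂ) * ((r : ℂ) * z) ^ n) (𝓝[<] 1)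
      (𝓝 (∑' n : ℕ, (binomCoeff α n : ℂ) * z ^ n)) := by
    refine tendsto_tsum_of_dominated_convergence (summable_abs_binomCoeff hα)
      (fun n => (h1.pow n).const_mul _) ?_
    filter_upwards [hlt] with r hr n using hb _ (hnorm r hr).le n
  have h3 : Tendsto (fun r : ℝ => (1 - (r : ℂ) * z) ^ (α : ℂ)) (𝓝[<] 1)
      (𝓝 ((1 - z) ^ (α : ℂ))) := (continuousAt_one_sub_cpow hα.1 hz).tendsto.comp h1
  have h4 := tendsto_nhds_unique h2 (h3.congr' (by
    filter_upwards [hlt] with r hr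
    exact (hasSum_binomCoeff_of_norm_lt_one α (hnorm r hr)).tsum_eq.symm))
  rw [← h4]
  exact hs.hasSum

lemma tsum_binomCoeff {α : ℝ} (hα : α ∈ Set.Ioo (0 : ℝ) 1) : ∑' n, binomCoeff α n = 0 := by
  have := (hasSum_binomCoeff hα (z := 1) (by simp)).tsum_eq
  have h0 : (α : ℂ) ≠ 0 := by exact_mod_cast hα.1.ne'
  simp only [one_pow, mul_one, sub_self, Complex.zero_cpow h0] at this
  exact_mod_cast this

lemma tsum_neg_one_pow_mul_binomCoeff {α : ℝ} (hα : α ∈ Set.Ioo (0 : ℝ) 1) :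
    ∑' n, (-1) ^ n * binomCoeff α n = (2 : ℝ) ^ α := by
  have := (hasSum_binomCoeff hα (z := -1) (by simp)).tsum_eq
  have h2 : (1 - (-1 : ℂ)) = ((2 : ℝ) : ℂ) := by norm_num
  rw [h2, ← Complex.ofReal_cpow (by norm_num)] at this
  have h3 : ∑' n : ℕ, (((-1) ^ n * binomCoeff α n : ℝ) : ℂ) = (((2 : ℝ) ^ α : ℝ) : ℂ) := by
    rw [← this]
    congr 1
    ext n
    push_cast
    ring
  exact_mod_cast h3

/-- The Taylor coefficients of `(1 - z) ^ α`, extended by zero to negative indices. -/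
noncomputable def binomCoeffInt (α : ℝ) (n : ℤ) : ℝ :=
  if 0 ≤ n then binomCoeff α n.toNat else 0

/-- The Fourier coefficient `phiHat α n` as a convolution of Taylor coefficients. -/
noncomputable def phiReal (α : ℝ) (n : ℤ) : ℝ :=
  ∑' m : ℕ, binomCoeffInt α (n + m) * ((-1) ^ m * binomCoeff α m)

lemma binomCoeffInt_natCast (α : ℝ) (n : ℕ) : binomCoeffInt α n = binomCoeff α n := by
  simp [binomCoeffInt]

lemma integral_exp_int_mul (k : ℤ) :
    ∫ θ in (-Real.pi)..Real.pi, Complex.exp ((k : ℂ) * (θ : ℂ) * Complex.I) =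
      if k = 0 then 2 * (Real.pi : ℂ) else 0 := by
  split_ifs with hk
  · subst hk
    simp
    ring
  · have hc : (k : ℂ) * Complex.I ≠ 0 :=
      mul_ne_zero (by exact_mod_cast hk) Complex.I_ne_zero
    have h := integral_exp_mul_complex (a := -Real.pi) (b := Real.pi) hc
    have h1 : ∀ θ : ℝ, (k : ℂ) * (θ : ℂ) * Complex.I = (k : ℂ) * Complex.I * θ := fun θ => by ring
    simp_rw [h1]
    rw [h, div_eq_zero_iff]
    left
    rw [sub_eq_zero, Complex.exp_eq_exp_iff_exists_int]
    exact ⟨k, by push_cast; ring⟩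

lemma norm_cexp_ofReal_mul_I_le_one (θ : ℝ) : ‖Complex.exp ((θ : ℂ) * Complex.I)‖ ≤ 1 :=
  (Complex.norm_exp_ofReal_mul_I θ).le

lemma continuous_one_sub_exp_cpow {α : ℝ} (hα : 0 < α) :
    Continuous (fun θ : ℝ => (1 - Complex.exp ((θ : ℂ) * Complex.I)) ^ (α : ℂ)) := by
  rw [continuous_iff_continuousAt]
  intro θ
  exact ContinuousAt.comp (f := fun θ : ℝ => Complex.exp ((θ : ℂ) * Complex.I))
    (continuousAt_one_sub_cpow hα (norm_cexp_ofReal_mul_I_le_one θ)) (by fun_prop)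

lemma integral_one_sub_exp_cpow_mul {α : ℝ} (hα : α ∈ Set.Ioo (0 : ℝ) 1) (k : ℤ) :
    ∫ θ in (-Real.pi)..Real.pi, (1 - Complex.exp ((θ : ℂ) * Complex.I)) ^ (α : ℂ) *
      Complex.exp (-(k : ℂ) * (θ : ℂ) * Complex.I) = 2 * Real.pi * (binomCoeffInt α k : ℂ) := by
  have hexp : ∀ (n : ℕ) (θ : ℝ), (binomCoeff α n : ℂ) * Complex.exp ((θ : ℂ) * Complex.I) ^ n *
      Complex.exp (-(k : ℂ) * (θ : ℂ) * Complex.I) =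
      (binomCoeff α n : ℂ) * Complex.exp (((n - k : ℤ) : ℂ) * (θ : ℂ) * Complex.I) := by
    intro n θ
    rw [← Complex.exp_nat_mul, mul_assoc, ← Complex.exp_add]
    congr 2
    push_cast
    ring
  have hs := intervalIntegral.hasSum_integral_of_dominated_convergence
    (μ := volume) (a := -Real.pi) (b := Real.pi)
    (F := fun (n : ℕ) (θ : ℝ) => (binomCoeff α n : ℂ) *
      Complex.exp (((n - k : ℤ) : ℂ) * (θ : ℂ) * Complex.I))
    (f := fun θ : ℝ => (1 - Complex.exp ((θ : ℂ) * Complex.I)) ^ (α : ℂ) *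
      Complex.exp (-(k : ℂ) * (θ : ℂ) * Complex.I))
    (fun n _ => |binomCoeff α n|)
    (fun n => (Continuous.aestronglyMeasurable (by fun_prop)))
    (fun n => ae_of_all _ fun θ _ => by
      rw [norm_mul, Complex.norm_real, Real.norm_eq_abs]
      have : (((n - k : ℤ) : ℂ) * (θ : ℂ)) = (((n - k : ℤ) * θ : ℝ) : ℂ) := by push_cast; ring
      rw [this, Complex.norm_exp_ofReal_mul_I, mul_one])
    (ae_of_all _ fun _ _ => summable_abs_binomCoeff hα)
    intervalIntegrable_const
    (ae_of_all _ fun θ _ => by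
      have := (hasSum_binomCoeff hα (norm_cexp_ofReal_mul_I_le_one θ)).mul_right
        (Complex.exp (-(k : ℂ) * (θ : ℂ) * Complex.I))
      simpa only [hexp] using this)
  rw [← hs.tsum_eq]
  simp_rw [intervalIntegral.integral_const_mul, integral_exp_int_mul]
  by_cases hk : 0 ≤ k
  · rw [tsum_eq_single k.toNat]
    · rw [if_pos (by omega), binomCoeffInt, if_pos hk]
      ring
    · intro n hn
      rw [if_neg (by omega), mul_zero]
  · rw [binomCoeffInt, if_neg hk]
    have : ∀ n : ℕ, ¬ ((n : ℤ) - k = 0) := fun n => by omega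
    simp [this]

lemma phiHat_eq_phiReal {α : ℝ} (hα : α ∈ Set.Ioo (0 : ℝ) 1) (n : ℤ) :
    phiHat α n = (phiReal α n : ℂ) := by
  set S := ∑' m, |binomCoeff α m| with hS
  have hA : ∀ θ : ℝ, ‖(1 - Complex.exp ((θ : ℂ) * Complex.I)) ^ (α : ℂ)‖ ≤ S := by
    intro θ
    rw [← (hasSum_binomCoeff hα (norm_cexp_ofReal_mul_I_le_one θ)).tsum_eq]
    refine tsum_of_norm_bounded (summable_abs_binomCoeff hα).hasSum fun m => ?_
    rw [norm_mul, norm_pow, Complex.norm_real, Complex.norm_exp_ofReal_mul_I, one_pow, mul_one,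
      Real.norm_eq_abs]
  have hcont := continuous_one_sub_exp_cpow hα.1
  have hs := intervalIntegral.hasSum_integral_of_dominated_convergence
    (μ := volume) (a := -Real.pi) (b := Real.pi)
    (F := fun (m : ℕ) (θ : ℝ) => (((-1) ^ m * binomCoeff α m : ℝ) : ℂ) *
      ((1 - Complex.exp ((θ : ℂ) * Complex.I)) ^ (α : ℂ) *
        Complex.exp (-((n + m : ℤ) : ℂ) * (θ : ℂ) * Complex.I)))
    (f := fun θ : ℝ => (1 - Complex.exp ((θ : ℂ) * Complex.I)) ^ (α : ℂ) *
      (1 + Complex.exp (-(θ : ℂ) * Complex.I)) ^ (α : ℂ) *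
      Complex.exp (-(n : ℂ) * (θ : ℂ) * Complex.I))
    (fun m _ => |binomCoeff α m| * S)
    (fun m => (Continuous.aestronglyMeasurable (by fun_prop)))
    (fun m => ae_of_all _ fun θ _ => by
      have : -((n + m : ℤ) : ℂ) * (θ : ℂ) = ((-(n + m : ℤ) * θ : ℝ) : ℂ) := by push_cast; ring
      rw [norm_mul, norm_mul, Complex.norm_real, Real.norm_eq_abs, this,
        Complex.norm_exp_ofReal_mul_I, mul_one, abs_mul, abs_pow, abs_neg, abs_one, one_pow,
        one_mul]
      exact mul_le_mul_of_nonneg_left (hA θ) (abs_nonneg _))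
    (ae_of_all _ fun _ _ => (summable_abs_binomCoeff hα).mul_right S)
    intervalIntegrable_const
    (ae_of_all _ fun θ _ => by
      have hn : ‖-Complex.exp (-(θ : ℂ) * Complex.I)‖ ≤ 1 := by
        rw [norm_neg]
        simpa using norm_cexp_ofReal_mul_I_le_one (-θ)
      have := ((hasSum_binomCoeff hα hn).mul_left
        ((1 - Complex.exp ((θ : ℂ) * Complex.I)) ^ (α : ℂ))).mul_right
        (Complex.exp (-(n : ℂ) * (θ : ℂ) * Complex.I))
      rw [sub_neg_eq_add] at this
      refine this.congr_fun fun m => ?_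
      have h2 : Complex.exp (-((n + m : ℤ) : ℂ) * (θ : ℂ) * Complex.I) =
          Complex.exp (-(θ : ℂ) * Complex.I) ^ m *
            Complex.exp (-(n : ℂ) * (θ : ℂ) * Complex.I) := by
        rw [← Complex.exp_nat_mul, ← Complex.exp_add]
        congr 1
        push_cast
        ring
      rw [h2, neg_pow]
      push_cast
      ring)
  rw [phiHat, ← hs.tsum_eq]
  simp_rw [intervalIntegral.integral_const_mul, integral_one_sub_exp_cpow_mul hα]
  rw [phiReal, Complex.ofReal_tsum, ← tsum_mul_left]
  refine tsum_congr fun m => ?_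
  have : (Real.pi : ℂ) ≠ 0 := by exact_mod_cast Real.pi_ne_zero
  push_cast
  field_simp

lemma abs_neg_one_pow_mul (m : ℕ) (y : ℝ) : |(-1) ^ m * y| = |y| := by
  rw [abs_mul, abs_pow, abs_neg, abs_one, one_pow, one_mul]

lemma phiReal_natCast (α : ℝ) (n : ℕ) :
    phiReal α n = ∑' m : ℕ, binomCoeff α (n + m) * ((-1) ^ m * binomCoeff α m) := by
  rw [phiReal]
  refine tsum_congr fun m => ?_
  rw [← binomCoeffInt_natCast α (n + m)]
  push_cast
  rfl

lemma phiReal_neg_natCast (α : ℝ) (n : ℕ) : phiReal α (-n) = (-1) ^ n * phiReal α n := by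
  rw [phiReal_natCast, phiReal, ← tsum_mul_left]
  have hinj : Function.Injective (fun j : ℕ => j + n) := add_left_injective n
  rw [← hinj.tsum_eq]
  · congr 1
    ext j
    have : (-(n : ℤ) + ((j + n : ℕ) : ℤ)) = (j : ℤ) := by push_cast; ring
    rw [this, binomCoeffInt_natCast, pow_add, add_comm n j]
    ring
  · intro m hm
    by_contra hm'
    apply hm
    have : m < n := by
      by_contra h
      exact hm' ⟨m - n, Nat.sub_add_cancel (not_lt.1 h)⟩
    simp only [binomCoeffInt]
    rw [if_neg (by omega), zero_mul]

lemma tendsto_phiReal {α : ℝ} (hα : α ∈ Set.Ioo (0 : ℝ) 1) :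
    Tendsto (fun n : ℕ => (n : ℝ) ^ (1 + α) * phiReal α n) atTop
      (𝓝 (2 ^ α / Real.Gamma (-α))) := by
  obtain ⟨C, hC0, hC⟩ := exists_abs_binomCoeff_le hα
  have hp : 0 < 1 + α := by linarith [hα.1]
  have hlim : ∀ m : ℕ, Tendsto (fun n : ℕ => (n : ℝ) ^ (1 + α) * binomCoeff α (n + m)) atTop
      (𝓝 (Real.Gamma (-α))⁻¹) := by
    intro m
    have h1 := (tendsto_add_atTop_iff_nat m).2 (tendsto_binomCoeff hα)
    have h2 : Tendsto (fun n : ℕ => ((n : ℝ) / ((n : ℝ) + m)) ^ (1 + α)) atTop (𝓝 1) := by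
      simpa using (tendsto_natCast_div_add_atTop (m : ℝ)).rpow_const (p := 1 + α)
        (Or.inl one_ne_zero)
    have h3 := h2.mul h1
    rw [one_mul] at h3
    refine h3.congr' ?_
    filter_upwards [eventually_gt_atTop 0] with n hn
    have hn' : (0 : ℝ) < n := by exact_mod_cast hn
    have : (0 : ℝ) < ((n : ℝ) + m) ^ (1 + α) := by positivity
    rw [Real.div_rpow hn'.le (by positivity)]
    push_cast
    field_simp
  have h := tendsto_tsum_of_dominated_convergence
    (f := fun (n : ℕ) (m : ℕ) =>
      (n : ℝ) ^ (1 + α) * (binomCoeff α (n + m) * ((-1) ^ m * binomCoeff α m)))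
    (g := fun m : ℕ => (Real.Gamma (-α))⁻¹ * ((-1) ^ m * binomCoeff α m)) (𝓕 := atTop)
    ((summable_abs_binomCoeff hα).mul_left C)
    (fun m => by
      simpa only [mul_assoc] using
        (hlim m).mul_const ((-1) ^ m * binomCoeff α m))
    (Eventually.of_forall fun n m => by
      rw [Real.norm_eq_abs, ← mul_assoc, abs_mul, abs_neg_one_pow_mul]
      refine mul_le_mul_of_nonneg_right ?_ (abs_nonneg _)
      rw [abs_mul, abs_of_nonneg (by positivity)]
      have h1 : (n : ℝ) ^ (1 + α) ≤ (1 + ((n + m : ℕ) : ℝ)) ^ (1 + α) :=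
        Real.rpow_le_rpow (by positivity) (by push_cast; linarith [m.cast_nonneg (α := ℝ)]) hp.le
      calc (n : ℝ) ^ (1 + α) * |binomCoeff α (n + m)|
          ≤ (1 + ((n + m : ℕ) : ℝ)) ^ (1 + α) * (C * (1 + ((n + m : ℕ) : ℝ)) ^ (-(1 + α))) := by
            gcongr
            exact hC _
        _ = C := by
            rw [Real.rpow_neg (by positivity)]
            have : (0 : ℝ) < (1 + ((n + m : ℕ) : ℝ)) ^ (1 + α) := by positivity
            field_simp)
  simp_rw [tsum_mul_left, tsum_neg_one_pow_mul_binomCoeff hα, ← phiReal_natCast] at h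
  rwa [div_eq_inv_mul]

lemma exists_abs_phiReal_le {α : ℝ} (hα : α ∈ Set.Ioo (0 : ℝ) 1) :
    ∃ C : ℝ, 0 < C ∧ ∀ n : ℤ, |phiReal α n| ≤ C * (1 + |(n : ℝ)|) ^ (-(1 + α)) := by
  obtain ⟨C, hC0, hC⟩ :=
    exists_abs_le_of_tendsto_rpow_mul (by linarith [hα.1]) (tendsto_phiReal hα)
  refine ⟨C, hC0, fun n => ?_⟩
  obtain ⟨m, rfl | rfl⟩ := n.eq_nat_or_neg
  · simpa using hC m
  · rw [phiReal_neg_natCast, abs_neg_one_pow_mul]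
    simpa using hC m

lemma summable_phiReal {α : ℝ} (hα : α ∈ Set.Ioo (0 : ℝ) 1) : Summable (phiReal α) := by
  obtain ⟨C, hC0, hC⟩ := exists_abs_phiReal_le hα
  have hs := (summable_one_add_rpow_neg (p := 1 + α) (by linarith [hα.1])).mul_left C
  refine Summable.of_nat_of_neg (Summable.of_norm_bounded hs fun n => ?_)
    (Summable.of_norm_bounded hs fun n => ?_)
  · simpa using hC n
  · simpa using hC (-n)

lemma tsum_phiReal {α : ℝ} (hα : α ∈ Set.Ioo (0 : ℝ) 1) : ∑' n, phiReal α n = 0 := by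
  have hz : HasSum (binomCoeffInt α) 0 := by
    have h0 : HasSum (binomCoeff α) 0 := by
      rw [← tsum_binomCoeff hα]
      exact (summable_abs_binomCoeff hα).of_abs.hasSum
    have hinj : Function.Injective (fun n : ℕ => (n : ℤ)) := Nat.cast_injective
    rw [← hinj.hasSum_iff]
    · simpa [Function.comp_def, binomCoeffInt_natCast] using h0
    · intro n hn
      rw [binomCoeffInt, if_neg]
      intro h
      exact hn ⟨n.toNat, by simp [h]⟩
  have habs : Summable (fun n : ℤ => |binomCoeffInt α n|) := hz.summable.abs
  have hprod : Summable (fun p : ℤ × ℕ =>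
      binomCoeffInt α p.1 * ((-1) ^ p.2 * binomCoeff α p.2)) := by
    refine summable_mul_of_summable_norm (f := binomCoeffInt α)
      (g := fun m : ℕ => (-1) ^ m * binomCoeff α m) habs ?_
    simpa only [Real.norm_eq_abs, abs_neg_one_pow_mul] using summable_abs_binomCoeff hα
  let e : ℤ × ℕ ≃ ℤ × ℕ :=
    { toFun := fun p => (p.1 + p.2, p.2)
      invFun := fun p => (p.1 - p.2, p.2)
      left_inv := fun p => by simp
      right_inv := fun p => by simp }
  have hshear : Summable (Function.uncurry fun (n : ℤ) (m : ℕ) =>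
      binomCoeffInt α (n + m) * ((-1) ^ m * binomCoeff α m)) :=
    (e.summable_iff.2 hprod).congr fun p => rfl
  simp_rw [phiReal]
  rw [← hshear.tsum_comm]
  have : ∀ m : ℕ, ∑' n : ℤ, binomCoeffInt α (n + m) * ((-1) ^ m * binomCoeff α m) = 0 := by
    intro m
    have := (Equiv.addRight (m : ℤ)).tsum_eq (binomCoeffInt α)
    simp only [Equiv.coe_addRight] at this
    rw [tsum_mul_right, this, hz.tsum_eq, zero_mul]
  simp [this]

/-- The integrable majorant `min (|v| ^ (-(1 + α))) (|v| ^ (-α))`. -/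
noncomputable def kernelBound (α v : ℝ) : ℝ := min (|v| ^ (-(1 + α))) (|v| ^ (-α))

/-- The weight measuring blow-up at the endpoints of `(0, 1)`. -/
noncomputable def endpointWeight (γ s : ℝ) : ℝ := 1 + |s| ^ (-γ) + |1 - s| ^ (-γ)

lemma kernelBound_nonneg (α v : ℝ) : 0 ≤ kernelBound α v :=
  le_min (by positivity) (by positivity)

lemma one_le_endpointWeight (γ s : ℝ) : 1 ≤ endpointWeight γ s := by
  unfold endpointWeight
  have h1 : 0 ≤ |s| ^ (-γ) := by positivity
  have h2 : 0 ≤ |1 - s| ^ (-γ) := by positivity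
  linarith

lemma measurable_kernelBound (α : ℝ) : Measurable (kernelBound α) := by
  unfold kernelBound
  fun_prop

lemma integrable_kernelBound {α : ℝ} (hα : α ∈ Set.Ioo (0 : ℝ) 1) :
    Integrable (kernelBound α) := by
  have hIoi : IntegrableOn (kernelBound α) (Set.Ioi 0) := by
    rw [← Set.Ioc_union_Ioi_eq_Ioi (zero_le_one' ℝ)]
    refine IntegrableOn.union ?_ ?_
    · have h : IntegrableOn (fun v : ℝ => v ^ (-α)) (Set.Ioc 0 1) :=
        (intervalIntegrable_iff_integrableOn_Ioc_of_le zero_le_one).1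
          (intervalIntegral.intervalIntegrable_rpow' (by linarith [hα.2]))
      refine Integrable.mono' h (measurable_kernelBound α).aestronglyMeasurable ?_
      filter_upwards [ae_restrict_mem measurableSet_Ioc] with v hv
      rw [Real.norm_eq_abs, abs_of_nonneg (kernelBound_nonneg _ _)]
      refine (min_le_right _ _).trans ?_
      rw [abs_of_pos hv.1]
    · have h : IntegrableOn (fun v : ℝ => v ^ (-(1 + α))) (Set.Ioi 1) :=
        integrableOn_Ioi_rpow_of_lt (by linarith [hα.1]) one_pos
      refine Integrable.mono' h (measurable_kernelBound α).aestronglyMeasurable ?_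
      filter_upwards [ae_restrict_mem measurableSet_Ioi] with v hv
      rw [Real.norm_eq_abs, abs_of_nonneg (kernelBound_nonneg _ _)]
      refine (min_le_left _ _).trans ?_
      rw [abs_of_pos (zero_lt_one.trans hv)]
  have hIio : IntegrableOn (kernelBound α) (Set.Iio 0) := by
    have h : IntegrableOn (kernelBound α) (Set.Ioi (-0)) := by simpa using hIoi
    exact h.comp_neg_Iio.congr (ae_of_all _ fun v => by simp only [kernelBound, abs_neg])
  rw [← integrableOn_univ, ← Set.Iio_union_Ici (a := (0 : ℝ))]
  exact hIio.union (Iff.mpr integrableOn_Ici_iff_integrableOn_Ioi hIoi)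

lemma integrable_kernelBound_mul_abs_rpow {α γ t p : ℝ} (hα : α ∈ Set.Ioo (0 : ℝ) 1)
    (hγ0 : 0 ≤ γ) (hγ1 : γ < 1) (hp : p ≠ t) :
    Integrable (fun s => kernelBound α (s - t) * |s - p| ^ (-γ)) := by
  set γ' := (1 + γ) / 2 with hγ'
  set δ := min (|p - t| / 2) 1 with hδ
  have hδ0 : 0 < δ := lt_min (by have := abs_pos.2 (sub_ne_zero.2 hp); positivity) one_pos
  have hmaj : Integrable (fun s => δ ^ (-(1 + α)) * kernelBound γ' (s - p) +
      δ ^ (-γ) * kernelBound α (s - t)) :=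
    (((integrable_kernelBound ⟨by linarith, by linarith⟩).comp_sub_right p).const_mul _).add
      (((integrable_kernelBound hα).comp_sub_right t).const_mul _)
  refine hmaj.mono' ?_ ?_
  · have := measurable_kernelBound α
    exact Measurable.aestronglyMeasurable (by fun_prop)
  · have hne : ∀ᵐ s : ℝ, s ≠ p := by simp [ae_iff]
    filter_upwards [hne] with s hs
    have hs0 : 0 < |s - p| := abs_pos.2 (sub_ne_zero.2 hs)
    have hk := kernelBound_nonneg α (s - t)
    have hk' := kernelBound_nonneg γ' (s - p)
    rw [Real.norm_eq_abs, abs_of_nonneg (by positivity)]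
    rcases le_total |s - p| δ with h | h
    · have h1 : kernelBound α (s - t) ≤ δ ^ (-(1 + α)) := by
        refine (min_le_left _ _).trans ?_
        refine Real.rpow_le_rpow_of_nonpos hδ0 ?_ (by linarith [hα.1])
        have h2 : |p - t| ≤ |s - p| + |s - t| := by
          rw [abs_sub_comm s p]
          exact abs_sub_le p s t
        have h3 : δ ≤ |p - t| / 2 := min_le_left _ _
        linarith
      have h4 : |s - p| ≤ 1 := h.trans (min_le_right _ _)
      have h5 : |s - p| ^ (-γ) ≤ kernelBound γ' (s - p) :=
        le_min (Real.rpow_le_rpow_of_exponent_ge hs0 h4 (by linarith))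
          (Real.rpow_le_rpow_of_exponent_ge hs0 h4 (by linarith))
      have h6 : 0 ≤ δ ^ (-γ) * kernelBound α (s - t) := by positivity
      have h7 : kernelBound α (s - t) * |s - p| ^ (-γ) ≤
          δ ^ (-(1 + α)) * kernelBound γ' (s - p) := by gcongr
      linarith
    · have h1 : |s - p| ^ (-γ) ≤ δ ^ (-γ) :=
        Real.rpow_le_rpow_of_nonpos hδ0 h (by linarith)
      have h6 : 0 ≤ δ ^ (-(1 + α)) * kernelBound γ' (s - p) := by positivity
      have h7 : kernelBound α (s - t) * |s - p| ^ (-γ) ≤ kernelBound α (s - t) * δ ^ (-γ) := by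
        gcongr
      linarith

lemma integrable_kernelBound_mul_endpointWeight {α γ t : ℝ} (hα : α ∈ Set.Ioo (0 : ℝ) 1)
    (hγ0 : 0 ≤ γ) (hγ1 : γ < 1) (ht : t ∈ Set.Ioo (0 : ℝ) 1) :
    Integrable (fun s => kernelBound α (s - t) * endpointWeight γ s) := by
  have h0 := (integrable_kernelBound hα).comp_sub_right t
  have h1 := integrable_kernelBound_mul_abs_rpow hα hγ0 hγ1 (p := 0) ht.1.ne
  have h2 := integrable_kernelBound_mul_abs_rpow hα hγ0 hγ1 (p := 1) ht.2.ne'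
  refine ((h0.add h1).add h2).congr (ae_of_all _ fun s => ?_)
  simp only [Pi.add_apply, endpointWeight, sub_zero, abs_sub_comm s 1]
  ring

/-- The integral of a step function on cells of length `c⁻¹`. -/
lemma hasSum_integral_floor_mul {c : ℝ} (hc : 0 < c) {H : ℤ → ℝ}
    (hH : Integrable (fun s : ℝ => H ⌊c * s⌋)) :
    HasSum H (c * ∫ s : ℝ, H ⌊c * s⌋) := by
  have hInt : Integrable (fun s : ℝ => H ⌊s⌋) :=
    (integrable_comp_mul_left_iff (fun s : ℝ => H ⌊s⌋) hc.ne').1 hH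
  have h1 := Measure.integral_comp_mul_left (fun s : ℝ => H ⌊s⌋) c
  rw [h1, abs_of_pos (inv_pos.2 hc), smul_eq_mul, mul_inv_cancel_left₀ hc.ne']
  have h2 := hasSum_integral_iUnion (μ := volume) (f := fun s : ℝ => H ⌊s⌋)
    (s := fun n : ℤ => Set.Ico (n : ℝ) (n + 1)) (fun _ => measurableSet_Ico)
    (Set.pairwise_disjoint_Ico_intCast ℝ) hInt.integrableOn
  rw [iUnion_Ico_intCast, setIntegral_univ] at h2
  refine h2.congr_fun fun n => ?_
  have : ∀ s ∈ Set.Ico (n : ℝ) (n + 1), H ⌊s⌋ = H n := by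
    intro s hs
    rw [Int.floor_eq_iff.2 hs]
  rw [setIntegral_congr_fun measurableSet_Ico this]
  simp

/-- The `l`-th term of the centred lattice sum at mesh `1 / N`. -/
noncomputable def latticeTerm (α t : ℝ) (G : ℝ → ℝ) (N : ℕ) (l : ℤ) : ℝ :=
  (N : ℝ) ^ (1 + α) * (phiReal α (⌊(N : ℝ) * t⌋ - l) * (G (l / N) - G t))

lemma abs_rpow_neg_le_two_mul_add_one {γ y z : ℝ} (hγ0 : 0 ≤ γ) (hγ1 : γ < 1) (hz : z ≠ 0)
    (h : y = 0 ∨ |z| ≤ 2 * |y|) : |y| ^ (-γ) ≤ 2 * |z| ^ (-γ) + 1 := by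
  have hz0 : 0 < |z| := abs_pos.2 hz
  have hz1 : 0 < |z| ^ (-γ) := by positivity
  rcases h with rfl | h
  · have : |(0 : ℝ)| ^ (-γ) ≤ 1 := by
      rw [abs_zero]
      exact Real.zero_rpow_le_one _
    linarith
  · have h1 : |y| ^ (-γ) ≤ (|z| / 2) ^ (-γ) :=
      Real.rpow_le_rpow_of_nonpos (by positivity) (by linarith) (by linarith)
    rw [Real.div_rpow hz0.le (by norm_num), Real.rpow_neg (by norm_num : (0 : ℝ) ≤ 2),
      div_inv_eq_mul] at h1
    have h2 : (2 : ℝ) ^ γ ≤ 2 := by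
      simpa using Real.rpow_le_rpow_of_exponent_le (by norm_num : (1 : ℝ) ≤ 2) hγ1.le
    nlinarith

lemma abs_le_two_mul_abs_intCast_div {N : ℕ} (hN : 0 < N) {l : ℤ} {z : ℝ}
    (h : |z - l / N| ≤ 1 / N) : (l / N : ℝ) = 0 ∨ |z| ≤ 2 * |(l / N : ℝ)| := by
  have hN' : (0 : ℝ) < N := by exact_mod_cast hN
  rcases eq_or_ne l 0 with rfl | hl
  · left; simp
  · right
    have h1 : (1 : ℝ) ≤ |(l : ℝ)| := by exact_mod_cast Int.one_le_abs hl
    have h2 : (1 : ℝ) / N ≤ |(l / N : ℝ)| := by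
      rw [abs_div, abs_of_pos hN']
      gcongr
    have h3 : |z| ≤ |z - l / N| + |(l / N : ℝ)| := by
      simpa using abs_add_le (z - l / N) (l / N : ℝ)
    linarith

lemma endpointWeight_intCast_div_le {γ : ℝ} (hγ0 : 0 ≤ γ) (hγ1 : γ < 1) {N : ℕ} (hN : 0 < N)
    {l : ℤ} {s : ℝ} (hs0 : s ≠ 0) (hs1 : s ≠ 1) (h : |s - l / N| ≤ 1 / N) :
    endpointWeight γ (l / N) ≤ 3 * endpointWeight γ s := by
  have hN' : (0 : ℝ) < N := by exact_mod_cast hN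
  have h0 := abs_rpow_neg_le_two_mul_add_one hγ0 hγ1 hs0 (abs_le_two_mul_abs_intCast_div hN h)
  have he : (1 - l / N : ℝ) = ((N - l : ℤ) : ℝ) / N := by
    push_cast
    field_simp
  have h' : |(1 - s) - ((N - l : ℤ) : ℝ) / N| ≤ 1 / N := by
    rw [← he, show (1 - s) - (1 - l / N : ℝ) = -(s - l / N) by ring, abs_neg]
    exact h
  have h1 := abs_rpow_neg_le_two_mul_add_one hγ0 hγ1 (sub_ne_zero.2 hs1.symm)
    (abs_le_two_mul_abs_intCast_div hN h')
  rw [← he] at h1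
  unfold endpointWeight
  have h2 : 0 ≤ |s| ^ (-γ) := by positivity
  have h3 : 0 ≤ |1 - s| ^ (-γ) := by positivity
  linarith

lemma rpow_neg_mul_min_le_kernelBound {α y v : ℝ} (hα : α ∈ Set.Ioo (0 : ℝ) 1) (hv : v ≠ 0)
    (hy : |v| ≤ 2 * y) : y ^ (-(1 + α)) * min 1 y ≤ 4 * kernelBound α v := by
  have hv0 : 0 < |v| := abs_pos.2 hv
  have hy0 : 0 < y := by linarith
  have key : ∀ p : ℝ, 0 ≤ p → p ≤ 2 → y ^ (-p) ≤ 4 * |v| ^ (-p) := by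
    intro p hp0 hp2
    have h1 : y ^ (-p) ≤ (|v| / 2) ^ (-p) :=
      Real.rpow_le_rpow_of_nonpos (by positivity) (by linarith) (by linarith)
    rw [Real.div_rpow hv0.le (by norm_num), Real.rpow_neg (by norm_num : (0 : ℝ) ≤ 2),
      div_inv_eq_mul] at h1
    have h2 : (2 : ℝ) ^ p ≤ 4 := by
      have := Real.rpow_le_rpow_of_exponent_le (by norm_num : (1 : ℝ) ≤ 2) hp2
      norm_num at this
      exact this
    have h3 : 0 < |v| ^ (-p) := by positivity
    nlinarith
  have hyp : 0 < y ^ (-(1 + α)) := by positivity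
  rw [kernelBound, mul_min_of_nonneg _ _ (by norm_num : (0 : ℝ) ≤ 4)]
  refine le_min ?_ ?_
  · calc y ^ (-(1 + α)) * min 1 y ≤ y ^ (-(1 + α)) * 1 := by gcongr; exact min_le_left _ _
      _ ≤ _ := by rw [mul_one]; exact key _ (by linarith [hα.1]) (by linarith [hα.2])
  · calc y ^ (-(1 + α)) * min 1 y ≤ y ^ (-(1 + α)) * y := by gcongr; exact min_le_right _ _
      _ = y ^ (-α) := by
        rw [← Real.rpow_add_one hy0.ne']
        congr 1
        ring
      _ ≤ _ := key _ hα.1.le (by linarith [hα.2])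

lemma exists_abs_latticeTerm_le {α γ t C : ℝ} {G : ℝ → ℝ} (hα : α ∈ Set.Ioo (0 : ℝ) 1)
    (hγ0 : 0 ≤ γ) (hγ1 : γ < 1) (hC : 0 ≤ C)
    (hG : ∀ s, |G s - G t| ≤ C * (min 1 |s - t| * endpointWeight γ s)) :
    ∃ K : ℝ, ∀ N : ℕ, 0 < N → ∀ (l : ℤ) (s : ℝ), s ≠ 0 → s ≠ 1 → s ≠ t →
      |s - l / N| ≤ 1 / N →
      |latticeTerm α t G N l| ≤ K * (kernelBound α (s - t) * endpointWeight γ s) := by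
  obtain ⟨D, hD0, hD⟩ := exists_abs_phiReal_le hα
  refine ⟨12 * D * C, fun N hN l s hs0 hs1 hst h => ?_⟩
  have hN' : (0 : ℝ) < N := by exact_mod_cast hN
  set k := ⌊(N : ℝ) * t⌋ with hk
  set y : ℝ := (1 + |((k - l : ℤ) : ℝ)|) / N with hy
  have hy0 : 0 < y := by positivity
  have hlt : |(l / N : ℝ) - t| ≤ y := by
    rw [hy, le_div_iff₀ hN', ← abs_of_pos hN', ← abs_mul, abs_of_pos hN']
    have e : ((l : ℝ) / N - t) * N = (k - N * t) - ((k - l : ℤ) : ℝ) := by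
      push_cast
      field_simp
      ring
    rw [e]
    have h1 := Int.floor_le ((N : ℝ) * t)
    have h2 := Int.lt_floor_add_one ((N : ℝ) * t)
    have h3 : |(k : ℝ) - N * t| ≤ 1 := by
      rw [abs_le]
      constructor <;> linarith
    exact (abs_sub _ _).trans (by linarith)
  have hst' : |s - t| ≤ 2 * y := by
    have h1 : (1 : ℝ) / N ≤ y := by
      rw [hy]
      gcongr
      linarith [abs_nonneg ((k - l : ℤ) : ℝ)]
    have h2 : |s - t| ≤ |s - l / N| + |(l / N : ℝ) - t| := abs_sub_le _ _ _
    linarith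
  have hker := rpow_neg_mul_min_le_kernelBound hα (sub_ne_zero.2 hst) hst'
  have hw := endpointWeight_intCast_div_le hγ0 hγ1 hN hs0 hs1 h
  have hw1 := one_le_endpointWeight γ (l / N)
  have hw2 := one_le_endpointWeight γ s
  have hGl : |G (l / N) - G t| ≤ C * (min 1 y * (3 * endpointWeight γ s)) := by
    refine (hG _).trans ?_
    gcongr
  have hNy : (N : ℝ) ^ (1 + α) * (1 + |((k - l : ℤ) : ℝ)|) ^ (-(1 + α)) = y ^ (-(1 + α)) := by
    rw [hy, Real.div_rpow (by positivity) hN'.le, Real.rpow_neg hN'.le, div_inv_eq_mul, mul_comm]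
  rw [latticeTerm, abs_mul, abs_mul, abs_of_pos (by positivity)]
  calc (N : ℝ) ^ (1 + α) * (|phiReal α (k - l)| * |G (l / N) - G t|)
      ≤ (N : ℝ) ^ (1 + α) * ((D * (1 + |((k - l : ℤ) : ℝ)|) ^ (-(1 + α))) *
          (C * (min 1 y * (3 * endpointWeight γ s)))) := by
        gcongr
        exact hD _
    _ = 3 * D * C * (y ^ (-(1 + α)) * min 1 y) * endpointWeight γ s := by
        rw [← hNy]
        ring
    _ ≤ 3 * D * C * (4 * kernelBound α (s - t)) * endpointWeight γ s := by gcongr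
    _ = _ := by ring

lemma tendsto_of_abs_sub_intCast_div_le {s : ℝ} {l : ℕ → ℤ}
    (hl : ∀ᶠ N : ℕ in atTop, |s - l N / N| ≤ 1 / N) :
    Tendsto (fun N : ℕ => (l N : ℝ) / N) atTop (𝓝 s) := by
  rw [tendsto_iff_norm_sub_tendsto_zero]
  refine squeeze_zero' (Eventually.of_forall fun _ => norm_nonneg _) ?_
    tendsto_one_div_atTop_nhds_zero_nat
  filter_upwards [hl] with N hN
  rwa [Real.norm_eq_abs, abs_sub_comm]

lemma abs_sub_floor_div_le {N : ℕ} (hN : 0 < N) (s : ℝ) :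
    |s - (⌊(N : ℝ) * s⌋ : ℝ) / N| ≤ 1 / N := by
  have hN' : (0 : ℝ) < N := by exact_mod_cast hN
  have h1 := Int.floor_le ((N : ℝ) * s)
  have h2 := Int.lt_floor_add_one ((N : ℝ) * s)
  rw [le_div_iff₀ hN', ← abs_of_pos hN', ← abs_mul, abs_of_pos hN', sub_mul,
    div_mul_cancel₀ _ hN'.ne', abs_le]
  constructor <;> linarith

lemma abs_sub_floor_add_one_div_le {N : ℕ} (hN : 0 < N) (s : ℝ) :
    |s - ((⌊(N : ℝ) * s⌋ + 1 : ℤ) : ℝ) / N| ≤ 1 / N := by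
  have hN' : (0 : ℝ) < N := by exact_mod_cast hN
  have h1 := Int.floor_le ((N : ℝ) * s)
  have h2 := Int.lt_floor_add_one ((N : ℝ) * s)
  rw [le_div_iff₀ hN', ← abs_of_pos hN', ← abs_mul, abs_of_pos hN', sub_mul,
    div_mul_cancel₀ _ hN'.ne', abs_le]
  push_cast
  constructor <;> linarith

lemma tendsto_natAbs_latticeTerm {α t s : ℝ} {G : ℝ → ℝ} (hα : α ∈ Set.Ioo (0 : ℝ) 1)
    (hst : s ≠ t) (hG : ContinuousAt G s) {l : ℕ → ℤ}
    (hl : ∀ᶠ N : ℕ in atTop, |s - l N / N| ≤ 1 / N) :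
    Tendsto (fun N : ℕ => (N : ℝ) ^ (1 + α) *
      (phiReal α ((⌊(N : ℝ) * t⌋ - l N).natAbs : ℤ) * (G (l N / N) - G t))) atTop
      (𝓝 (|t - s| ^ (-(1 + α)) * (2 ^ α / Real.Gamma (-α)) * (G s - G t))) := by
  have hl' := tendsto_of_abs_sub_intCast_div_le hl
  have hk' : Tendsto (fun N : ℕ => (⌊(N : ℝ) * t⌋ : ℝ) / N) atTop (𝓝 t) :=
    tendsto_of_abs_sub_intCast_div_le (by
      filter_upwards [eventually_gt_atTop 0] with N hN using abs_sub_floor_div_le hN t)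
  have hd : 0 < |t - s| := abs_pos.2 (sub_ne_zero.2 hst.symm)
  set n : ℕ → ℕ := fun N => (⌊(N : ℝ) * t⌋ - l N).natAbs with hn
  have hnd : Tendsto (fun N : ℕ => (n N : ℝ) / N) atTop (𝓝 |t - s|) := by
    refine (hk'.sub hl').abs.congr fun N => ?_
    rw [← sub_div, abs_div, Nat.abs_cast, hn]
    simp only
    rw [Nat.cast_natAbs]
    push_cast
    rfl
  have hninf : Tendsto n atTop atTop := by
    rw [← tendsto_natCast_atTop_iff (R := ℝ)]
    have := hnd.pos_mul_atTop hd tendsto_natCast_atTop_atTop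
    refine this.congr' ?_
    filter_upwards [eventually_gt_atTop 0] with N hN
    have : (N : ℝ) ≠ 0 := by positivity
    field_simp
  have h1 := (tendsto_phiReal hα).comp hninf
  have h2 : Tendsto (fun N : ℕ => ((n N : ℝ) / N) ^ (-(1 + α))) atTop
      (𝓝 (|t - s| ^ (-(1 + α)))) := hnd.rpow_const (Or.inl hd.ne')
  have h3 : Tendsto (fun N : ℕ => G (l N / N) - G t) atTop (𝓝 (G s - G t)) :=
    (hG.tendsto.comp hl').sub_const _
  refine ((h2.mul h1).mul h3).congr' ?_
  filter_upwards [eventually_gt_atTop 0, hninf.eventually_gt_atTop 0] with N hN hnN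
  have hN' : (0 : ℝ) < N := by exact_mod_cast hN
  have hnN' : (0 : ℝ) < n N := by exact_mod_cast hnN
  have hp : (0 : ℝ) < (n N : ℝ) ^ (1 + α) := by positivity
  have hp' : (0 : ℝ) < (N : ℝ) ^ (1 + α) := by positivity
  rw [Real.div_rpow hnN'.le hN'.le, Real.rpow_neg hnN'.le, Real.rpow_neg hN'.le]
  change _ = (N : ℝ) ^ (1 + α) * (phiReal α (n N) * (G (l N / N) - G t))
  simp only [Function.comp_apply]
  field_simp

/-- The mean of two consecutive terms of the lattice sum, as a step function of position. -/
noncomputable def latticeMean (α t : ℝ) (G : ℝ → ℝ) (N : ℕ) (l : ℤ) : ℝ :=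
  (latticeTerm α t G N l + latticeTerm α t G N (l + 1)) / 2

/-- The pointwise limit of the averaged lattice terms. -/
noncomputable def marchaudIntegrand (α t : ℝ) (G : ℝ → ℝ) (s : ℝ) : ℝ :=
  (Set.Iio t).indicator
    (fun s => (2 ^ α / Real.Gamma (-α)) * ((t - s) ^ (-(1 + α)) * (G s - G t))) s

lemma tendsto_latticeMean {α t s : ℝ} {G : ℝ → ℝ} (hα : α ∈ Set.Ioo (0 : ℝ) 1)
    (hst : s ≠ t) (hG : ContinuousAt G s) :
    Tendsto (fun N : ℕ => latticeMean α t G N ⌊(N : ℝ) * s⌋) atTop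
      (𝓝 (marchaudIntegrand α t G s)) := by
  have hl0 : ∀ᶠ N : ℕ in atTop, |s - (⌊(N : ℝ) * s⌋ : ℝ) / N| ≤ 1 / N := by
    filter_upwards [eventually_gt_atTop 0] with N hN using abs_sub_floor_div_le hN s
  have hl1 : ∀ᶠ N : ℕ in atTop, |s - ((⌊(N : ℝ) * s⌋ + 1 : ℤ) : ℝ) / N| ≤ 1 / N := by
    filter_upwards [eventually_gt_atTop 0] with N hN using abs_sub_floor_add_one_div_le hN s
  have h0 := tendsto_natAbs_latticeTerm hα hst hG hl0
  have h1 := tendsto_natAbs_latticeTerm hα hst hG hl1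
  rcases lt_or_gt_of_ne hst with h | h
  · rw [marchaudIntegrand, Set.indicator_of_mem (by exact h)]
    have h2 := (h0.add h1).div_const 2
    have hgap : Tendsto (fun N : ℕ => (N : ℝ) * (t - s)) atTop atTop :=
      tendsto_natCast_atTop_atTop.atTop_mul_const (by linarith)
    have he : (|t - s| ^ (-(1 + α)) * (2 ^ α / Real.Gamma (-α)) * (G s - G t) +
        |t - s| ^ (-(1 + α)) * (2 ^ α / Real.Gamma (-α)) * (G s - G t)) / 2 =
        (2 ^ α / Real.Gamma (-α)) * ((t - s) ^ (-(1 + α)) * (G s - G t)) := by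
      rw [abs_of_pos (by linarith)]
      ring
    rw [he] at h2
    refine h2.congr' ?_
    filter_upwards [hgap.eventually_gt_atTop 2] with N hN
    have hfl : ⌊(N : ℝ) * s⌋ + 1 ≤ ⌊(N : ℝ) * t⌋ := by
      rw [Int.le_floor]
      push_cast
      linarith [Int.floor_le ((N : ℝ) * s)]
    rw [latticeMean, latticeTerm, latticeTerm, Int.natAbs_of_nonneg (by omega),
      Int.natAbs_of_nonneg (by omega)]
  · rw [marchaudIntegrand, Set.indicator_of_notMem (by simpa using h.le)]
    have h2 := ((h0.sub h1).abs).div_const 2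
    rw [sub_self, abs_zero, zero_div] at h2
    refine squeeze_zero_norm' ?_ h2
    filter_upwards with N
    have hfl : ⌊(N : ℝ) * t⌋ ≤ ⌊(N : ℝ) * s⌋ := Int.floor_mono (by gcongr)
    set k := ⌊(N : ℝ) * t⌋
    set m := ⌊(N : ℝ) * s⌋
    obtain ⟨n, hn⟩ := Int.eq_ofNat_of_zero_le (sub_nonneg.2 hfl)
    have e0 : k - m = -(n : ℤ) := by omega
    have e1 : k - (m + 1) = -((n + 1 : ℕ) : ℤ) := by push_cast; omega
    rw [latticeMean, latticeTerm, latticeTerm, e0, e1, Int.natAbs_neg, Int.natAbs_neg,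
      Int.natAbs_natCast, Int.natAbs_natCast, phiReal_neg_natCast, phiReal_neg_natCast,
      Real.norm_eq_abs, abs_div, abs_two]
    apply le_of_eq
    congr 1
    rw [← abs_neg_one_pow_mul n]
    congr 1
    have hsq : ((-1 : ℝ) ^ n) * (-1) ^ n = 1 := by
      rw [← pow_add, ← two_mul, pow_mul]
      simp
    rw [pow_succ]
    linear_combination ((N : ℝ) ^ (1 + α) * (phiReal α n * (G (m / N) - G t)) -
      (N : ℝ) ^ (1 + α) * (phiReal α (n + 1 : ℕ) * (G ((m + 1 : ℤ) / N) - G t))) * hsq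

lemma tendsto_integral_latticeMean {α γ t C : ℝ} {G : ℝ → ℝ} (hα : α ∈ Set.Ioo (0 : ℝ) 1)
    (ht : t ∈ Set.Ioo (0 : ℝ) 1) (hγ0 : 0 ≤ γ) (hγ1 : γ < 1) (hC : 0 ≤ C)
    (hG : ∀ s, |G s - G t| ≤ C * (min 1 |s - t| * endpointWeight γ s))
    (hcont : ∀ s, s ≠ 0 → s ≠ 1 → ContinuousAt G s) :
    (∀ N : ℕ, 0 < N → Integrable (fun s : ℝ => latticeMean α t G N ⌊(N : ℝ) * s⌋)) ∧
    Integrable (marchaudIntegrand α t G) ∧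
    Tendsto (fun N : ℕ => ∫ s : ℝ, latticeMean α t G N ⌊(N : ℝ) * s⌋) atTop
      (𝓝 (∫ s, marchaudIntegrand α t G s)) := by
  obtain ⟨K, hK⟩ := exists_abs_latticeTerm_le hα hγ0 hγ1 hC hG
  have hne : ∀ᵐ s : ℝ, s ≠ 0 ∧ s ≠ 1 ∧ s ≠ t := by
    have h : ∀ p : ℝ, ∀ᵐ s : ℝ, s ≠ p := fun p => by simp [ae_iff]
    filter_upwards [h 0, h 1, h t] with s h0 h1 h2 using ⟨h0, h1, h2⟩
  have hbint := (integrable_kernelBound_mul_endpointWeight hα hγ0 hγ1 ht).const_mul K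
  have hmeas : ∀ N : ℕ, AEStronglyMeasurable
      (fun s : ℝ => latticeMean α t G N ⌊(N : ℝ) * s⌋) volume := fun N =>
    ((Measurable.of_discrete (f := latticeMean α t G N)).comp
      (Int.measurable_floor.comp (measurable_const_mul (N : ℝ)))).aestronglyMeasurable
  have hbound : ∀ N : ℕ, 0 < N → ∀ᵐ s : ℝ, ‖latticeMean α t G N ⌊(N : ℝ) * s⌋‖ ≤
      K * (kernelBound α (s - t) * endpointWeight γ s) := by
    intro N hN
    filter_upwards [hne] with s hs
    have h0 := hK N hN ⌊(N : ℝ) * s⌋ s hs.1 hs.2.1 hs.2.2 (abs_sub_floor_div_le hN s)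
    have h1 := hK N hN (⌊(N : ℝ) * s⌋ + 1) s hs.1 hs.2.1 hs.2.2
      (abs_sub_floor_add_one_div_le hN s)
    rw [Real.norm_eq_abs, latticeMean, abs_div, abs_two]
    have := abs_add_le (latticeTerm α t G N ⌊(N : ℝ) * s⌋)
      (latticeTerm α t G N (⌊(N : ℝ) * s⌋ + 1))
    linarith
  have hlim : ∀ᵐ s : ℝ, Tendsto (fun N : ℕ => latticeMean α t G N ⌊(N : ℝ) * s⌋) atTop
      (𝓝 (marchaudIntegrand α t G s)) := by
    filter_upwards [hne] with s hs
    exact tendsto_latticeMean hα hs.2.2 (hcont s hs.1 hs.2.1)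
  refine ⟨fun N hN => hbint.mono' (hmeas N) (hbound N hN), ?_, ?_⟩
  · refine hbint.mono' (aestronglyMeasurable_of_tendsto_ae atTop hmeas hlim) ?_
    have hall : ∀ᵐ s : ℝ, ∀ N : ℕ, 0 < N → ‖latticeMean α t G N ⌊(N : ℝ) * s⌋‖ ≤
        K * (kernelBound α (s - t) * endpointWeight γ s) := by
      rw [ae_all_iff]
      intro N
      by_cases hN : 0 < N
      · filter_upwards [hbound N hN] with s hs _ using hs
      · exact ae_of_all _ fun s h => absurd h hN
    filter_upwards [hall, hlim] with s hs hl
    refine le_of_tendsto hl.norm ?_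
    filter_upwards [eventually_gt_atTop 0] with N hN using hs N hN
  · exact tendsto_integral_filter_of_dominated_convergence _
      (Eventually.of_forall hmeas)
      (by filter_upwards [eventually_gt_atTop 0] with N hN using hbound N hN) hbint hlim

lemma integral_latticeMean_eq_sum {α t : ℝ} {G : ℝ → ℝ} (hα : α ∈ Set.Ioo (0 : ℝ) 1)
    (hsupp : ∀ s, s ∉ Set.Ioo (0 : ℝ) 1 → G s = 0) {N : ℕ} (hN : 0 < N)
    (hInt : Integrable (fun s : ℝ => latticeMean α t G N ⌊(N : ℝ) * s⌋)) :
    ∫ s : ℝ, latticeMean α t G N ⌊(N : ℝ) * s⌋ =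
      (N : ℝ) ^ α * ∑ l ∈ Finset.range (N + 1),
        phiReal α (⌊(N : ℝ) * t⌋ - (l : ℤ)) * G ((l : ℝ) / N) := by
  have hN' : (0 : ℝ) < N := by exact_mod_cast hN
  set k := ⌊(N : ℝ) * t⌋ with hk
  have h1 := hasSum_integral_floor_mul hN' hInt
  have hφ : HasSum (fun l : ℤ => phiReal α (k - l)) 0 := by
    rw [← tsum_phiReal hα, ← (Equiv.subLeft k).tsum_eq (phiReal α)]
    exact ((Equiv.subLeft k).summable_iff.2 (summable_phiReal hα)).hasSum
  have hfin : HasSum (fun l : ℤ => phiReal α (k - l) * G ((l : ℝ) / N))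
      (∑ l ∈ Finset.range (N + 1), phiReal α (k - (l : ℤ)) * G ((l : ℝ) / N)) := by
    have hinj : Function.Injective (fun n : ℕ => (n : ℤ)) := Nat.cast_injective
    have hz : ∀ l : ℤ, (l ≤ 0 ∨ (N : ℤ) ≤ l) → G ((l : ℝ) / N) = 0 := by
      intro l hl
      apply hsupp
      rintro ⟨h0, h1⟩
      rw [div_lt_one hN'] at h1
      have h0' : (0 : ℝ) < l := by
        by_contra h
        exact absurd h0 (not_lt.2 (div_nonpos_of_nonpos_of_nonneg (not_lt.1 h) hN'.le))
      have h0'' : 0 < l := by exact_mod_cast h0'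
      have h1' : l < N := by exact_mod_cast h1
      omega
    rw [← hinj.hasSum_iff]
    · refine (hasSum_sum_of_ne_finset_zero (s := Finset.range (N + 1))
        (f := (fun l : ℤ => phiReal α (k - l) * G ((l : ℝ) / N)) ∘ fun n : ℕ => (n : ℤ)) ?_)
      intro n hn
      rw [Finset.mem_range] at hn
      simp only [Function.comp_apply]
      rw [hz n (by omega), mul_zero]
    · intro l hl
      rw [hz l, mul_zero]
      left
      by_contra h
      exact hl ⟨l.toNat, by simp only; omega⟩
  have hA : HasSum (latticeTerm α t G N) ((N : ℝ) ^ (1 + α) *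
      ∑ l ∈ Finset.range (N + 1), phiReal α (k - (l : ℤ)) * G ((l : ℝ) / N)) := by
    have h2 := (hfin.sub (hφ.mul_right (G t))).mul_left ((N : ℝ) ^ (1 + α))
    rw [zero_mul, sub_zero] at h2
    refine h2.congr_fun fun l => ?_
    rw [latticeTerm]
    ring
  have hA' : HasSum (fun l : ℤ => latticeTerm α t G N (l + 1)) ((N : ℝ) ^ (1 + α) *
      ∑ l ∈ Finset.range (N + 1), phiReal α (k - (l : ℤ)) * G ((l : ℝ) / N)) :=
    (Equiv.addRight (1 : ℤ)).hasSum_iff.2 hA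
  have h3 := h1.unique ((hA.add hA').div_const 2)
  rw [Real.rpow_add hN', Real.rpow_one] at h3
  have h4 : (N : ℝ) * ∫ s : ℝ, latticeMean α t G N ⌊(N : ℝ) * s⌋ =
      N * ((N : ℝ) ^ α * ∑ l ∈ Finset.range (N + 1),
        phiReal α (k - (l : ℤ)) * G ((l : ℝ) / N)) := by
    rw [h3]
    ring
  exact mul_left_cancel₀ hN'.ne' h4

lemma integral_Iic_zero_sub_rpow {α t : ℝ} (hα : 0 < α) (ht : 0 < t) :
    ∫ s in Set.Iic (0 : ℝ), (t - s) ^ (-(1 + α)) = t ^ (-α) / α := by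
  have h1 : ∫ s in Set.Iic (0 : ℝ), (t - s) ^ (-(1 + α)) =
      ∫ v in Set.Ioi (0 : ℝ), (t + v) ^ (-(1 + α)) := by
    have := integral_comp_neg_Iic (0 : ℝ) (fun v : ℝ => (t + v) ^ (-(1 + α)))
    simpa only [neg_zero, ← sub_eq_add_neg] using this
  have h2 : ∫ v in Set.Ioi (0 : ℝ), (t + v) ^ (-(1 + α)) =
      ∫ w in Set.Ioi t, w ^ (-(1 + α)) := by
    rw [← integral_indicator measurableSet_Ioi, ← integral_indicator measurableSet_Ioi,
      ← integral_add_left_eq_self ((Set.Ioi t).indicator fun w : ℝ => w ^ (-(1 + α))) t]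
    congr 1
    ext v
    simp [Set.indicator]
  rw [h1, h2, integral_Ioi_rpow_of_lt (by linarith) ht,
    show -(1 + α) + 1 = -α by ring, neg_div_neg_eq]

lemma integral_marchaudIntegrand {α t : ℝ} {G : ℝ → ℝ} (hα : 0 < α) (ht : 0 < t)
    (hneg : ∀ s, s ≤ 0 → G s = 0) (hInt : Integrable (marchaudIntegrand α t G)) :
    ∫ s, marchaudIntegrand α t G s = (2 ^ α / Real.Gamma (-α)) *
      ((∫ s in (0 : ℝ)..t, (t - s) ^ (-(1 + α)) * (G s - G t)) - G t * (t ^ (-α) / α)) := by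
  set L := (2 : ℝ) ^ α / Real.Gamma (-α) with hL
  have hm : marchaudIntegrand α t G = (Set.Iio t).indicator
      (fun s => L * ((t - s) ^ (-(1 + α)) * (G s - G t))) := rfl
  have hon : IntegrableOn (fun s => L * ((t - s) ^ (-(1 + α)) * (G s - G t))) (Set.Iio t) := by
    rw [hm, integrable_indicator_iff measurableSet_Iio] at hInt
    exact hInt
  have hU : Set.Iio t = Set.Iic 0 ∪ Set.Ioo 0 t := (Set.Iic_union_Ioo_eq_Iio ht).symm
  rw [hm, integral_indicator measurableSet_Iio, hU, setIntegral_union _ measurableSet_Ioo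
    (hon.mono_set (by rw [hU]; exact Set.subset_union_left))
    (hon.mono_set (by rw [hU]; exact Set.subset_union_right))]
  · have h1 : ∫ s in Set.Iic (0 : ℝ), L * ((t - s) ^ (-(1 + α)) * (G s - G t)) =
        L * ((t ^ (-α) / α) * (-G t)) := by
      rw [← integral_Iic_zero_sub_rpow hα ht, ← integral_mul_const, ← integral_const_mul]
      refine setIntegral_congr_fun measurableSet_Iic fun s hs => ?_
      rw [hneg s hs, zero_sub]
    rw [h1, intervalIntegral.integral_of_le ht.le, ← integral_Ioc_eq_integral_Ioo,
      integral_const_mul]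
    ring
  · rw [Set.disjoint_left]
    intro s hs hs'
    exact absurd hs'.1 (not_lt.2 hs)

/-- The increment of a locally Lipschitz function on `(0, 1)`, extended by zero, is controlled by
the distance and the endpoint weight. -/
lemma exists_abs_indicator_sub_le {γ t C₀ C₁ h₀ h₁ : ℝ} {F : ℝ → ℝ}
    (ht : t ∈ Set.Ioo (0 : ℝ) 1)
    (hlip : ∀ c d : ℝ, 0 < c → c ≤ d → d < 1 →
      ∃ K : ℝ, ∀ z ∈ Set.Icc c d, ∀ z' ∈ Set.Icc c d, |F z - F z'| ≤ K * |z - z'|)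
    (hh₀ : 0 < h₀) (hh₁ : 0 < h₁)
    (hF₀ : ∀ s ∈ Set.Ioo 0 h₀, |F s| ≤ C₀ * s ^ (-γ))
    (hF₁ : ∀ s ∈ Set.Ioo 0 h₁, |F (1 - s)| ≤ C₁ * s ^ (-γ)) :
    ∃ C : ℝ, 0 ≤ C ∧ ∀ s, |(Set.Ioo (0 : ℝ) 1).indicator F s - (Set.Ioo (0 : ℝ) 1).indicator F t| ≤
      C * (min 1 |s - t| * endpointWeight γ s) := by
  obtain ⟨ht0, ht1⟩ := ht
  set c := min h₀ t / 2 with hc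
  set e := min h₁ (1 - t) / 2 with he
  have hm0 : 0 < min h₀ t := lt_min hh₀ ht0
  have hm1 : 0 < min h₁ (1 - t) := lt_min hh₁ (by linarith)
  have hc0 : 0 < c := by positivity
  have he0 : 0 < e := by positivity
  have hch : c < h₀ := by have := min_le_left h₀ t; linarith
  have hct : c < t := by have := min_le_right h₀ t; linarith
  have heh : e < h₁ := by have := min_le_left h₁ (1 - t); linarith
  have het : e < 1 - t := by have := min_le_right h₁ (1 - t); linarith
  obtain ⟨K, hK⟩ := hlip c (1 - e) hc0 (by linarith) (by linarith)
  set δ := min 1 (min (t - c) (1 - e - t)) with hδ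
  have hδ0 : 0 < δ := lt_min one_pos (lt_min (by linarith) (by linarith))
  set M := |C₀| + |C₁| + |F t| with hM
  have hM0 : 0 ≤ M := by positivity
  refine ⟨|K| + M / δ, by positivity, fun s => ?_⟩
  rw [Set.indicator_of_mem (show t ∈ Set.Ioo (0 : ℝ) 1 from ⟨ht0, ht1⟩)]
  have hw := one_le_endpointWeight γ s
  have hmin : 0 ≤ min 1 |s - t| := le_min zero_le_one (abs_nonneg _)
  by_cases hs : s ∈ Set.Icc c (1 - e)
  · rw [Set.indicator_of_mem (show s ∈ Set.Ioo (0 : ℝ) 1 from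
      ⟨by linarith [hs.1], by linarith [hs.2]⟩)]
    have h1 := hK s hs t ⟨hct.le, by linarith⟩
    have h2 : |s - t| ≤ 1 := by
      rw [abs_le]
      constructor <;> linarith [hs.1, hs.2]
    rw [min_eq_right h2]
    have h3 : 0 ≤ M / δ * (|s - t| * endpointWeight γ s) := by positivity
    have h4 : |K| * |s - t| ≤ |K| * (|s - t| * endpointWeight γ s) := by
      gcongr
      exact le_mul_of_one_le_right (abs_nonneg _) hw
    have h5 : K * |s - t| ≤ |K| * |s - t| := by
      gcongr
      exact le_abs_self K
    linarith
  · have hdist : δ ≤ min 1 |s - t| := by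
      refine le_min (min_le_left _ _) ?_
      rw [Set.mem_Icc, not_and_or, not_le, not_le] at hs
      rcases hs with hs | hs
      · refine (min_le_right _ _).trans ((min_le_left _ _).trans ?_)
        rw [abs_sub_comm]
        exact le_trans (by linarith) (le_abs_self _)
      · refine (min_le_right _ _).trans ((min_le_right _ _).trans ?_)
        exact le_trans (by linarith) (le_abs_self _)
    have hval : |(Set.Ioo (0 : ℝ) 1).indicator F s| ≤ (|C₀| + |C₁|) * endpointWeight γ s := by
      have hp0 : 0 ≤ |s| ^ (-γ) := by positivity
      have hp1 : 0 ≤ |1 - s| ^ (-γ) := by positivity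
      by_cases hs01 : s ∈ Set.Ioo (0 : ℝ) 1
      · rw [Set.indicator_of_mem hs01]
        rw [Set.mem_Icc, not_and_or, not_le, not_le] at hs
        rcases hs with hs | hs
        · have h1 := hF₀ s ⟨hs01.1, by linarith⟩
          calc |F s| ≤ C₀ * s ^ (-γ) := h1
            _ ≤ |C₀| * |s| ^ (-γ) := by
              rw [abs_of_pos hs01.1] at hp0 ⊢
              exact mul_le_mul_of_nonneg_right (le_abs_self _) hp0
            _ ≤ (|C₀| + |C₁|) * endpointWeight γ s := by
              gcongr
              · linarith [abs_nonneg C₁]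
              · unfold endpointWeight
                linarith
        · have h1 := hF₁ (1 - s) ⟨by linarith [hs01.2], by linarith⟩
          rw [sub_sub_cancel] at h1
          calc |F s| ≤ C₁ * (1 - s) ^ (-γ) := h1
            _ ≤ |C₁| * |1 - s| ^ (-γ) := by
              rw [abs_of_pos (by linarith [hs01.2] : 0 < 1 - s)] at hp1 ⊢
              exact mul_le_mul_of_nonneg_right (le_abs_self _) hp1
            _ ≤ (|C₀| + |C₁|) * endpointWeight γ s := by
              gcongr
              · linarith [abs_nonneg C₀]
              · unfold endpointWeight
                linarith
      · rw [Set.indicator_of_notMem hs01, abs_zero]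
        positivity
    have h1 : |(Set.Ioo (0 : ℝ) 1).indicator F s - F t| ≤ M * endpointWeight γ s := by
      have h2 := abs_sub ((Set.Ioo (0 : ℝ) 1).indicator F s) (F t)
      have h3 : |F t| ≤ |F t| * endpointWeight γ s := le_mul_of_one_le_right (abs_nonneg _) hw
      have h4 : M * endpointWeight γ s =
        (|C₀| + |C₁|) * endpointWeight γ s + |F t| * endpointWeight γ s := by rw [hM]; ring
      linarith
    calc |(Set.Ioo (0 : ℝ) 1).indicator F s - F t| ≤ M * endpointWeight γ s := h1
      _ = M / δ * (δ * endpointWeight γ s) := by field_simp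
      _ ≤ (|K| + M / δ) * (min 1 |s - t| * endpointWeight γ s) := by
        gcongr
        linarith [abs_nonneg K]

lemma continuousAt_indicator_of_lipschitz {F : ℝ → ℝ}
    (hlip : ∀ c d : ℝ, 0 < c → c ≤ d → d < 1 →
      ∃ K : ℝ, ∀ z ∈ Set.Icc c d, ∀ z' ∈ Set.Icc c d, |F z - F z'| ≤ K * |z - z'|)
    {s : ℝ} (hs0 : s ≠ 0) (hs1 : s ≠ 1) :
    ContinuousAt ((Set.Ioo (0 : ℝ) 1).indicator F) s := by
  by_cases hs : s ∈ Set.Ioo (0 : ℝ) 1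
  · obtain ⟨K, hK⟩ := hlip (s / 2) ((1 + s) / 2) (by linarith [hs.1]) (by linarith)
      (by linarith [hs.2])
    have hF : ContinuousAt F s := by
      rw [ContinuousAt, tendsto_iff_norm_sub_tendsto_zero]
      have h0 : Tendsto (fun z => K * |z - s|) (𝓝 s) (𝓝 0) := by
        have : ContinuousAt (fun z => K * |z - s|) s := by fun_prop
        simpa using this.tendsto
      refine squeeze_zero' (Eventually.of_forall fun _ => norm_nonneg _) ?_ h0
      filter_upwards [Icc_mem_nhds (by linarith [hs.1] : s / 2 < s)
        (by linarith [hs.2] : s < (1 + s) / 2)] with z hz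
      exact hK z hz s ⟨by linarith [hs.1], by linarith [hs.2]⟩
    refine hF.congr ?_
    filter_upwards [isOpen_Ioo.mem_nhds hs] with z hz
    rw [Set.indicator_of_mem hz]
  · have hout : s ∈ (Set.Icc (0 : ℝ) 1)ᶜ := fun h =>
      hs ⟨lt_of_le_of_ne h.1 hs0.symm, lt_of_le_of_ne h.2 hs1⟩
    refine (continuousAt_const (y := (0 : ℝ))).congr ?_
    filter_upwards [isClosed_Icc.isOpen_compl.mem_nhds hout] with z hz
    rw [Set.indicator_of_notMem fun h => hz ⟨h.1.le, h.2.le⟩]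

/-- Convergence of the fractional differences on the unit interval. -/
lemma tendsto_sum_phiReal_unitInterval {α γ t C₀ C₁ h₀ h₁ : ℝ} {F : ℝ → ℝ}
    (hα : α ∈ Set.Ioo (0 : ℝ) 1) (ht : t ∈ Set.Ioo (0 : ℝ) 1) (hγ0 : 0 ≤ γ) (hγ1 : γ < 1)
    (hlip : ∀ c d : ℝ, 0 < c → c ≤ d → d < 1 →
      ∃ K : ℝ, ∀ z ∈ Set.Icc c d, ∀ z' ∈ Set.Icc c d, |F z - F z'| ≤ K * |z - z'|)
    (hh₀ : 0 < h₀) (hh₁ : 0 < h₁)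
    (hF₀ : ∀ s ∈ Set.Ioo 0 h₀, |F s| ≤ C₀ * s ^ (-γ))
    (hF₁ : ∀ s ∈ Set.Ioo 0 h₁, |F (1 - s)| ≤ C₁ * s ^ (-γ)) :
    Tendsto (fun N : ℕ => (N : ℝ) ^ α * ∑ l ∈ Finset.range (N + 1),
        phiReal α (⌊(N : ℝ) * t⌋ - (l : ℤ)) * (Set.Ioo (0 : ℝ) 1).indicator F ((l : ℝ) / N)) atTop
      (𝓝 ((2 ^ α / Real.Gamma (-α)) *
        ((∫ s in (0 : ℝ)..t, (t - s) ^ (-(1 + α)) * (F s - F t)) - F t * (t ^ (-α) / α)))) := by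
  obtain ⟨C, hC, hG⟩ := exists_abs_indicator_sub_le ht hlip hh₀ hh₁ hF₀ hF₁
  obtain ⟨hInt, hInt', hlim⟩ := tendsto_integral_latticeMean hα ht hγ0 hγ1 hC hG
    fun s hs0 hs1 => continuousAt_indicator_of_lipschitz hlip hs0 hs1
  have hsupp : ∀ s, s ∉ Set.Ioo (0 : ℝ) 1 → (Set.Ioo (0 : ℝ) 1).indicator F s = 0 :=
    fun s hs => Set.indicator_of_notMem hs _
  have hval := integral_marchaudIntegrand hα.1 ht.1
    (fun s hs => hsupp s fun h => absurd h.1 (not_lt.2 hs)) hInt'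
  have hcongr : ∫ s in (0 : ℝ)..t, (t - s) ^ (-(1 + α)) *
      ((Set.Ioo (0 : ℝ) 1).indicator F s - (Set.Ioo (0 : ℝ) 1).indicator F t) =
      ∫ s in (0 : ℝ)..t, (t - s) ^ (-(1 + α)) * (F s - F t) := by
    rw [intervalIntegral.integral_of_le ht.1.le, intervalIntegral.integral_of_le ht.1.le]
    refine setIntegral_congr_fun measurableSet_Ioc fun s hs => ?_
    rw [Set.indicator_of_mem ht,
      Set.indicator_of_mem (show s ∈ Set.Ioo (0 : ℝ) 1 from ⟨hs.1, hs.2.trans_lt ht.2⟩)]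
  rw [hcongr, Set.indicator_of_mem ht] at hval
  rw [← hval]
  refine hlim.congr' ?_
  filter_upwards [eventually_gt_atTop 0] with N hN
  exact integral_latticeMean_eq_sum hα hsupp hN (hInt N hN)

lemma exists_abs_le_mul_rpow_of_isBigO {γ c : ℝ} {g : ℝ → ℝ} (hc : 0 < c)
    (hg : g =O[𝓝[>] 0] fun h : ℝ => h ^ (-γ)) :
    ∃ C h₀ : ℝ, 0 < h₀ ∧ ∀ s ∈ Set.Ioo 0 h₀, |g (c * s)| ≤ C * s ^ (-γ) := by
  obtain ⟨C, hC⟩ := hg.bound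
  obtain ⟨ε, hε, hεs⟩ := mem_nhdsGT_iff_exists_Ioo_subset.1 hC
  rw [Set.mem_Ioi] at hε
  refine ⟨C * c ^ (-γ), ε / c, by positivity, fun s hs => ?_⟩
  have hcs : c * s ∈ Set.Ioo 0 ε := ⟨mul_pos hc hs.1, by
    have := (lt_div_iff₀ hc).1 hs.2
    linarith⟩
  have h := hεs hcs
  rw [Set.mem_ofPred_eq, Real.norm_eq_abs, Real.norm_of_nonneg (Real.rpow_nonneg hcs.1.le _),
    Real.mul_rpow hc.le hs.1.le, ← mul_assoc] at h
  exact h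

lemma XvecAB_eq_indicator (f : ℝ → ℝ) (a b : ℝ) {N l : ℕ} (hN : 0 < N) (hl : l ≤ N) :
    XvecAB f a b N l =
      (Set.Ioo (0 : ℝ) 1).indicator (fun s => f (a + (b - a) * s)) ((l : ℝ) / N) := by
  have hN' : (0 : ℝ) < N := by exact_mod_cast hN
  by_cases h : l = 0 ∨ l = N
  · rw [XvecAB, if_pos h, Set.indicator_of_notMem]
    rintro ⟨h1, h2⟩
    rcases h with rfl | rfl
    · simp at h1
    · simp [hN'.ne'] at h2
  · rw [XvecAB, if_neg h, Set.indicator_of_mem, mul_div_assoc]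
    push Not at h
    have h0 : (0 : ℝ) < l := by exact_mod_cast Nat.pos_of_ne_zero h.1
    have h1 : (l : ℝ) < N := by exact_mod_cast lt_of_le_of_ne hl h.2
    exact ⟨by positivity, (div_lt_one hN').2 h1⟩

lemma marchaud_expression_rescale {α a b x : ℝ} (f : ℝ → ℝ) (hab : a < b)
    (hx : x ∈ Set.Ioo a b) :
    (∫ s in (0 : ℝ)..(x - a) / (b - a), ((x - a) / (b - a) - s) ^ (-(1 + α)) *
        (f (a + (b - a) * s) - f x)) - f x * (((x - a) / (b - a)) ^ (-α) / α) =
      (b - a) ^ α * ((∫ u in a..x, (x - u) ^ (-α - 1) * (f u - f x)) -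
        f x * ((x - a) ^ (-α) / α)) := by
  have hc : 0 < b - a := sub_pos.2 hab
  have hxa : 0 < x - a := sub_pos.2 hx.1
  have hpow : (b - a) ^ α * (b - a) ^ (-α - 1) * (b - a) = 1 := by
    rw [← Real.rpow_add hc, ← Real.rpow_add_one hc.ne']
    ring_nf
    exact Real.rpow_zero _
  have hend : a + (b - a) * ((x - a) / (b - a)) = x := by
    field_simp
    ring
  have hsub := intervalIntegral.mul_integral_comp_add_mul (a := 0) (b := (x - a) / (b - a))
    (f := fun u => (x - u) ^ (-α - 1) * (f u - f x)) (b - a) a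
  rw [mul_zero, add_zero, hend] at hsub
  have hI : ∫ s in (0 : ℝ)..(x - a) / (b - a),
      (x - (a + (b - a) * s)) ^ (-α - 1) * (f (a + (b - a) * s) - f x) =
      (b - a) ^ (-α - 1) * ∫ s in (0 : ℝ)..(x - a) / (b - a),
        ((x - a) / (b - a) - s) ^ (-(1 + α)) * (f (a + (b - a) * s) - f x) := by
    rw [← intervalIntegral.integral_const_mul]
    refine intervalIntegral.integral_congr fun s hs => ?_
    rw [Set.uIcc_of_le (by positivity)] at hs
    have hxs : x - (a + (b - a) * s) = (b - a) * ((x - a) / (b - a) - s) := by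
      field_simp
      ring
    rw [hxs, Real.mul_rpow hc.le (sub_nonneg.2 hs.2), show -α - 1 = -(1 + α) by ring, mul_assoc]
  have hrpow : ((x - a) / (b - a)) ^ (-α) = (b - a) ^ α * (x - a) ^ (-α) := by
    rw [Real.div_rpow hxa.le hc.le, Real.rpow_neg hc.le, div_inv_eq_mul, mul_comm]
  rw [← hsub, hI, hrpow]
  linear_combination (-(∫ s in (0 : ℝ)..(x - a) / (b - a),
    ((x - a) / (b - a) - s) ^ (-(1 + α)) * (f (a + (b - a) * s) - f x))) * hpow

/-- On an interval `(a,b)`, for `f` Lipschitz on closed subintervals of `(a,b)` with the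
`O(h^{-γ})` behaviour at the endpoints, the fractional derivative `D_{α,a,b}(f)(x)` exists
and admits the Marchaud-type integral expression. -/
theorem fractional_derivative_interval (α : ℝ) (hα : α ∈ Set.Ioo (0 : ℝ) 1)
    (a b : ℝ) (hab : a < b) (f : ℝ → ℝ)
    (hlip : ∀ c d : ℝ, a < c → c ≤ d → d < b →
      ∃ K : ℝ, ∀ z ∈ Set.Icc c d, ∀ z' ∈ Set.Icc c d, |f z - f z'| ≤ K * |z - z'|)
    (hO : ∃ γ : ℝ, 0 ≤ γ ∧ γ ≤ 1 - α ∧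
      ((fun h : ℝ => f (a + h)) =O[nhdsWithin 0 (Set.Ioi 0)] fun h : ℝ => h ^ (-γ)) ∧
      ((fun h : ℝ => f (b - h)) =O[nhdsWithin 0 (Set.Ioi 0)] fun h : ℝ => h ^ (-γ)))
    (x : ℝ) (hx : x ∈ Set.Ioo a b) :
    Tendsto
      (fun N : ℕ => (((N : ℝ) ^ α : ℝ) : ℂ) *
        ∑ l ∈ Finset.range (N + 1),
          phiHat α (⌊(N : ℝ) * ((x - a) / (b - a))⌋ - (l : ℤ)) * ((XvecAB f a b N l : ℝ) : ℂ))
      atTop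
      (nhds ((((b - a) ^ α * ((2 : ℝ) ^ α / Real.Gamma (-α)) *
        ((∫ u in a..x, (x - u) ^ (-α - 1) * (f u - f x)) -
          f x * ((x - a) ^ (-α) / α)) : ℝ) : ℂ))) := by

  obtain ⟨γ, hγ0, hγ1, hOa, hOb⟩ := hO
  have hc : 0 < b - a := sub_pos.2 hab
  have ht : (x - a) / (b - a) ∈ Set.Ioo (0 : ℝ) 1 :=
    ⟨div_pos (sub_pos.2 hx.1) hc, (div_lt_one hc).2 (by linarith [hx.2])⟩
  have hend : a + (b - a) * ((x - a) / (b - a)) = x := by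
    field_simp
    ring
  obtain ⟨C₀, h₀, hh₀, hF₀⟩ := exists_abs_le_mul_rpow_of_isBigO hc hOa
  obtain ⟨C₁, h₁, hh₁, hF₁⟩ := exists_abs_le_mul_rpow_of_isBigO hc hOb
  have hlim := tendsto_sum_phiReal_unitInterval (F := fun s => f (a + (b - a) * s)) hα ht hγ0
    (by linarith [hα.1])
    (by
      intro c d h0 hcd h1
      obtain ⟨K, hK⟩ := hlip (a + (b - a) * c) (a + (b - a) * d)
        (by linarith [mul_pos hc h0]) (by gcongr) (by nlinarith)
      refine ⟨K * (b - a), fun z hz z' hz' => ?_⟩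
      have hmem : ∀ w ∈ Set.Icc c d,
          a + (b - a) * w ∈ Set.Icc (a + (b - a) * c) (a + (b - a) * d) := fun w hw =>
        ⟨by have := hw.1; gcongr, by have := hw.2; gcongr⟩
      refine (hK _ (hmem z hz) _ (hmem z' hz')).trans_eq ?_
      rw [add_sub_add_left_eq_sub, ← mul_sub, abs_mul, abs_of_pos hc, mul_assoc])
    hh₀ hh₁ hF₀
    (by
      intro s hs
      have := hF₁ s hs
      rwa [show b - (b - a) * s = a + (b - a) * (1 - s) by ring] at this)
  simp only [hend] at hlim
  rw [marchaud_expression_rescale f hab hx, ← mul_assoc,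
    mul_comm (2 ^ α / Real.Gamma (-α))] at hlim
  refine ((Complex.continuous_ofReal.tendsto _).comp hlim).congr' ?_
  filter_upwards [eventually_gt_atTop 0] with N hN
  rw [Function.comp_apply, Complex.ofReal_mul, Complex.ofReal_sum]
  congr 1
  refine Finset.sum_congr rfl fun l hl => ?_
  rw [phiHat_eq_phiReal hα, Complex.ofReal_mul,
    XvecAB_eq_indicator f a b hN (Nat.lt_succ_iff.1 (Finset.mem_range.1 hl))]
end

section
/- Let α > 0 be a non-integer real number whose integer part is an even positive integer 2p, set α' := α − 2p ∈ (0,1), and let a < b. Let ψ : (a,b) → ℝ be Lipschitz on every closed subinterval of (a,b) with ψ(a+h) = O(h^{−γ}) and ψ(b−h) = O(h^{−γ}) as h → 0⁺ for some γ ∈ [0,1−α']. Define y₀(x) := ((b−a)^{−α'}/(2^{α'} Γ(α'))) ∫_a^x (x−t)^{α'−1} ψ(t) dt and y(x) := (−1)^p ∫₀^1 G_p( (x−a)/(b−a), s ) · y₀(a + (b−a)s) ds. Then: (i) y^{(j)}(a) = y^{(j)}(b) = 0 for 0 ≤ j ≤ p−1; (ii) (b−a)^{2p} · y^{(2p)}(x)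 = y₀(x) for every x ∈ (a,b); and (iii) for every x ∈ (a,b), (b−a)^{α'} (2^{α'}/Γ(−α')) ( ∫_a^x (x−u)^{−α'−1}(y₀(u) − y₀(x)) du − y₀(x)(x−a)^{−α'}/α' ) = ψ(x). Thus y solves the equation D_{α,a,b}(y) = ψ on (a,b) with the Dirichlet-type boundary conditions at a and b. -/
open MeasureTheory Filter Asymptotics

/-- The fractional primitive of order `α' ∈ (0,1)` on the interval `(a,b)`:
`y₀(x) = ((b-a)^{-α'}/(2^{α'} Γ(α'))) ∫_a^x (x-t)^{α'-1} ψ(t) dt`. -/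
noncomputable def JfracAB (α' a b : ℝ) (ψ : ℝ → ℝ) (x : ℝ) : ℝ :=
  (b - a) ^ (-α') / ((2 : ℝ) ^ α' * Real.Gamma α') * ∫ t in a..x, (x - t) ^ (α' - 1) * ψ t

/-- The Green-kernel primitive of order `2p` on `(a,b)`:
`y(x) = (-1)^p ∫₀^1 G_p((x-a)/(b-a), s) g(a + (b-a)s) ds`. -/
noncomputable def JgreenAB (p : ℕ) (a b : ℝ) (g : ℝ → ℝ) (x : ℝ) : ℝ :=
  (-1 : ℝ) ^ p * ∫ s in (0 : ℝ)..1, GreenK p ((x - a) / (b - a)) s * g (a + (b - a) * s)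

open Set Topology

theorem continuousOn_div_pow_of_pos {f : ℝ → ℝ} (hf : Continuous f) {c d : ℝ} (hc : 0 < c)
    (hd : 0 < d) (n : ℕ) : ContinuousOn (fun t => f t / t ^ n) (uIcc c d) := by
  refine hf.continuousOn.div (by fun_prop) fun t ht => ?_
  have : 0 < t := lt_of_lt_of_le (lt_min hc hd) ht.1
  positivity

/-- The Beta integral on `[s, x]` in projective form. -/
theorem integral_projective_beta {s x : ℝ} (hs : 0 < s) (hx : 0 < x) (m n : ℕ) :
    ∫ t in s..x, (x - t) ^ m * (t - s) ^ n / t ^ (m + n + 2) =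
      (m.factorial : ℝ) * n.factorial / (m + n + 1).factorial *
        ((x - s) ^ (m + n + 1) / (x ^ (n + 1) * s ^ (m + 1))) := by
  have hpos : ∀ t ∈ uIcc s x, 0 < t := fun t ht => lt_of_lt_of_le (lt_min hs hx) ht.1
  induction m generalizing n with
  | zero =>
    have hder : ∀ t ∈ uIcc s x, HasDerivAt (fun t => ((t - s) / t) ^ (n + 1) / (s * (n + 1)))
        ((x - t) ^ 0 * (t - s) ^ n / t ^ (0 + n + 2)) t := by
      intro t ht
      have ht0 := (hpos t ht).ne'
      have h := (((((hasDerivAt_id t).sub_const s).div (hasDerivAt_id t) ht0).fun_pow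
        (n + 1)).div_const (s * (n + 1)))
      refine h.congr_deriv ?_
      simp only [id, Pi.div_apply, Nat.add_sub_cancel, div_pow]
      push_cast
      field_simp
      ring
    rw [intervalIntegral.integral_eq_sub_of_hasDerivAt hder
      ((continuousOn_div_pow_of_pos (by fun_prop) hs hx _).intervalIntegrable)]
    rw [Nat.zero_add, Nat.factorial_succ]
    have := Nat.factorial_ne_zero n
    simp only [sub_self, zero_div, Nat.factorial_zero, div_pow]
    push_cast
    rw [zero_pow (Nat.succ_ne_zero n)]
    field_simp
    ring
  | succ m ih =>
    have hder : ∀ t ∈ uIcc s x, HasDerivAt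
        (fun t => ((x - t) / t) ^ (m + 1) * ((t - s) / t) ^ (n + 1) / (s * (n + 1)))
        ((x - t) ^ (m + 1) * (t - s) ^ n / t ^ (m + 1 + n + 2) -
          (m + 1) * x / (s * (n + 1)) *
            ((x - t) ^ m * (t - s) ^ (n + 1) / t ^ (m + (n + 1) + 2))) t := by
      intro t ht
      have ht0 := (hpos t ht).ne'
      have h := ((((((hasDerivAt_id t).const_sub x).div (hasDerivAt_id t) ht0).fun_pow
        (m + 1)).fun_mul ((((hasDerivAt_id t).sub_const s).div (hasDerivAt_id t) ht0).fun_pow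
        (n + 1))).div_const (s * (n + 1)))
      refine h.congr_deriv ?_
      simp only [id, Pi.div_apply, Nat.add_sub_cancel, div_pow]
      push_cast
      field_simp
      ring
    have i1 : IntervalIntegrable (fun t => (x - t) ^ (m + 1) * (t - s) ^ n / t ^ (m + 1 + n + 2))
      volume s x := (continuousOn_div_pow_of_pos (by fun_prop) hs hx _).intervalIntegrable
    have i2 : IntervalIntegrable
      (fun t => (x - t) ^ m * (t - s) ^ (n + 1) / t ^ (m + (n + 1) + 2))
      volume s x := (continuousOn_div_pow_of_pos (by fun_prop) hs hx _).intervalIntegrable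
    have h := intervalIntegral.integral_eq_sub_of_hasDerivAt hder (i1.sub (i2.const_mul _))
    rw [intervalIntegral.integral_sub i1 (i2.const_mul _), intervalIntegral.integral_const_mul,
      ih (n + 1)] at h
    simp only [sub_self, zero_div, zero_pow (Nat.succ_ne_zero _), zero_mul, mul_zero,
      sub_eq_zero] at h
    rw [h, show m + 1 + n + 1 = m + (n + 1) + 1 by ring, Nat.factorial_succ m,
      Nat.factorial_succ n]
    push_cast
    have := Nat.factorial_ne_zero (m + (n + 1) + 1)
    field_simp
    ring

/-- Coefficients, as functions of `s`, of the polynomial part `x ↦ ∑ₖ cₖ(s) x^(q+1+k)` of the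
Green kernel of order `q + 1`. -/
noncomputable def greenCoeff (q k : ℕ) (s : ℝ) : ℝ :=
  ∑ i ∈ Finset.range (q + 1), (q.choose k : ℝ) * q.choose i * (-1) ^ (k + i) *
    (s ^ (q - k) - s ^ (q + 1 + i)) / ((k + i + 1) * (q.factorial : ℝ) ^ 2)

/-- The truncated power `r₊^n / n!`, with the value `0` at `r = 0`. -/
noncomputable def truncPow (n : ℕ) (r : ℝ) : ℝ := if 0 < r then r ^ n / n.factorial else 0

theorem integral_inv_pow_to_one {s : ℝ} (hs : 0 < s) (n : ℕ) :
    ∫ t in s..1, (1 : ℝ) / t ^ (n + 2) = (1 / s ^ (n + 1) - 1) / (n + 1) := by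
  have hpos : ∀ t ∈ uIcc s 1, 0 < t := fun t ht => lt_of_lt_of_le (lt_min hs one_pos) ht.1
  have hder : ∀ t ∈ uIcc s 1, HasDerivAt (fun t : ℝ => -(1 / t ^ (n + 1)) / (n + 1))
      (1 / t ^ (n + 2)) t := by
    intro t ht
    have ht0 := (hpos t ht).ne'
    have h := ((((hasDerivAt_const t (1 : ℝ)).fun_div (hasDerivAt_pow (n + 1) t)
      (pow_ne_zero _ ht0)).fun_neg).div_const ((n : ℝ) + 1))
    refine h.congr_deriv ?_
    rw [Nat.add_sub_cancel]
    push_cast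
    field_simp
    ring
  rw [intervalIntegral.integral_eq_sub_of_hasDerivAt hder
    ((continuousOn_div_pow_of_pos (by fun_prop) hs one_pos _).intervalIntegrable)]
  rw [one_pow]
  ring

theorem integral_green_polynomial_part {q : ℕ} {s : ℝ} (hs : 0 < s) (x : ℝ) :
    x ^ (q + 1) * s ^ (q + 1) / (q.factorial : ℝ) ^ 2 *
      ∫ t in s..1, (t - x) ^ q * (t - s) ^ q / t ^ (2 * (q + 1)) =
    ∑ k ∈ Finset.range (q + 1), greenCoeff q k s * x ^ (q + 1 + k) := by
  have hpos : ∀ t ∈ uIcc s 1, 0 < t := fun t ht => lt_of_lt_of_le (lt_min hs one_pos) ht.1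
  have hexp : ∀ t ∈ uIcc s 1, (t - x) ^ q * (t - s) ^ q / t ^ (2 * (q + 1)) =
      ∑ k ∈ Finset.range (q + 1), ∑ i ∈ Finset.range (q + 1),
        ((q.choose k : ℝ) * q.choose i * (-x) ^ k * (-s) ^ i) * (1 / t ^ (k + i + 2)) := by
    intro t ht
    have ht0 := (hpos t ht).ne'
    rw [sub_eq_neg_add, sub_eq_neg_add, add_pow, add_pow, Finset.sum_mul_sum, Finset.sum_div]
    refine Finset.sum_congr rfl fun k hk => ?_
    rw [Finset.sum_div]
    refine Finset.sum_congr rfl fun i hi => ?_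
    obtain ⟨k', hk'⟩ := Nat.exists_eq_add_of_le (Finset.mem_range_succ_iff.1 hk)
    obtain ⟨i', hi'⟩ := Nat.exists_eq_add_of_le (Finset.mem_range_succ_iff.1 hi)
    rw [show q - k = k' by omega, show q - i = i' by omega,
      show 2 * (q + 1) = k + i + 2 + (k' + i') by omega]
    rw [pow_add t _ (k' + i'), pow_add t k' i']
    field_simp
  have hint : ∀ n : ℕ, ∀ c : ℝ,
      IntervalIntegrable (fun t : ℝ => c * (1 / t ^ n)) volume s 1 := fun n c =>
    ((continuousOn_div_pow_of_pos (by fun_prop) hs one_pos _).intervalIntegrable).const_mul c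
  have hint' : ∀ k ∈ Finset.range (q + 1), IntervalIntegrable (fun t : ℝ =>
      ∑ i ∈ Finset.range (q + 1), ((q.choose k : ℝ) * q.choose i * (-x) ^ k * (-s) ^ i) *
        (1 / t ^ (k + i + 2))) volume s 1 := fun k _ => by
    simpa only [Finset.sum_fn] using IntervalIntegrable.sum (Finset.range (q + 1))
      fun i _ => hint (k + i + 2) ((q.choose k : ℝ) * q.choose i * (-x) ^ k * (-s) ^ i)
  rw [intervalIntegral.integral_congr hexp, intervalIntegral.integral_finsetSum hint',
    Finset.mul_sum]
  refine Finset.sum_congr rfl fun k hk => ?_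
  rw [intervalIntegral.integral_finsetSum fun i _ => hint _ _, greenCoeff, Finset.mul_sum,
    Finset.sum_mul]
  refine Finset.sum_congr rfl fun i hi => ?_
  rw [intervalIntegral.integral_const_mul, integral_inv_pow_to_one hs]
  obtain ⟨k', hk'⟩ := Nat.exists_eq_add_of_le (Finset.mem_range_succ_iff.1 hk)
  rw [show q - k = k' by omega, neg_pow x, neg_pow s, pow_add (-1 : ℝ) k i]
  have hq := Nat.factorial_ne_zero q
  push_cast
  have h1 : s ^ (q + 1) * s ^ i * (1 / s ^ (k + i + 1) - 1) = s ^ k' - s ^ (q + 1 + i) := by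
    subst hk'
    field_simp
    ring
  rw [← h1]
  field_simp
  ring

theorem greenK_eq {q : ℕ} {s : ℝ} (hs : 0 < s) (x : ℝ) :
    GreenK (q + 1) x s = ∑ k ∈ Finset.range (q + 1), greenCoeff q k s * x ^ (q + 1 + k) +
      (-1) ^ (q + 1) * truncPow (2 * q + 1) (x - s) := by
  rw [GreenK, if_neg (fun h => hs.ne' h.2), ← integral_green_polynomial_part hs x,
    Nat.add_sub_cancel, truncPow]
  split_ifs with h
  · have hsx : s < x := sub_pos.1 h
    have hx := hs.trans hsx
    have hi : ∀ c d : ℝ, 0 < c → 0 < d → IntervalIntegrable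
      (fun t => (t - x) ^ q * (t - s) ^ q / t ^ (2 * (q + 1))) volume c d := fun c d hc hd =>
      (continuousOn_div_pow_of_pos (by fun_prop) hc hd _).intervalIntegrable
    have key : ∫ t in s..x, (t - x) ^ q * (t - s) ^ q / t ^ (2 * (q + 1)) =
        (-1) ^ q * ∫ t in s..x, (x - t) ^ q * (t - s) ^ q / t ^ (q + q + 2) := by
      rw [← intervalIntegral.integral_const_mul]
      congr 1 with t
      rw [← neg_sub x t, neg_pow (x - t), show 2 * (q + 1) = q + q + 2 by ring]
      ring
    rw [integral_projective_beta hs hx] at key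
    rw [max_eq_left hsx.le, ← intervalIntegral.integral_add_adjacent_intervals
      (hi s x hs hx) (hi x 1 hx one_pos), key, ← two_mul]
    have hq := Nat.factorial_ne_zero q
    have hq' := Nat.factorial_ne_zero (2 * q + 1)
    field_simp
    ring
  · rw [max_eq_right (by linarith)]
    ring

theorem continuous_greenCoeff (q k : ℕ) : Continuous (greenCoeff q k) := by
  unfold greenCoeff
  fun_prop

theorem measurable_truncPow (n : ℕ) : Measurable (truncPow n) :=
  Measurable.ite measurableSet_Ioi (by fun_prop) measurable_const

theorem truncPow_succ_eq (n : ℕ) (r : ℝ) :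
    truncPow (n + 1) r = max r 0 ^ (n + 1) / (n + 1).factorial := by
  unfold truncPow
  split_ifs with h
  · rw [max_eq_left h.le]
  · rw [max_eq_right (not_lt.1 h)]; simp

theorem hasDerivAt_truncPow_succ (n : ℕ) {r : ℝ} (hr : r ≠ 0) :
    HasDerivAt (truncPow (n + 1)) (truncPow n r) r := by
  rcases hr.lt_or_gt with h | h
  · rw [truncPow, if_neg h.not_gt]
    refine (hasDerivAt_const r (0 : ℝ)).congr_of_eventuallyEq ?_
    filter_upwards [Iio_mem_nhds h] with t ht
    rw [truncPow, if_neg (not_lt.2 (le_of_lt ht))]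
  · rw [truncPow, if_pos h]
    refine (((hasDerivAt_pow (n + 1) r).div_const ((n + 1).factorial : ℝ)).congr_deriv
      ?_).congr_of_eventuallyEq ?_
    · rw [Nat.factorial_succ, Nat.add_sub_cancel]
      have := Nat.factorial_ne_zero n
      push_cast
      field_simp
    · filter_upwards [Ioi_mem_nhds h] with t ht
      rw [truncPow, if_pos (mem_Ioi.1 ht)]

theorem abs_truncPow_sub_le (n : ℕ) {r t M : ℝ} (hr : r ≤ M) (ht : t ≤ M) (hM : 0 ≤ M) :
    |truncPow (n + 1) r - truncPow (n + 1) t| ≤ M ^ n / n.factorial * |r - t| := by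
  rw [truncPow_succ_eq, truncPow_succ_eq, ← sub_div, abs_div, Nat.abs_cast]
  have h1 := abs_pow_sub_pow_le (max r 0) (max t 0) (n + 1)
  have h2 : |max r 0 - max t 0| ≤ |r - t| := abs_max_sub_max_le_abs r t 0
  have h3 : max |max r 0| |max t 0| ≤ M := by
    rw [abs_of_nonneg (le_max_right _ _), abs_of_nonneg (le_max_right _ _)]
    simp [hr, ht, hM]
  have h4 : max |max r 0| |max t 0| ^ n ≤ M ^ n := by gcongr
  rw [Nat.add_sub_cancel] at h1
  have h5 : |max r 0 ^ (n + 1) - max t 0 ^ (n + 1)| ≤ |r - t| * (n + 1 : ℕ) * M ^ n :=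
    h1.trans (by gcongr)
  rw [div_le_iff₀ (by positivity), Nat.factorial_succ]
  refine h5.trans (le_of_eq ?_)
  have := Nat.factorial_ne_zero n
  push_cast
  field_simp

/-- The integral of `g` over `[0, 1]` against the truncated power `s ↦ (x - s)₊^n / n!`, that is,
the `(n + 1)`-fold primitive of `g` based at `0`. -/
noncomputable def truncMoment (g : ℝ → ℝ) (n : ℕ) (x : ℝ) : ℝ :=
  ∫ s in (0 : ℝ)..1, truncPow n (x - s) * g s

theorem abs_truncPow_le (n : ℕ) {r M : ℝ} (hr : r ≤ M) (hM : 0 ≤ M) :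
    |truncPow n r| ≤ M ^ n / n.factorial := by
  unfold truncPow
  split_ifs with h
  · rw [abs_of_nonneg (by positivity)]
    gcongr
  · rw [abs_zero]; positivity

theorem intervalIntegrable_truncPow_mul {g : ℝ → ℝ} (hg : IntervalIntegrable g volume 0 1)
    (n : ℕ) (x : ℝ) :
    IntervalIntegrable (fun s => truncPow n (x - s) * g s) volume 0 1 := by
  rw [intervalIntegrable_iff] at hg ⊢
  refine Integrable.bdd_mul (c := |x| ^ n / n.factorial) hg
    ((measurable_truncPow n).comp (measurable_const.sub measurable_id)).aestronglyMeasurable ?_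
  refine (ae_restrict_iff' measurableSet_uIoc).2 (ae_of_all _ fun s hs => ?_)
  rw [uIoc_of_le zero_le_one] at hs
  exact abs_truncPow_le n (by linarith [le_abs_self x, hs.1]) (abs_nonneg x)

theorem hasDerivAt_truncMoment_succ {g : ℝ → ℝ} (hg : IntervalIntegrable g volume 0 1)
    (n : ℕ) (x : ℝ) : HasDerivAt (truncMoment g (n + 1)) (truncMoment g n x) x := by
  refine (intervalIntegral.hasDerivAt_integral_of_dominated_loc_of_lip
    (s := Metric.ball x 1) (F := fun y s => truncPow (n + 1) (y - s) * g s)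
    (F' := fun s => truncPow n (x - s) * g s)
    (bound := fun s => (|x| + 1) ^ n / n.factorial * |g s|)
    (Metric.ball_mem_nhds x one_pos) (Filter.Eventually.of_forall fun y =>
      (intervalIntegrable_iff.1 (intervalIntegrable_truncPow_mul hg (n + 1) y)).1)
    (intervalIntegrable_truncPow_mul hg (n + 1) x)
    (intervalIntegrable_iff.1 (intervalIntegrable_truncPow_mul hg n x)).1 ?_
    (hg.abs.const_mul _) ?_).2
  · refine ae_of_all _ fun s hs => ?_
    rw [uIoc_of_le zero_le_one] at hs
    refine LipschitzOnWith.of_dist_le_mul fun y hy z hz => ?_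
    rw [Metric.mem_ball, Real.dist_eq, abs_lt] at hy hz
    have hx := le_abs_self x
    have h := abs_truncPow_sub_le n (r := y - s) (t := z - s) (M := |x| + 1)
      (by linarith [hs.1]) (by linarith [hs.1]) (by positivity)
    rw [Real.dist_eq, Real.dist_eq, ← sub_mul, abs_mul, Real.coe_nnabs, abs_of_nonneg
      (by positivity : 0 ≤ (|x| + 1) ^ n / n.factorial * |g s|)]
    rw [sub_sub_sub_cancel_right] at h
    calc _ ≤ (|x| + 1) ^ n / n.factorial * |y - z| * |g s| := by gcongr
      _ = _ := by ring
  · filter_upwards [Measure.ae_ne volume x] with s hs _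
    have h := (hasDerivAt_truncPow_succ n (sub_ne_zero.2 hs.symm)).comp x
      ((hasDerivAt_id x).sub_const s)
    simpa using h.mul_const (g s)

theorem truncMoment_zero_right (g : ℝ → ℝ) (n : ℕ) : truncMoment g n 0 = 0 := by
  rw [truncMoment]
  refine intervalIntegral.integral_zero_ae (ae_of_all _ fun s hs => ?_)
  rw [uIoc_of_le zero_le_one] at hs
  rw [truncPow, if_neg (by linarith [hs.1]), zero_mul]

theorem hasDerivAt_truncMoment_zero {g : ℝ → ℝ} (hg : IntervalIntegrable g volume 0 1)
    (hc : ContinuousOn g (Ioo 0 1)) {x : ℝ} (hx : x ∈ Ioo (0 : ℝ) 1) :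
    HasDerivAt (truncMoment g 0) (g x) x := by
  have hsub : ∀ y ∈ Icc (0 : ℝ) 1, IntervalIntegrable g volume 0 y ∧
      IntervalIntegrable g volume y 1 := fun y hy =>
    ⟨hg.mono_set (uIcc_subset_uIcc left_mem_uIcc (by rwa [uIcc_of_le zero_le_one])),
      hg.mono_set (uIcc_subset_uIcc (by rwa [uIcc_of_le zero_le_one]) right_mem_uIcc)⟩
  have h1 : HasDerivAt (fun y => ∫ s in (0 : ℝ)..y, g s) (g x) x :=
    intervalIntegral.integral_hasDerivAt_right (hsub x ⟨hx.1.le, hx.2.le⟩).1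
      (hc.stronglyMeasurableAtFilter isOpen_Ioo x hx) (hc.continuousAt (isOpen_Ioo.mem_nhds hx))
  refine h1.congr_of_eventuallyEq ?_
  filter_upwards [isOpen_Ioo.mem_nhds hx] with y hy
  have e1 : ∫ s in (0 : ℝ)..y, truncPow 0 (y - s) * g s = ∫ s in (0 : ℝ)..y, g s := by
    refine intervalIntegral.integral_congr_ae ?_
    filter_upwards [Measure.ae_ne volume y] with s hs hs'
    rw [uIoc_of_le hy.1.le] at hs'
    rw [truncPow, if_pos (sub_pos.2 (lt_of_le_of_ne hs'.2 hs))]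
    simp
  have e2 : ∫ s in y..1, truncPow 0 (y - s) * g s = 0 := by
    refine intervalIntegral.integral_zero_ae (ae_of_all _ fun s hs => ?_)
    rw [uIoc_of_le hy.2.le] at hs
    rw [truncPow, if_neg (by linarith [hs.1]), zero_mul]
  have hi := intervalIntegrable_truncPow_mul hg 0 y
  have hm : y ∈ uIcc (0 : ℝ) 1 := by rw [uIcc_of_le zero_le_one]; exact ⟨hy.1.le, hy.2.le⟩
  rw [truncMoment, ← intervalIntegral.integral_add_adjacent_intervals
    (hi.mono_set (uIcc_subset_uIcc left_mem_uIcc hm))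
    (hi.mono_set (uIcc_subset_uIcc hm right_mem_uIcc)), e1, e2, add_zero]

theorem iteratedDeriv_eq_zero_of_isBigO {f : ℝ → ℝ} {x₀ : ℝ} {n : ℕ} (hf : ContDiff ℝ n f)
    (h : f =O[𝓝 x₀] fun x => (x - x₀) ^ (n + 1)) {j : ℕ} (hj : j ≤ n) :
    iteratedDeriv j f x₀ = 0 := by
  induction j using Nat.strong_induction_on with
  | _ j ih =>
    have h1 := taylor_isLittleO_univ (x₀ := x₀)
      (hf.of_le (by exact_mod_cast hj : (j : WithTop ℕ∞) ≤ n))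
    have h2 : ∀ x, taylorWithinEval f j univ x₀ x =
        ((j.factorial : ℝ)⁻¹ * iteratedDeriv j f x₀) * (x - x₀) ^ j := by
      intro x
      rw [taylor_within_apply, Finset.sum_range_succ, Finset.sum_eq_zero, zero_add,
        iteratedDerivWithin_univ, smul_eq_mul]
      · ring
      · intro k hk
        have hk' := Finset.mem_range.1 hk
        rw [iteratedDerivWithin_univ, ih k hk' (hk'.le.trans hj), smul_zero]
    have h3 : f =o[𝓝 x₀] fun x => (x - x₀) ^ j := by
      refine h.trans_isLittleO ?_
      have : (fun x : ℝ => x ^ (n + 1)) =o[𝓝 0] fun x : ℝ => x ^ j :=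
        isLittleO_pow_pow (by omega)
      exact this.comp_tendsto ((continuous_id.sub continuous_const).tendsto' _ _ (sub_self x₀))
    have h4 := h3.sub h1
    simp only [sub_sub_cancel, h2] at h4
    by_contra hne
    have hc : (j.factorial : ℝ)⁻¹ * iteratedDeriv j f x₀ ≠ 0 :=
      mul_ne_zero (by positivity) hne
    rw [isLittleO_const_mul_left_iff hc] at h4
    refine isLittleO_irrefl ?_ h4
    have : ∃ᶠ x in 𝓝[≠] x₀, (x - x₀) ^ j ≠ 0 :=
      (Filter.Eventually.mono (eventually_mem_nhdsWithin (s := {x₀}ᶜ))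
        fun x hx => pow_ne_zero _ (sub_ne_zero.2 hx)).frequently
    exact this.filter_mono nhdsWithin_le_nhds

theorem abs_greenK_le {q : ℕ} {s x : ℝ} (hs : s ∈ Ioc (0 : ℝ) 1) (hx : x ∈ Icc (1 / 2 : ℝ) (3 / 2)) :
    |GreenK (q + 1) x s| ≤ 2 ^ (4 * q + 3) * |x - 1| ^ (q + 1) := by
  obtain ⟨hs0, hs1⟩ := hs
  obtain ⟨hx0, hx1⟩ := hx
  rw [GreenK, if_neg (fun h => hs0.ne' h.2), Nat.add_sub_cancel, abs_mul]
  have h1 : |x ^ (q + 1) * s ^ (q + 1) / (q.factorial : ℝ) ^ 2| ≤ 2 ^ (q + 1) := by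
    rw [abs_of_nonneg (by positivity)]
    have hq : (1 : ℝ) ≤ q.factorial := by exact_mod_cast Nat.factorial_pos q
    refine (div_le_self (by positivity) (one_le_pow₀ hq)).trans ?_
    calc x ^ (q + 1) * s ^ (q + 1) ≤ 2 ^ (q + 1) * 1 ^ (q + 1) := by
          gcongr
          linarith
      _ = _ := by simp
  have hm : |1 - max x s| ≤ |x - 1| := by
    have := abs_max_sub_max_le_abs 1 x s
    rwa [max_eq_left hs1, abs_sub_comm 1 x] at this
  have h2 : ∀ t ∈ uIoc (max x s) 1, ‖(t - x) ^ q * (t - s) ^ q / t ^ (2 * (q + 1))‖ ≤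
      |x - 1| ^ q * 2 ^ q * 2 ^ (2 * (q + 1)) := by
    intro t ht
    have ht' : 1 / 2 ≤ t ∧ |t - x| ≤ |x - 1| ∧ |t - s| ≤ 2 := by
      rcases le_total x 1 with hx | hx
      · rw [uIoc_of_le (max_le hx hs1)] at ht
        have ht1 := (max_lt_iff.1 ht.1)
        refine ⟨by linarith, ?_, ?_⟩
        · rw [abs_of_nonneg (by linarith), abs_of_nonpos (by linarith)]
          linarith [ht.2]
        · rw [abs_le]; constructor <;> linarith [ht.2]
      · rw [max_eq_left (hs1.trans hx), uIoc_of_ge hx] at ht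
        refine ⟨by linarith [ht.1], ?_, ?_⟩
        · rw [abs_of_nonpos (by linarith [ht.2]), abs_of_nonneg (by linarith)]
          linarith [ht.1]
        · rw [abs_le]; constructor <;> linarith [ht.1, ht.2]
    obtain ⟨ht1, ht2, ht3⟩ := ht'
    have ht0 : 0 < t := by linarith
    rw [Real.norm_eq_abs, abs_div, abs_mul, abs_pow, abs_pow, abs_of_pos (pow_pos ht0 _)]
    rw [div_eq_mul_inv, ← inv_pow]
    gcongr
    exact inv_le_of_inv_le₀ (by norm_num) (by linarith)
  have h3 := intervalIntegral.norm_integral_le_of_norm_le_const h2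
  rw [Real.norm_eq_abs] at h3
  calc _ ≤ 2 ^ (q + 1) * (|x - 1| ^ q * 2 ^ q * 2 ^ (2 * (q + 1)) * |x - 1|) := by
        gcongr
        exact h3.trans (by gcongr)
    _ = _ := by ring

/-- The polynomial part of the Green-kernel potential of `g`. -/
noncomputable def greenPoly (q : ℕ) (g : ℝ → ℝ) : Polynomial ℝ :=
  ∑ k ∈ Finset.range (q + 1),
    Polynomial.C (∫ s in (0 : ℝ)..1, greenCoeff q k s * g s) * Polynomial.X ^ (q + 1 + k)

theorem intervalIntegrable_greenCoeff_mul {g : ℝ → ℝ} (hg : IntervalIntegrable g volume 0 1)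
    (q k : ℕ) : IntervalIntegrable (fun s => greenCoeff q k s * g s) volume 0 1 :=
  hg.continuousOn_mul (continuous_greenCoeff q k).continuousOn

theorem integral_greenK_mul_s18 {g : ℝ → ℝ} (hg : IntervalIntegrable g volume 0 1) (q : ℕ) (x : ℝ) :
    ∫ s in (0 : ℝ)..1, GreenK (q + 1) x s * g s =
      (greenPoly q g).eval x + (-1) ^ (q + 1) * truncMoment g (2 * q + 1) x := by
  have h1 : ∫ s in (0 : ℝ)..1, GreenK (q + 1) x s * g s = ∫ s in (0 : ℝ)..1,
      ((∑ k ∈ Finset.range (q + 1), x ^ (q + 1 + k) * (greenCoeff q k s * g s)) +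
        (-1) ^ (q + 1) * (truncPow (2 * q + 1) (x - s) * g s)) := by
    refine intervalIntegral.integral_congr_ae (ae_of_all _ fun s hs => ?_)
    rw [uIoc_of_le zero_le_one] at hs
    rw [greenK_eq hs.1, add_mul, Finset.sum_mul, mul_assoc]
    congr 1
    exact Finset.sum_congr rfl fun k _ => by ring
  have hi : ∀ k ∈ Finset.range (q + 1), IntervalIntegrable
      (fun s => x ^ (q + 1 + k) * (greenCoeff q k s * g s)) volume 0 1 := fun k _ =>
    (intervalIntegrable_greenCoeff_mul hg q k).const_mul _
  rw [h1, intervalIntegral.integral_add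
    (by simpa only [Finset.sum_fn] using IntervalIntegrable.sum (Finset.range (q + 1)) hi)
    ((intervalIntegrable_truncPow_mul hg _ x).const_mul _),
    intervalIntegral.integral_const_mul, intervalIntegral.integral_finsetSum hi, greenPoly,
    Polynomial.eval_finsetSum]
  congr 1
  refine Finset.sum_congr rfl fun k _ => ?_
  rw [intervalIntegral.integral_const_mul]
  rw [Polynomial.eval_mul, Polynomial.eval_C, Polynomial.eval_pow, Polynomial.eval_X, mul_comm]

/-- The `j`-th derivative of `x ↦ (-1)^(q+1) ∫₀¹ G_{q+1}(x, s) g(s) ds`, for `j ≤ 2q + 1`. -/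
noncomputable def greenDeriv (q : ℕ) (g : ℝ → ℝ) (j : ℕ) (x : ℝ) : ℝ :=
  (-1) ^ (q + 1) * (Polynomial.derivative^[j] (greenPoly q g)).eval x +
    truncMoment g (2 * q + 1 - j) x

theorem greenDeriv_zero {g : ℝ → ℝ} (hg : IntervalIntegrable g volume 0 1) (q : ℕ) (x : ℝ) :
    (-1) ^ (q + 1) * ∫ s in (0 : ℝ)..1, GreenK (q + 1) x s * g s = greenDeriv q g 0 x := by
  rw [integral_greenK_mul_s18 hg, mul_add, ← mul_assoc, ← mul_pow, greenDeriv]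
  simp

theorem hasDerivAt_greenDeriv {g : ℝ → ℝ} (hg : IntervalIntegrable g volume 0 1) {q j : ℕ}
    (hj : j < 2 * q + 1) (x : ℝ) : HasDerivAt (greenDeriv q g j) (greenDeriv q g (j + 1) x) x := by
  obtain ⟨i, hi⟩ := Nat.exists_eq_add_of_lt hj
  have h1 := ((Polynomial.derivative^[j] (greenPoly q g)).hasDerivAt x).const_mul
    ((-1 : ℝ) ^ (q + 1))
  have h2 := h1.fun_add (hasDerivAt_truncMoment_succ hg i x)
  unfold greenDeriv
  rw [show 2 * q + 1 - (j + 1) = i by omega, Function.iterate_succ_apply',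
    show 2 * q + 1 - j = i + 1 by omega]
  exact h2

theorem hasDerivAt_greenDeriv_last {g : ℝ → ℝ} (hg : IntervalIntegrable g volume 0 1)
    (hc : ContinuousOn g (Ioo 0 1)) (q : ℕ) {x : ℝ} (hx : x ∈ Ioo (0 : ℝ) 1) :
    HasDerivAt (greenDeriv q g (2 * q + 1)) (g x) x := by
  have h1 := ((Polynomial.derivative^[2 * q + 1] (greenPoly q g)).hasDerivAt x).const_mul
    ((-1 : ℝ) ^ (q + 1))
  have hz : Polynomial.derivative^[2 * q + 1 + 1] (greenPoly q g) = 0 := by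
    refine Polynomial.iterate_derivative_eq_zero ?_
    refine lt_of_le_of_lt (Polynomial.natDegree_sum_le_of_forall_le (n := 2 * q + 1) _ _
      fun k hk => ?_) (Nat.lt_succ_self _)
    have := Finset.mem_range.1 hk
    exact (Polynomial.natDegree_C_mul_X_pow_le _ _).trans (by omega)
  have h2 := h1.fun_add (hasDerivAt_truncMoment_zero hg hc hx)
  rw [← Function.iterate_succ_apply' Polynomial.derivative, hz] at h2
  unfold greenDeriv
  simpa using h2

theorem iteratedDeriv_greenDeriv_zero {g : ℝ → ℝ} (hg : IntervalIntegrable g volume 0 1)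
    {q j : ℕ} (hj : j ≤ 2 * q + 1) :
    iteratedDeriv j (greenDeriv q g 0) = greenDeriv q g j := by
  induction j with
  | zero => rw [iteratedDeriv_zero]
  | succ j ih =>
    rw [iteratedDeriv_succ, ih (by omega)]
    exact funext fun x => (hasDerivAt_greenDeriv hg (by omega) x).deriv

theorem greenDeriv_apply_zero (q : ℕ) (g : ℝ → ℝ) {j : ℕ} (hj : j < q + 1) :
    greenDeriv q g j 0 = 0 := by
  have : (Polynomial.derivative^[j] (greenPoly q g)).eval 0 = 0 := by
    rw [← Polynomial.coeff_zero_eq_eval_zero, Polynomial.coeff_iterate_derivative, greenPoly,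
      Polynomial.finsetSum_coeff, Finset.sum_eq_zero, smul_zero]
    intro k _
    rw [Polynomial.coeff_C_mul, Polynomial.coeff_X_pow, if_neg (by omega), mul_zero]
  rw [greenDeriv, this, truncMoment_zero_right, mul_zero, add_zero]

theorem greenDeriv_apply_one {g : ℝ → ℝ} (hg : IntervalIntegrable g volume 0 1) {q j : ℕ}
    (hj : j < q + 1) : greenDeriv q g j 1 = 0 := by
  rw [← iteratedDeriv_greenDeriv_zero hg (by omega)]
  refine iteratedDeriv_eq_zero_of_isBigO (n := q) ?_ ?_ (Nat.lt_succ_iff.1 hj)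
  · refine contDiff_of_differentiable_iteratedDeriv fun m hm => ?_
    have hm' : m ≤ q := by exact_mod_cast hm
    rw [iteratedDeriv_greenDeriv_zero hg (by omega)]
    exact fun x => (hasDerivAt_greenDeriv hg (by omega) x).differentiableAt
  · refine IsBigO.of_bound (2 ^ (4 * q + 3) * ∫ s in (0 : ℝ)..1, |g s|) ?_
    filter_upwards [Icc_mem_nhds (by norm_num : (1 / 2 : ℝ) < 1) (by norm_num : (1 : ℝ) < 3 / 2)]
      with x hx
    rw [← greenDeriv_zero hg, norm_mul, norm_pow, norm_neg, norm_one, one_pow, one_mul]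
    refine (intervalIntegral.norm_integral_le_of_norm_le zero_le_one
      (g := fun s => 2 ^ (4 * q + 3) * |x - 1| ^ (q + 1) * |g s|)
      (ae_of_all _ fun s hs => ?_) (hg.abs.const_mul _)).trans (le_of_eq ?_)
    · rw [norm_mul, Real.norm_eq_abs, Real.norm_eq_abs]
      exact mul_le_mul_of_nonneg_right (abs_greenK_le hs hx) (abs_nonneg _)
    · rw [intervalIntegral.integral_const_mul, norm_pow, Real.norm_eq_abs]
      ring

theorem iteratedDeriv_comp_sub_div {f : ℕ → ℝ → ℝ} {n : ℕ}
    (hf : ∀ j < n, ∀ x, HasDerivAt (f j) (f (j + 1) x) x) (a L : ℝ) {j : ℕ} (hj : j ≤ n) :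
    iteratedDeriv j (fun x => f 0 ((x - a) / L)) = fun x => f j ((x - a) / L) / L ^ j := by
  induction j with
  | zero => simp
  | succ j ih =>
    rw [iteratedDeriv_succ, ih (by omega)]
    refine funext fun x => ?_
    have h := ((hf j (by omega) ((x - a) / L)).comp x
      (((hasDerivAt_id x).sub_const a).div_const L)).div_const (L ^ j)
    refine h.deriv.trans ?_
    rw [pow_succ]
    field_simp

theorem jgreenAB_boundary_and_iteratedDeriv {p : ℕ} (hp : 1 ≤ p) {a b : ℝ} (hab : a < b)
    {g : ℝ → ℝ} (hg : IntervalIntegrable g volume a b) (hc : ContinuousOn g (Ioo a b)) :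
    (∀ j < p, iteratedDeriv j (JgreenAB p a b g) a = 0 ∧
      iteratedDeriv j (JgreenAB p a b g) b = 0) ∧
    ∀ x ∈ Ioo a b, (b - a) ^ (2 * p) * iteratedDeriv (2 * p) (JgreenAB p a b g) x = g x := by
  obtain ⟨q, rfl⟩ := Nat.exists_eq_add_of_le' hp
  have hL : 0 < b - a := sub_pos.2 hab
  set h : ℝ → ℝ := fun s => g (a + (b - a) * s) with hh
  have hi : IntervalIntegrable h volume 0 1 := by
    have := (hg.comp_add_left a).comp_mul_left (c := b - a)
    simpa [hL.ne'] using this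
  have hco : ContinuousOn h (Ioo 0 1) := by
    refine hc.comp (by fun_prop) fun s hs => ⟨?_, ?_⟩
    · nlinarith [hs.1]
    · nlinarith [hs.2]
  have hJ : JgreenAB (q + 1) a b g = fun x => greenDeriv q h 0 ((x - a) / (b - a)) :=
    funext fun x => greenDeriv_zero hi q _
  have hD : ∀ j ≤ 2 * q + 1, iteratedDeriv j (JgreenAB (q + 1) a b g) =
      fun x => greenDeriv q h j ((x - a) / (b - a)) / (b - a) ^ j := fun j hj => by
    rw [hJ]
    exact iteratedDeriv_comp_sub_div (fun i hi' x => hasDerivAt_greenDeriv hi hi' x) a (b - a) hj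
  refine ⟨fun j hj => ?_, fun x hx => ?_⟩
  · rw [hD j (by omega)]
    simp [hL.ne', greenDeriv_apply_zero q h hj, greenDeriv_apply_one hi hj]
  · have hx' : (x - a) / (b - a) ∈ Ioo (0 : ℝ) 1 :=
      ⟨div_pos (sub_pos.2 hx.1) hL, (div_lt_one hL).2 (by linarith [hx.2])⟩
    have hd := ((hasDerivAt_greenDeriv_last hi hco q hx').comp x
      (((hasDerivAt_id x).sub_const a).div_const (b - a))).div_const ((b - a) ^ (2 * q + 1))
    rw [show 2 * (q + 1) = 2 * q + 1 + 1 by ring, iteratedDeriv_succ, hD _ le_rfl]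
    rw [show deriv (fun x => greenDeriv q h (2 * q + 1) ((x - a) / (b - a)) /
      (b - a) ^ (2 * q + 1)) x = _ from hd.deriv]
    have : a + (b - a) * ((x - a) / (b - a)) = x := by field_simp; ring
    simp only [hh, this]
    field_simp
    ring

/-- The Riemann–Liouville integral of order `β` based at `a`, without the factor `1 / Γ(β)`. -/
noncomputable def rlInt (β a : ℝ) (ψ : ℝ → ℝ) (x : ℝ) : ℝ :=
  ∫ t in a..x, (x - t) ^ (β - 1) * ψ t

/-- The kernel `s^(β-1)` truncated to `(0, L)`. -/
noncomputable def powKer (β L : ℝ) : ℝ → ℝ := (Ioo 0 L).indicator fun s => s ^ (β - 1)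

theorem integrable_powKer {β : ℝ} (hβ : 0 < β) {L : ℝ} (hL : 0 ≤ L) : Integrable (powKer β L) := by
  rw [powKer, integrable_indicator_iff measurableSet_Ioo, ← integrableOn_Ioc_iff_integrableOn_Ioo,
    ← intervalIntegrable_iff_integrableOn_Ioc_of_le hL]
  exact intervalIntegral.intervalIntegrable_rpow' (by linarith)

theorem integrable_indicator_Ioo {ψ : ℝ → ℝ} {a b : ℝ} (hab : a ≤ b)
    (hψ : IntervalIntegrable ψ volume a b) : Integrable ((Ioo a b).indicator ψ) := by
  rwa [integrable_indicator_iff measurableSet_Ioo, ← integrableOn_Ioc_iff_integrableOn_Ioo,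
    ← intervalIntegrable_iff_integrableOn_Ioc_of_le hab]

theorem integrable_prod_powKer {β : ℝ} (hβ : 0 < β) {ψ : ℝ → ℝ} {a b : ℝ} (hab : a ≤ b)
    (hψ : IntervalIntegrable ψ volume a b) :
    Integrable (fun p : ℝ × ℝ => (Ioo a b).indicator ψ p.2 * powKer β (b - a) (p.1 - p.2))
      (volume.prod volume) :=
  (integrable_indicator_Ioo hab hψ).convolution_integrand (ContinuousLinearMap.mul ℝ ℝ)
    (integrable_powKer hβ (sub_nonneg.2 hab))

theorem integral_indicator_mul_powKer (β : ℝ) (ψ : ℝ → ℝ) {a b u : ℝ} (hu : u ∈ Ioc a b) :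
    ∫ t, (Ioo a b).indicator ψ t * powKer β (b - a) (u - t) = rlInt β a ψ u := by
  rw [rlInt, intervalIntegral.integral_of_le hu.1.le, integral_Ioc_eq_integral_Ioo,
    ← integral_indicator measurableSet_Ioo]
  congr 1 with t
  by_cases ht : t ∈ Ioo a u
  · have h1 : t ∈ Ioo a b := ⟨ht.1, ht.2.trans_le hu.2⟩
    have h2 : u - t ∈ Ioo 0 (b - a) := ⟨sub_pos.2 ht.2, by linarith [ht.1, hu.2]⟩
    rw [indicator_of_mem ht, indicator_of_mem h1, powKer, indicator_of_mem h2, mul_comm]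
  · rw [indicator_of_notMem ht]
    by_cases h1 : t ∈ Ioo a b
    · have h2 : u - t ∉ Ioo 0 (b - a) := fun h => ht ⟨h1.1, sub_pos.1 h.1⟩
      rw [powKer, indicator_of_notMem h2, mul_zero]
    · rw [indicator_of_notMem h1, zero_mul]

theorem intervalIntegrable_rlInt {β : ℝ} (hβ : 0 < β) {ψ : ℝ → ℝ} {a b : ℝ} (hab : a ≤ b)
    (hψ : IntervalIntegrable ψ volume a b) : IntervalIntegrable (rlInt β a ψ) volume a b := by
  rw [intervalIntegrable_iff_integrableOn_Ioc_of_le hab]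
  refine ((integrable_prod_powKer hβ hab hψ).integral_prod_left.integrableOn).congr_fun
    (fun u hu => ?_) measurableSet_Ioc
  exact integral_indicator_mul_powKer β ψ hu

theorem integral_rpow_mul_rpow_singular {β t c x : ℝ} (hβ : 0 < β) (htc : t < c) (hcx : c < x) :
    ∫ u in t..c, (x - u) ^ (-β - 1) * (u - t) ^ (β - 1) =
      (c - t) ^ β * (x - c) ^ (-β) / (β * (x - t)) := by
  have hxt : 0 < x - t := by linarith
  have hx : ∀ u ∈ Icc t c, 0 < x - u := fun u hu => by linarith [hu.2]
  have hcont : ContinuousOn (fun u => (u - t) ^ β * (x - u) ^ (-β) / (β * (x - t))) (Icc t c) := by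
    refine ContinuousOn.div_const (ContinuousOn.mul ?_ ?_) _
    · exact ContinuousOn.rpow_const (by fun_prop) fun u _ => Or.inr hβ.le
    · exact ContinuousOn.rpow_const (by fun_prop) fun u hu => Or.inl (hx u hu).ne'
  have hder : ∀ u ∈ Ioo t c, HasDerivAt (fun u => (u - t) ^ β * (x - u) ^ (-β) / (β * (x - t)))
      ((x - u) ^ (-β - 1) * (u - t) ^ (β - 1)) u := by
    intro u hu
    have h1 : 0 < u - t := sub_pos.2 hu.1
    have h2 : 0 < x - u := hx u ⟨hu.1.le, hu.2.le⟩
    have hd := (((((hasDerivAt_id u).sub_const t).rpow_const (p := β) (Or.inl h1.ne')).fun_mul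
      (((hasDerivAt_id u).const_sub x).rpow_const (p := -β) (Or.inl h2.ne'))).div_const
        (β * (x - t)))
    refine hd.congr_deriv ?_
    have e1 : (u - t) ^ β = (u - t) ^ (β - 1) * (u - t) := by
      rw [← Real.rpow_add_one h1.ne', sub_add_cancel]
    have e2 : (x - u) ^ (-β) = (x - u) ^ (-β - 1) * (x - u) := by
      rw [← Real.rpow_add_one h2.ne', sub_add_cancel]
    simp only [id]
    rw [e1, e2]
    field_simp
    ring
  have hint : IntervalIntegrable (fun u => (x - u) ^ (-β - 1) * (u - t) ^ (β - 1)) volume t c := by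
    refine IntervalIntegrable.continuousOn_mul ?_ ?_
    · have := (intervalIntegral.intervalIntegrable_rpow' (a := 0) (b := c - t)
        (by linarith : -1 < β - 1)).comp_sub_right t
      simpa using this
    · rw [uIcc_of_le htc.le]
      exact ContinuousOn.rpow_const (by fun_prop) fun u hu => Or.inl (hx u hu).ne'
  rw [intervalIntegral.integral_eq_sub_of_hasDerivAt_of_le htc.le hcont hder hint, sub_self,
    Real.zero_rpow hβ.ne']
  ring

theorem integral_rpow_mul_rlInt {β : ℝ} (hβ : 0 < β) {ψ : ℝ → ℝ} {a c x : ℝ} (hac : a < c)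
    (hcx : c < x) (hψ : IntervalIntegrable ψ volume a c) :
    ∫ u in a..c, (x - u) ^ (-β - 1) * rlInt β a ψ u =
      ∫ t in a..c, ψ t * ((c - t) ^ β * (x - c) ^ (-β) / (β * (x - t))) := by
  set w : ℝ → ℝ := (Ioo a c).indicator fun u => (x - u) ^ (-β - 1) with hw
  have hwm : Measurable w := Measurable.indicator (by fun_prop) measurableSet_Ioo
  have hwb : ∀ u, ‖w u‖ ≤ (x - c) ^ (-β - 1) := by
    intro u
    rw [hw]
    by_cases hu : u ∈ Ioo a c
    · have : 0 < x - u := by linarith [hu.2]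
      rw [indicator_of_mem hu, Real.norm_eq_abs, abs_of_nonneg (by positivity)]
      exact Real.rpow_le_rpow_of_nonpos (by linarith) (by linarith [hu.2]) (by linarith)
    · rw [indicator_of_notMem hu, norm_zero]
      exact Real.rpow_nonneg (by linarith) _
  have hprod : Integrable (fun p : ℝ × ℝ => w p.1 * ((Ioo a c).indicator ψ p.2 *
      powKer β (c - a) (p.1 - p.2))) (volume.prod volume) :=
    (integrable_prod_powKer hβ hac.le hψ).bdd_mul
      (hwm.comp measurable_fst).aestronglyMeasurable (ae_of_all _ fun p => hwb p.1)
  have hswap := integral_integral_swap (f := fun u t => w u * ((Ioo a c).indicator ψ t *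
      powKer β (c - a) (u - t))) hprod
  have hl : ∫ u, ∫ t, w u * ((Ioo a c).indicator ψ t * powKer β (c - a) (u - t)) =
      ∫ u in a..c, (x - u) ^ (-β - 1) * rlInt β a ψ u := by
    rw [intervalIntegral.integral_of_le hac.le, integral_Ioc_eq_integral_Ioo,
      ← integral_indicator measurableSet_Ioo]
    congr 1 with u
    rw [integral_const_mul]
    by_cases hu : u ∈ Ioo a c
    · rw [indicator_of_mem hu, integral_indicator_mul_powKer β ψ ⟨hu.1, hu.2.le⟩, hw,
        indicator_of_mem hu]
    · rw [indicator_of_notMem hu, hw, indicator_of_notMem hu, zero_mul]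
  have hr : ∫ t, ∫ u, w u * ((Ioo a c).indicator ψ t * powKer β (c - a) (u - t)) =
      ∫ t in a..c, ψ t * ((c - t) ^ β * (x - c) ^ (-β) / (β * (x - t))) := by
    rw [intervalIntegral.integral_of_le hac.le, integral_Ioc_eq_integral_Ioo,
      ← integral_indicator measurableSet_Ioo]
    congr 1 with t
    by_cases ht : t ∈ Ioo a c
    · rw [indicator_of_mem ht, indicator_of_mem ht,
        ← integral_rpow_mul_rpow_singular hβ ht.2 hcx, ← intervalIntegral.integral_const_mul,
        intervalIntegral.integral_of_le ht.2.le, integral_Ioc_eq_integral_Ioo,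
        ← integral_indicator measurableSet_Ioo]
      congr 1 with u
      by_cases hu : u ∈ Ioo t c
      · have h1 : u ∈ Ioo a c := ⟨ht.1.trans hu.1, hu.2⟩
        have h2 : u - t ∈ Ioo 0 (c - a) := ⟨sub_pos.2 hu.1, by linarith [hu.2, ht.1]⟩
        rw [hw, powKer, indicator_of_mem hu, indicator_of_mem h1, indicator_of_mem h2]
        ring
      · rw [indicator_of_notMem hu]
        by_cases h1 : u ∈ Ioo a c
        · have h2 : u - t ∉ Ioo 0 (c - a) := fun h => hu ⟨sub_pos.1 h.1, h1.2⟩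
          rw [powKer, indicator_of_notMem h2, mul_zero, mul_zero]
        · rw [hw, indicator_of_notMem h1, zero_mul]
    · simp only [indicator_of_notMem ht, zero_mul, mul_zero, integral_zero]
  rw [← hl, ← hr, hswap]

theorem rpow_sub_rpow_le {β r ε : ℝ} (hβ1 : β ≤ 1) (hε : 0 ≤ ε) (hr : ε < r) :
    r ^ β - (r - ε) ^ β ≤ ε * r ^ (β - 1) := by
  have hr0 : 0 < r := hε.trans_lt hr
  have h1 : (r - ε) / r ≤ ((r - ε) / r) ^ β := by
    have := Real.rpow_le_rpow_of_exponent_ge (x := (r - ε) / r) (div_pos (sub_pos.2 hr) hr0)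
      ((div_le_one hr0).2 (by linarith)) hβ1
    rwa [Real.rpow_one] at this
  rw [Real.div_rpow (by linarith) hr0.le, le_div_iff₀ (by positivity)] at h1
  rw [Real.rpow_sub_one hr0.ne']
  have h2 : (r - ε) / r * r ^ β = r ^ β - ε * (r ^ β / r) := by field_simp
  linarith

theorem rpow_sub_rpow_pos_part_mem {β r ε : ℝ} (hβ0 : 0 ≤ β) (hβ1 : β ≤ 1) (hε : 0 ≤ ε)
    (hr : 0 ≤ r) : 0 ≤ r ^ β - max (r - ε) 0 ^ β ∧ r ^ β - max (r - ε) 0 ^ β ≤ ε ^ β := by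
  have h0 : 0 ≤ max (r - ε) 0 := le_max_right _ _
  constructor
  · exact sub_nonneg.2 (Real.rpow_le_rpow h0 (max_le (by linarith) hr) hβ0)
  · have h1 : r ^ β ≤ (max (r - ε) 0 + ε) ^ β :=
      Real.rpow_le_rpow hr (by linarith [le_max_left (r - ε) 0]) hβ0
    have h2 := Real.rpow_add_le_add_rpow h0 hε hβ0 hβ1
    linarith

theorem intervalIntegrable_rpow_sub_mul_of_lt {β : ℝ} {ψ : ℝ → ℝ} {a c x : ℝ} (hac : a ≤ c)
    (hcx : c < x) (hψ : IntervalIntegrable ψ volume a c) :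
    IntervalIntegrable (fun t => (x - t) ^ β * ψ t) volume a c := by
  refine hψ.continuousOn_mul (ContinuousOn.rpow_const (by fun_prop) fun t ht => Or.inl ?_)
  rw [uIcc_of_le hac] at ht
  linarith [ht.2]

theorem intervalIntegrable_rpow_mul_comp_sub {β : ℝ} (hβ : 0 < β) {ψ : ℝ → ℝ} {v w y : ℝ}
    (hvw : v ≤ w) (hψ : ContinuousOn ψ (Icc (y - w) (y - v))) :
    IntervalIntegrable (fun s => s ^ (β - 1) * ψ (y - s)) volume v w := by
  refine (intervalIntegral.intervalIntegrable_rpow' (by linarith)).mul_continuousOn ?_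
  rw [uIcc_of_le hvw]
  exact hψ.comp (by fun_prop) fun s hs => ⟨by linarith [hs.2], by linarith [hs.1]⟩

theorem intervalIntegrable_rpow_sub_mul {β : ℝ} (hβ : 0 < β) {ψ : ℝ → ℝ} {c x : ℝ}
    (hcx : c ≤ x) (hψ : ContinuousOn ψ (Icc c x)) :
    IntervalIntegrable (fun t => (x - t) ^ (β - 1) * ψ t) volume c x := by
  have h := (intervalIntegrable_rpow_mul_comp_sub hβ (v := 0) (w := x - c) (y := x)
    (by linarith) (by simpa using hψ)).comp_sub_left x
  simpa using h.symm

theorem rlInt_eq_add {β : ℝ} (hβ : 0 < β) {ψ : ℝ → ℝ} {a c x : ℝ} (hac : a ≤ c) (hcx : c < x)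
    (hi : IntervalIntegrable ψ volume a c) (hψ : ContinuousOn ψ (Icc c x)) :
    rlInt β a ψ x = (∫ t in a..c, (x - t) ^ (β - 1) * ψ t) +
      ∫ s in (0 : ℝ)..(x - c), s ^ (β - 1) * ψ (x - s) := by
  rw [rlInt, ← intervalIntegral.integral_add_adjacent_intervals
    (intervalIntegrable_rpow_sub_mul_of_lt hac hcx hi)
    (intervalIntegrable_rpow_sub_mul hβ hcx.le hψ)]
  congr 1
  have h := intervalIntegral.integral_comp_sub_left (a := c) (b := x)
    (fun s => s ^ (β - 1) * ψ (x - s)) x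
  simpa using h

theorem abs_rpow_sub_rpow_le_of_neg {β η r δ : ℝ} (hβ0 : 0 ≤ β) (hβ1 : β ≤ 1) (hη : 0 < η)
    (hr : η ≤ r) (hδ : 0 ≤ δ) :
    |(r + δ) ^ (β - 1) - r ^ (β - 1)| ≤ η ^ (β - 1) / η * δ := by
  have hr0 : 0 < r := hη.trans_le hr
  have hrd : 0 < r + δ := by linarith
  have h1 : (r + δ) ^ (β - 1) ≤ r ^ (β - 1) :=
    Real.rpow_le_rpow_of_nonpos hr0 (by linarith) (by linarith)
  have h2 : r ^ (β - 1) ≤ η ^ (β - 1) := Real.rpow_le_rpow_of_nonpos hη hr (by linarith)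
  have h3 : (r / (r + δ)) * r ^ (β - 1) ≤ (r + δ) ^ (β - 1) := by
    have := Real.rpow_le_rpow_of_exponent_ge (div_pos hr0 hrd)
      ((div_le_one hrd).2 (by linarith)) (by linarith : 1 - β ≤ 1)
    rw [Real.rpow_one, Real.div_rpow hr0.le hrd.le, ← neg_sub β 1, Real.rpow_neg hr0.le,
      Real.rpow_neg hrd.le, inv_div_inv, le_div_iff₀ (by positivity)] at this
    exact this
  rw [abs_of_nonpos (by linarith)]
  have h4 : r / (r + δ) * r ^ (β - 1) = r ^ (β - 1) - r ^ (β - 1) / (r + δ) * δ := by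
    field_simp
    ring
  have h5 : r ^ (β - 1) / (r + δ) ≤ η ^ (β - 1) / η := by
    gcongr
    linarith
  have h6 := mul_le_mul_of_nonneg_right h5 hδ
  linarith

theorem continuousOn_of_abs_sub_le {ψ : ℝ → ℝ} {s : Set ℝ} {K : ℝ}
    (hψ : ∀ z ∈ s, ∀ z' ∈ s, |ψ z - ψ z'| ≤ K * |z - z'|) : ContinuousOn ψ s :=
  (LipschitzOnWith.of_dist_le_mul (K := Real.toNNReal K) fun z hz z' hz' =>
    (hψ z hz z' hz').trans (mul_le_mul_of_nonneg_right (Real.le_coe_toNNReal K)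
      (abs_nonneg _))).continuousOn

theorem rlInt_lipschitz {β : ℝ} (hβ0 : 0 < β) (hβ1 : β < 1) {ψ : ℝ → ℝ} {a c c' d K : ℝ}
    (hac : a ≤ c) (hcc' : c < c') (hi : IntervalIntegrable ψ volume a c)
    (hψ : ∀ z ∈ Icc c d, ∀ z' ∈ Icc c d, |ψ z - ψ z'| ≤ K * |z - z'|) :
    ∃ M, ∀ u ∈ Icc c' d, ∀ x ∈ Icc c' d, |rlInt β a ψ x - rlInt β a ψ u| ≤ M * |x - u| := by
  have hcont : ContinuousOn ψ (Icc c d) := continuousOn_of_abs_sub_le hψ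
  obtain ⟨B, hB⟩ := isCompact_Icc.exists_bound_of_continuousOn hcont
  set η := c' - c with hη
  have hη0 : 0 < η := sub_pos.2 hcc'
  set A := η ^ (β - 1) / η with hA
  set I₁ := ∫ t in a..c, |ψ t| with hI₁
  set I₂ := ∫ s in (0 : ℝ)..(d - c), s ^ (β - 1) with hI₂
  suffices h : ∀ u ∈ Icc c' d, ∀ x ∈ Icc c' d, u ≤ x → |rlInt β a ψ x - rlInt β a ψ u| ≤
      (A * I₁ + |K| * I₂ + η ^ (β - 1) * B) * |x - u| by
    refine ⟨A * I₁ + |K| * I₂ + η ^ (β - 1) * B, fun u hu x hx => ?_⟩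
    rcases le_total u x with h' | h'
    · exact h u hu x hx h'
    · rw [abs_sub_comm, abs_sub_comm x u]
      exact h x hx u hu h'
  intro u hu x hx hux
  have hcu : c < u := hcc'.trans_le hu.1
  have hcx : c < x := hcu.trans_le hux
  have hxu : 0 ≤ x - u := sub_nonneg.2 hux
  have hcx' : ContinuousOn ψ (Icc c x) := hcont.mono (Icc_subset_Icc_right hx.2)
  have hcu' : ContinuousOn ψ (Icc c u) := hcont.mono (Icc_subset_Icc_right hu.2)
  have j1 : IntervalIntegrable (fun s => s ^ (β - 1) * ψ (x - s)) volume 0 (u - c) :=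
    intervalIntegrable_rpow_mul_comp_sub hβ0 (by linarith)
      (hcx'.mono (Icc_subset_Icc (by linarith) (by linarith)))
  have j2 : IntervalIntegrable (fun s => s ^ (β - 1) * ψ (x - s)) volume (u - c) (x - c) :=
    intervalIntegrable_rpow_mul_comp_sub hβ0 (by linarith)
      (hcx'.mono (Icc_subset_Icc (by linarith) (by linarith)))
  have j3 : IntervalIntegrable (fun s => s ^ (β - 1) * ψ (u - s)) volume 0 (u - c) :=
    intervalIntegrable_rpow_mul_comp_sub hβ0 (by linarith)
      (hcu'.mono (Icc_subset_Icc (by linarith) (by linarith)))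
  have hpow : ∀ v w : ℝ, IntervalIntegrable (fun s : ℝ => s ^ (β - 1)) volume v w := fun v w =>
    intervalIntegral.intervalIntegrable_rpow' (by linarith)
  have e : rlInt β a ψ x - rlInt β a ψ u =
      (∫ t in a..c, ((x - t) ^ (β - 1) * ψ t - (u - t) ^ (β - 1) * ψ t)) +
      (∫ s in (0 : ℝ)..(u - c), (s ^ (β - 1) * ψ (x - s) - s ^ (β - 1) * ψ (u - s))) +
      ∫ s in (u - c)..(x - c), s ^ (β - 1) * ψ (x - s) := by
    rw [rlInt_eq_add hβ0 hac hcx hi hcx', rlInt_eq_add hβ0 hac hcu hi hcu',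
      intervalIntegral.integral_sub (intervalIntegrable_rpow_sub_mul_of_lt hac hcx hi)
      (intervalIntegrable_rpow_sub_mul_of_lt hac hcu hi), intervalIntegral.integral_sub j1 j3,
      ← intervalIntegral.integral_add_adjacent_intervals j1 j2]
    ring
  have b1 : |∫ t in a..c, ((x - t) ^ (β - 1) * ψ t - (u - t) ^ (β - 1) * ψ t)| ≤
      A * (x - u) * I₁ := by
    rw [hI₁, ← intervalIntegral.integral_const_mul]
    refine (Real.norm_eq_abs _).ge.trans (intervalIntegral.norm_integral_le_of_norm_le hac
      (ae_of_all _ fun t ht => ?_) (hi.abs.const_mul _))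
    rw [← sub_mul, norm_mul, Real.norm_eq_abs, Real.norm_eq_abs]
    refine mul_le_mul_of_nonneg_right ?_ (abs_nonneg _)
    have h := abs_rpow_sub_rpow_le_of_neg hβ0.le hβ1.le hη0 (r := u - t)
      (by linarith [hu.1, ht.2]) hxu
    rwa [show u - t + (x - u) = x - t by ring] at h
  have b2 : |∫ s in (0 : ℝ)..(u - c), (s ^ (β - 1) * ψ (x - s) - s ^ (β - 1) * ψ (u - s))| ≤
      |K| * (x - u) * I₂ := by
    have h1 : |∫ s in (0 : ℝ)..(u - c), (s ^ (β - 1) * ψ (x - s) - s ^ (β - 1) * ψ (u - s))| ≤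
        ∫ s in (0 : ℝ)..(u - c), |K| * (x - u) * s ^ (β - 1) := by
      refine (Real.norm_eq_abs _).ge.trans (intervalIntegral.norm_integral_le_of_norm_le
        (by linarith : (0 : ℝ) ≤ u - c) (ae_of_all _ fun s hs => ?_) ((hpow _ _).const_mul _))
      have hs0 : 0 ≤ s ^ (β - 1) := Real.rpow_nonneg hs.1.le _
      rw [← mul_sub, norm_mul, Real.norm_eq_abs, Real.norm_eq_abs, abs_of_nonneg hs0, mul_comm]
      refine mul_le_mul_of_nonneg_right ?_ hs0
      have h := hψ (x - s) ⟨by linarith [hs.2], by linarith [hs.1, hx.2]⟩ (u - s)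
        ⟨by linarith [hs.2], by linarith [hs.1, hu.2]⟩
      rw [sub_sub_sub_cancel_right, abs_of_nonneg hxu] at h
      exact h.trans (mul_le_mul_of_nonneg_right (le_abs_self K) hxu)
    refine h1.trans ?_
    rw [intervalIntegral.integral_const_mul]
    refine mul_le_mul_of_nonneg_left ?_ (by positivity)
    refine intervalIntegral.integral_mono_interval le_rfl (by linarith) (by linarith [hu.2]) ?_
      (hpow _ _)
    exact (ae_restrict_iff' measurableSet_Ioc).2
      (ae_of_all _ fun s hs => Real.rpow_nonneg hs.1.le _)
  have b3 : |∫ s in (u - c)..(x - c), s ^ (β - 1) * ψ (x - s)| ≤ η ^ (β - 1) * B * (x - u) := by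
    have h := intervalIntegral.norm_integral_le_of_norm_le_const (a := u - c) (b := x - c)
      (f := fun s => s ^ (β - 1) * ψ (x - s)) (C := η ^ (β - 1) * B) fun s hs => by
        rw [uIoc_of_le (by linarith)] at hs
        have hηs : η ≤ s := by linarith [hs.1, hu.1]
        rw [norm_mul, Real.norm_eq_abs, abs_of_nonneg (Real.rpow_nonneg (by linarith) _)]
        refine mul_le_mul (Real.rpow_le_rpow_of_nonpos hη0 hηs (by linarith))
          (hB _ ⟨by linarith [hs.2], by linarith [hx.2]⟩) (norm_nonneg _)
          (Real.rpow_nonneg hη0.le _)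
    rwa [sub_sub_sub_cancel_right, abs_of_nonneg hxu] at h
  rw [e, abs_of_nonneg hxu]
  refine (abs_add_three _ _ _).trans ?_
  linarith

theorem continuousOn_rlInt {β : ℝ} (hβ0 : 0 < β) (hβ1 : β < 1) {ψ : ℝ → ℝ} {a b : ℝ}
    (hi : IntervalIntegrable ψ volume a b)
    (hψ : ∀ c d : ℝ, a < c → c ≤ d → d < b →
      ∃ K : ℝ, ∀ z ∈ Icc c d, ∀ z' ∈ Icc c d, |ψ z - ψ z'| ≤ K * |z - z'|) :
    ContinuousOn (rlInt β a ψ) (Ioo a b) := by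
  intro x hx
  obtain ⟨c, hac, hcx⟩ := exists_between hx.1
  obtain ⟨c', hcc', hcx'⟩ := exists_between hcx
  obtain ⟨d, hxd, hdb⟩ := exists_between hx.2
  obtain ⟨K, hK⟩ := hψ c d hac (hcx.trans hxd).le hdb
  have hic : IntervalIntegrable ψ volume a c := hi.mono_set (uIcc_subset_uIcc left_mem_uIcc (by
    rw [uIcc_of_le (hx.1.trans hx.2).le]; exact ⟨hac.le, (hcx.trans hx.2).le⟩))
  obtain ⟨M, hM⟩ := rlInt_lipschitz hβ0 hβ1 hac.le hcc' hic hK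
  have hco : ContinuousOn (rlInt β a ψ) (Icc c' d) :=
    continuousOn_of_abs_sub_le fun z hz z' hz' => hM z' hz' z hz
  exact (hco.continuousAt (Icc_mem_nhds hcx' hxd)).continuousWithinAt

theorem intervalIntegrable_of_isBigO_rpow {f : ℝ → ℝ} {γ d : ℝ} (hγ : γ < 1) (hd : 0 < d)
    (hf : ContinuousOn f (Ioc 0 d)) (hO : f =O[𝓝[>] 0] fun h => h ^ (-γ)) :
    IntervalIntegrable f volume 0 d := by
  have hpow : IntegrableAtFilter (fun h : ℝ => h ^ (-γ)) (𝓝[>] 0) :=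
    ⟨Ioc 0 d, Ioc_mem_nhdsGT hd, (intervalIntegrable_iff_integrableOn_Ioc_of_le hd.le).1
      (intervalIntegral.intervalIntegrable_rpow' (by linarith))⟩
  obtain ⟨s, hs, hfs⟩ := hO.integrableAtFilter
    ⟨Ioc 0 d, Ioc_mem_nhdsGT hd, hf.aestronglyMeasurable measurableSet_Ioc⟩ hpow
  obtain ⟨e, he, hes⟩ := mem_nhdsGT_iff_exists_Ioc_subset.1 hs
  rw [mem_Ioi] at he
  have h1 : IntervalIntegrable f volume 0 (min e d) := by
    rw [intervalIntegrable_iff_integrableOn_Ioc_of_le (le_min he.le hd.le)]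
    exact hfs.mono_set ((Ioc_subset_Ioc_right (min_le_left _ _)).trans hes)
  refine h1.trans (ContinuousOn.intervalIntegrable ?_)
  rw [uIcc_of_le (min_le_right _ _)]
  exact hf.mono fun z hz => ⟨(lt_min he hd).trans_le hz.1, hz.2⟩

theorem intervalIntegrable_of_isBigO_rpow_endpoints {f : ℝ → ℝ} {γ a b : ℝ} (hγ : γ < 1)
    (hab : a < b) (hf : ContinuousOn f (Ioo a b))
    (ha : (fun h => f (a + h)) =O[𝓝[>] 0] fun h => h ^ (-γ))
    (hb : (fun h => f (b - h)) =O[𝓝[>] 0] fun h => h ^ (-γ)) :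
    IntervalIntegrable f volume a b := by
  have hd : 0 < (b - a) / 2 := by linarith
  have h1 := (intervalIntegrable_of_isBigO_rpow hγ hd (hf.comp (by fun_prop) fun z hz =>
    ⟨by linarith [hz.1], by linarith [hz.1, hz.2]⟩) ha).comp_sub_right a
  have h2 := (intervalIntegrable_of_isBigO_rpow hγ hd (hf.comp (by fun_prop) fun z hz =>
    ⟨by linarith [hz.1, hz.2], by linarith [hz.1]⟩) hb).comp_sub_left b
  simp only [Function.comp_def, add_sub_cancel, zero_add] at h1
  simp only [Function.comp_def, sub_sub_cancel, sub_zero] at h2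
  rw [show b - (b - a) / 2 = (b - a) / 2 + a by ring] at h2
  exact h1.trans h2.symm

theorem intervalIntegrable_rpow_mul_sub {β : ℝ} (hβ1 : β < 1) {f : ℝ → ℝ} {a c x M : ℝ}
    (hac : a ≤ c) (hcx : c < x) (hf : IntervalIntegrable f volume a x)
    (hM : ∀ u ∈ Icc c x, |f u - f x| ≤ M * |u - x|) :
    IntervalIntegrable (fun u => (x - u) ^ (-β - 1) * (f u - f x)) volume a x := by
  have hmem : c ∈ uIcc a x := by
    rw [uIcc_of_le (hac.trans hcx.le)]
    exact ⟨hac, hcx.le⟩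
  have h1 : IntervalIntegrable f volume a c := hf.mono_set (uIcc_subset_uIcc left_mem_uIcc hmem)
  have h2 : IntervalIntegrable f volume c x := hf.mono_set (uIcc_subset_uIcc hmem right_mem_uIcc)
  refine (intervalIntegrable_rpow_sub_mul_of_lt hac hcx
    (h1.sub intervalIntegrable_const)).trans ?_
  have hpow : IntervalIntegrable (fun u => M * (x - u) ^ (-β)) volume c x := by
    have := ((intervalIntegral.intervalIntegrable_rpow' (a := 0) (b := x - c)
      (by linarith : -1 < -β)).comp_sub_left x).const_mul M
    simpa using this.symm
  rw [intervalIntegrable_iff_integrableOn_Ioc_of_le hcx.le] at hpow h2 ⊢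
  refine Integrable.mono' hpow (AEStronglyMeasurable.mul
    (by fun_prop : Measurable fun u => (x - u) ^ (-β - 1)).aestronglyMeasurable
    (h2.aestronglyMeasurable.sub aestronglyMeasurable_const))
    ((ae_restrict_iff' measurableSet_Ioc).2 (ae_of_all _ fun u hu => ?_))
  rcases hu.2.eq_or_lt with rfl | hux
  · rcases eq_or_ne β 0 with rfl | hβ
    · have := hM c ⟨le_rfl, hcx.le⟩
      have hM0 : 0 ≤ M := by
        by_contra hneg
        have h3 : M * |c - u| < 0 :=
          mul_neg_of_neg_of_pos (not_le.1 hneg) (abs_pos.2 (sub_ne_zero.2 hcx.ne))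
        linarith [abs_nonneg (f c - f u)]
      simpa using hM0
    · simp [Real.zero_rpow (neg_ne_zero.2 hβ)]
  · have hp : 0 < x - u := sub_pos.2 hux
    have h3 := hM u ⟨hu.1.le, hu.2⟩
    rw [abs_sub_comm u x, abs_of_pos hp] at h3
    rw [norm_mul, Real.norm_eq_abs, Real.norm_eq_abs, abs_of_nonneg (Real.rpow_nonneg hp.le _),
      show (x - u) ^ (-β) = (x - u) ^ (-β - 1) * (x - u) by
        rw [← Real.rpow_add_one hp.ne', sub_add_cancel]]
    calc (x - u) ^ (-β - 1) * |f u - f x| ≤ (x - u) ^ (-β - 1) * (M * (x - u)) := by gcongr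
      _ = _ := by ring

theorem integral_rpow_mul_rpow_eq_Gamma {β L : ℝ} (hβ0 : 0 < β) (hβ1 : β < 1) (hL : 0 < L) :
    ∫ s in (0 : ℝ)..L, s ^ (β - 1) * (L - s) ^ (-β) = Real.Gamma β * Real.Gamma (1 - β) := by
  have h := Complex.betaIntegral_scaled (β : ℂ) ((1 - β : ℝ) : ℂ) hL
  rw [Complex.betaIntegral_eq_Gamma_mul_div _ _ (by simpa) (by simpa), Complex.Gamma_ofReal,
    Complex.Gamma_ofReal] at h
  apply Complex.ofReal_injective
  rw [← intervalIntegral.integral_ofReal]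
  simp only [Complex.ofReal_sub, Complex.ofReal_one, add_sub_cancel, sub_self, Complex.cpow_zero,
    Complex.Gamma_one, one_mul, div_one, sub_sub_cancel_left] at h
  rw [Complex.ofReal_mul, ← h]
  refine intervalIntegral.integral_congr fun s hs => ?_
  rw [uIcc_of_le hL.le] at hs
  simp only [Complex.ofReal_mul, Complex.ofReal_cpow hs.1,
    Complex.ofReal_cpow (sub_nonneg.2 hs.2), Complex.ofReal_sub, Complex.ofReal_one,
    Complex.ofReal_neg]

theorem rlInt_one {β : ℝ} (hβ : 0 < β) (a u : ℝ) :
    rlInt β a (fun _ => 1) u = (u - a) ^ β / β := by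
  have h := intervalIntegral.integral_comp_sub_left (a := a) (b := u)
    (fun s => s ^ (β - 1)) u
  simp only [rlInt, mul_one]
  rw [h, sub_self, integral_rpow (Or.inl (by linarith)), sub_add_cancel, Real.zero_rpow hβ.ne',
    sub_zero]

/-- The Marchaud form of the fractional derivative of order `β` based at `a`, without the factor
`1 / Γ(-β)`. -/
noncomputable def marchaud (β a : ℝ) (f : ℝ → ℝ) (x : ℝ) : ℝ :=
  (∫ u in a..x, (x - u) ^ (-β - 1) * (f u - f x)) - f x * ((x - a) ^ (-β) / β)

theorem marchaud_rlInt_one {β a x : ℝ} (hβ0 : 0 < β) (hβ1 : β < 1) (hax : a < x) :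
    marchaud β a (rlInt β a fun _ => 1) x = Real.Gamma β * Real.Gamma (-β) := by
  have hL : 0 < x - a := sub_pos.2 hax
  obtain ⟨c, hac, hcx⟩ := exists_between hax
  obtain ⟨M, hM⟩ := rlInt_lipschitz hβ0 hβ1 (a := a) (c := a) (c' := c) (d := x) (K := 0) le_rfl hac
    IntervalIntegrable.refl (ψ := fun _ => 1) (by simp)
  have hM' : ∀ u ∈ Icc c x, |rlInt β a (fun _ => 1) u - rlInt β a (fun _ => 1) x| ≤ M * |u - x| :=
    fun u hu => hM x ⟨hcx.le, le_rfl⟩ u hu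
  have hint := intervalIntegrable_rpow_mul_sub hβ1 hac.le hcx
    (intervalIntegrable_rlInt hβ0 hax.le intervalIntegrable_const) hM'
  set F : ℝ → ℝ := fun u => (x - u) ^ (-β) * ((u - a) ^ β / β - (x - a) ^ β / β) / β with hF
  have hint2 : IntervalIntegrable (fun u => (x - u) ^ (-β) * (u - a) ^ (β - 1)) volume a x := by
    have h1 := (intervalIntegral.intervalIntegrable_rpow' (a := 0) (b := c - a)
      (by linarith : -1 < β - 1)).comp_sub_right a
    have h2 := (intervalIntegral.intervalIntegrable_rpow' (a := 0) (b := x - c)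
      (by linarith : -1 < -β)).comp_sub_left x
    simp only [zero_add, sub_add_cancel] at h1
    simp only [sub_zero, sub_sub_cancel] at h2
    refine (h1.continuousOn_mul ?_).trans (h2.symm.mul_continuousOn ?_)
    · rw [uIcc_of_le hac.le]
      exact ContinuousOn.rpow_const (by fun_prop) fun u hu => Or.inl (by linarith [hu.2])
    · rw [uIcc_of_le hcx.le]
      exact ContinuousOn.rpow_const (by fun_prop) fun u hu => Or.inl (by linarith [hu.1])
  have hcont : ContinuousOn F (Icc a x) := by
    intro u hu
    rcases hu.2.eq_or_lt with hux | hux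
    · rw [hux]
      have hlim : Tendsto (fun v => M / β * (x - v) ^ (1 - β)) (𝓝[Icc a x] x) (𝓝 0) := by
        have h1 : ContinuousAt (fun v => M / β * (x - v) ^ (1 - β)) x :=
          (ContinuousAt.rpow_const (by fun_prop) (Or.inr (by linarith))).const_mul _
        have h2 := h1.tendsto.mono_left (nhdsWithin_le_nhds (s := Icc a x))
        rwa [sub_self, Real.zero_rpow (by linarith), mul_zero] at h2
      rw [ContinuousWithinAt, show F x = 0 by simp [hF]]
      refine squeeze_zero_norm' ?_ hlim
      filter_upwards [self_mem_nhdsWithin, nhdsWithin_le_nhds (Ioi_mem_nhds hcx)] with v hv hv'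
      have h3 := hM' v ⟨(mem_Ioi.1 hv').le, hv.2⟩
      rw [rlInt_one hβ0, rlInt_one hβ0] at h3
      rcases hv.2.eq_or_lt with hvx | hvx
      · simp [hvx, hF, Real.zero_rpow (sub_pos.2 hβ1).ne']
      · have hp : 0 < x - v := sub_pos.2 hvx
        rw [abs_sub_comm v x, abs_of_pos hp] at h3
        rw [hF, norm_div, norm_mul, Real.norm_eq_abs, Real.norm_eq_abs, Real.norm_eq_abs,
          abs_of_pos hβ0, abs_of_nonneg (Real.rpow_nonneg hp.le _),
          show (x - v) ^ (1 - β) = (x - v) ^ (-β) * (x - v) by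
            rw [← Real.rpow_add_one hp.ne', neg_add_eq_sub], div_mul_eq_mul_div]
        refine div_le_div_of_nonneg_right ?_ hβ0.le
        calc _ ≤ (x - v) ^ (-β) * (M * (x - v)) := by gcongr
          _ = _ := by ring
    · have h1 : 0 < x - u := sub_pos.2 hux
      refine ContinuousAt.continuousWithinAt ?_
      refine ((ContinuousAt.rpow_const (by fun_prop) (Or.inl h1.ne')).mul ?_).div_const _
      exact ((ContinuousAt.rpow_const (by fun_prop) (Or.inr hβ0.le)).div_const _).sub_const _
  have hder : ∀ u ∈ Ioo a x, HasDerivAt F ((x - u) ^ (-β - 1) *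
      (rlInt β a (fun _ => 1) u - rlInt β a (fun _ => 1) x) +
      1 / β * ((x - u) ^ (-β) * (u - a) ^ (β - 1))) u := by
    intro u hu
    have h1 : 0 < u - a := sub_pos.2 hu.1
    have h2 : 0 < x - u := sub_pos.2 hu.2
    rw [rlInt_one hβ0 a u, rlInt_one hβ0 a x]
    have hd := (((((hasDerivAt_id u).const_sub x).rpow_const (p := -β) (Or.inl h2.ne')).fun_mul
      (((((hasDerivAt_id u).sub_const a).rpow_const (p := β) (Or.inl h1.ne')).div_const
        β).sub_const ((x - a) ^ β / β))).div_const β)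
    refine hd.congr_deriv ?_
    simp only [id]
    field_simp
  have hFTC := intervalIntegral.integral_eq_sub_of_hasDerivAt_of_le hax.le hcont hder
    (hint.add (hint2.const_mul _))
  rw [intervalIntegral.integral_add hint (hint2.const_mul _),
    intervalIntegral.integral_const_mul] at hFTC
  have hB : ∫ u in a..x, (x - u) ^ (-β) * (u - a) ^ (β - 1) =
      Real.Gamma β * Real.Gamma (1 - β) := by
    rw [← integral_rpow_mul_rpow_eq_Gamma hβ0 hβ1 hL]
    have h := intervalIntegral.integral_comp_sub_right (a := a) (b := x)
      (fun s => s ^ (β - 1) * (x - a - s) ^ (-β)) a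
    rw [sub_self] at h
    rw [← h]
    congr 1 with u
    rw [mul_comm]
    congr 2
    ring
  have hG : Real.Gamma (1 - β) = -β * Real.Gamma (-β) := by
    rw [← Real.Gamma_add_one (neg_ne_zero.2 hβ0.ne'), neg_add_eq_sub]
  have hFx : F x = 0 := by simp [hF]
  have hFa : F a = -((x - a) ^ β / β * ((x - a) ^ (-β) / β)) := by
    simp only [hF, sub_self, Real.zero_rpow hβ0.ne']
    ring
  rw [hB, hG, hFx, hFa] at hFTC
  rw [marchaud, rlInt_one hβ0 a x]
  rw [rlInt_one hβ0 a x] at hFTC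
  have : 1 / β * (Real.Gamma β * (-β * Real.Gamma (-β))) = -(Real.Gamma β * Real.Gamma (-β)) := by
    field_simp
  linarith

theorem intervalIntegrable_div_sub {χ : ℝ → ℝ} {a c x K : ℝ} (hac : a ≤ c) (hcx : c < x)
    (hi : IntervalIntegrable χ volume a x) (hK : ∀ t ∈ Icc c x, |χ t| ≤ K * (x - t)) :
    IntervalIntegrable (fun t => χ t / (x - t)) volume a x := by
  have hmem : c ∈ uIcc a x := by
    rw [uIcc_of_le (hac.trans hcx.le)]
    exact ⟨hac, hcx.le⟩
  have h1 : IntervalIntegrable χ volume a c := hi.mono_set (uIcc_subset_uIcc left_mem_uIcc hmem)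
  have h2 : IntervalIntegrable χ volume c x := hi.mono_set (uIcc_subset_uIcc hmem right_mem_uIcc)
  have hK0 : 0 ≤ K := nonneg_of_mul_nonneg_left
    ((abs_nonneg _).trans (hK c ⟨le_rfl, hcx.le⟩)) (sub_pos.2 hcx)
  have h3 : IntervalIntegrable (fun t => χ t / (x - t)) volume a c := by
    simp only [div_eq_mul_inv]
    refine h1.mul_continuousOn (ContinuousOn.inv₀ (by fun_prop) fun t ht => ?_)
    rw [uIcc_of_le hac] at ht
    linarith [ht.2]
  refine h3.trans ?_
  rw [intervalIntegrable_iff_integrableOn_Ioc_of_le hcx.le] at h2 ⊢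
  refine Integrable.mono' (g := fun _ => K) (integrable_const K) (h2.aestronglyMeasurable.div₀
    (by fun_prop : Measurable fun t => x - t).aestronglyMeasurable)
    ((ae_restrict_iff' measurableSet_Ioc).2 (ae_of_all _ fun t ht => ?_))
  rcases ht.2.eq_or_lt with htx | htx
  · simpa [htx] using hK0
  · have hp : 0 < x - t := sub_pos.2 htx
    rw [norm_div, Real.norm_eq_abs, Real.norm_eq_abs, abs_of_pos hp,
      div_le_iff₀ hp]
    exact hK t ⟨ht.1.le, ht.2⟩

theorem integral_rpow_sub_neg {β a c x : ℝ} (hβ : 0 < β) (hac : a ≤ c) (hcx : c < x) :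
    ∫ u in a..c, (x - u) ^ (-β - 1) = ((x - c) ^ (-β) - (x - a) ^ (-β)) / β := by
  rw [intervalIntegral.integral_comp_sub_left (fun s => s ^ (-β - 1)) x,
    integral_rpow (Or.inr ⟨by linarith, fun h => ?_⟩), sub_add_cancel]
  · field_simp
    ring
  · rw [uIcc_of_le (by linarith)] at h
    linarith [h.1]

theorem integral_rpow_mul_rlInt_sub {β : ℝ} (hβ : 0 < β) {χ : ℝ → ℝ} {a c₀ x K ε : ℝ}
    (hac : a ≤ c₀) (hcx : c₀ < x) (hi : IntervalIntegrable χ volume a x)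
    (hK : ∀ t ∈ Icc c₀ x, |χ t| ≤ K * (x - t)) (hε : 0 < ε) (hεx : ε < x - a) :
    (∫ u in a..(x - ε), (x - u) ^ (-β - 1) * (rlInt β a χ u - rlInt β a χ x)) -
        rlInt β a χ x * ((x - a) ^ (-β) / β) =
      -(1 / β) * ∫ t in a..x,
        χ t / (x - t) * (((x - t) ^ β - max (x - t - ε) 0 ^ β) / ε ^ β) := by
  have hax : a < x := by linarith
  have hac' : a < x - ε := by linarith
  have hcx' : x - ε < x := by linarith
  have hmem : x - ε ∈ uIcc a x := by
    rw [uIcc_of_le hax.le]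
    exact ⟨hac'.le, hcx'.le⟩
  have hsub : uIcc a (x - ε) ⊆ uIcc a x := uIcc_subset_uIcc left_mem_uIcc hmem
  have hi' : IntervalIntegrable χ volume a (x - ε) := hi.mono_set hsub
  have hχx : χ x = 0 := by
    have := hK x ⟨hcx.le, le_rfl⟩
    rw [sub_self, mul_zero] at this
    exact abs_nonpos_iff.1 this
  have hh := intervalIntegrable_div_sub hac hcx hi hK
  have g1 : IntervalIntegrable (fun t => χ t / (x - t) * (x - t) ^ β) volume a x :=
    hh.mul_continuousOn (ContinuousOn.rpow_const (by fun_prop) fun _ _ => Or.inr hβ.le)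
  have g2 : IntervalIntegrable (fun t => χ t / (x - t) * max (x - t - ε) 0 ^ β) volume a x :=
    hh.mul_continuousOn (ContinuousOn.rpow_const (by fun_prop) fun _ _ => Or.inr hβ.le)
  have e1 : ∫ t in a..x, χ t / (x - t) * (x - t) ^ β = rlInt β a χ x := by
    refine intervalIntegral.integral_congr fun t ht => ?_
    rw [uIcc_of_le hax.le] at ht
    rcases ht.2.eq_or_lt with htx | htx
    · simp [htx, hχx]
    · have hp : 0 < x - t := sub_pos.2 htx
      simp only [Real.rpow_sub_one hp.ne']
      field_simp
  have e2 : ∫ t in a..x, χ t / (x - t) * max (x - t - ε) 0 ^ β =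
      β * ε ^ β * ∫ u in a..(x - ε), (x - u) ^ (-β - 1) * rlInt β a χ u := by
    rw [integral_rpow_mul_rlInt hβ hac' hcx' hi',
      ← intervalIntegral.integral_add_adjacent_intervals (g2.mono_set hsub)
        (g2.mono_set (uIcc_subset_uIcc hmem right_mem_uIcc)),
      ← intervalIntegral.integral_const_mul]
    have z : ∫ t in (x - ε)..x, χ t / (x - t) * max (x - t - ε) 0 ^ β = 0 := by
      rw [intervalIntegral.integral_congr (g := fun _ => (0 : ℝ)) fun t ht => ?_,
        intervalIntegral.integral_zero]
      rw [uIcc_of_le hcx'.le] at ht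
      simp only [max_eq_right (by linarith [ht.1] : x - t - ε ≤ 0), Real.zero_rpow hβ.ne',
        mul_zero]
    rw [z, add_zero]
    refine intervalIntegral.integral_congr fun t ht => ?_
    rw [uIcc_of_le hac'.le] at ht
    have hp : 0 < x - t := by linarith [ht.2]
    have hεβ : (0 : ℝ) < ε ^ β := Real.rpow_pos_of_pos hε _
    simp only [max_eq_left (by linarith [ht.2] : 0 ≤ x - t - ε), sub_sub_cancel,
      Real.rpow_neg hε.le, sub_right_comm x ε t]
    field_simp
  have hεβ : (0 : ℝ) < ε ^ β := Real.rpow_pos_of_pos hε _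
  have e3 : ∫ t in a..x, χ t / (x - t) * (((x - t) ^ β - max (x - t - ε) 0 ^ β) / ε ^ β) =
      (rlInt β a χ x - β * ε ^ β *
        ∫ u in a..(x - ε), (x - u) ^ (-β - 1) * rlInt β a χ u) / ε ^ β := by
    rw [← e1, ← e2, ← intervalIntegral.integral_sub g1 g2, ← intervalIntegral.integral_div]
    congr 1 with t
    ring
  have i1 : IntervalIntegrable (fun u => (x - u) ^ (-β - 1) * rlInt β a χ u) volume a (x - ε) :=
    intervalIntegrable_rpow_sub_mul_of_lt hac'.le hcx' (intervalIntegrable_rlInt hβ hac'.le hi')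
  have i2 : IntervalIntegrable (fun u => (x - u) ^ (-β - 1) * rlInt β a χ x) volume a (x - ε) :=
    intervalIntegrable_rpow_sub_mul_of_lt hac'.le hcx' intervalIntegrable_const
  simp only [mul_sub]
  rw [intervalIntegral.integral_sub i1 i2, intervalIntegral.integral_mul_const,
    integral_rpow_sub_neg hβ hac'.le hcx', e3, sub_sub_cancel, Real.rpow_neg hε.le]
  field_simp
  ring

theorem marchaud_rlInt_of_abs_le {β : ℝ} (hβ0 : 0 < β) (hβ1 : β < 1) {χ : ℝ → ℝ} {a c x K : ℝ}
    (hac : a ≤ c) (hcx : c < x) (hi : IntervalIntegrable χ volume a x)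
    (hK : ∀ t ∈ Icc c x, |χ t| ≤ K * (x - t))
    (hint : IntervalIntegrable (fun u => (x - u) ^ (-β - 1) * (rlInt β a χ u - rlInt β a χ x))
      volume a x) :
    marchaud β a (rlInt β a χ) x = 0 := by
  have hax : a < x := hac.trans_lt hcx
  have hh := intervalIntegrable_div_sub hac hcx hi hK
  have hev : ∀ᶠ ε in 𝓝[>] (0 : ℝ), ε ∈ Ioo 0 (x - a) := Ioo_mem_nhdsGT (sub_pos.2 hax)
  have hleft : Tendsto (fun ε => (∫ u in a..(x - ε), (x - u) ^ (-β - 1) *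
      (rlInt β a χ u - rlInt β a χ x)) - rlInt β a χ x * ((x - a) ^ (-β) / β)) (𝓝[>] 0)
      (𝓝 (marchaud β a (rlInt β a χ) x)) := by
    refine Tendsto.sub_const ?_ _
    have hc := intervalIntegral.continuousOn_primitive_interval' hint left_mem_uIcc x
      right_mem_uIcc
    refine hc.tendsto.comp (tendsto_nhdsWithin_iff.2 ⟨?_, ?_⟩)
    · have : Tendsto (fun ε : ℝ => x - ε) (𝓝 0) (𝓝 (x - 0)) := tendsto_id.const_sub x
      rw [sub_zero] at this
      exact this.mono_left nhdsWithin_le_nhds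
    · filter_upwards [hev] with ε hε
      rw [uIcc_of_le hax.le]
      exact ⟨by linarith [hε.2], by linarith [hε.1]⟩
  have hright : Tendsto (fun ε => ∫ t in a..x, χ t / (x - t) *
      (((x - t) ^ β - max (x - t - ε) 0 ^ β) / ε ^ β)) (𝓝[>] 0) (𝓝 (∫ _ in a..x, (0 : ℝ))) := by
    refine intervalIntegral.tendsto_integral_filter_of_dominated_convergence
      (fun t => |χ t / (x - t)|) (Eventually.of_forall fun ε => ?_) ?_ hh.abs
      (ae_of_all _ fun t ht => ?_)
    · rw [uIoc_of_le hax.le]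
      exact ((intervalIntegrable_iff_integrableOn_Ioc_of_le hax.le).1 hh).aestronglyMeasurable.mul
        (by fun_prop : Measurable fun t : ℝ =>
          ((x - t) ^ β - max (x - t - ε) 0 ^ β) / ε ^ β).aestronglyMeasurable
    · filter_upwards [hev] with ε hε
      refine ae_of_all _ fun t ht => ?_
      rw [uIoc_of_le hax.le] at ht
      obtain ⟨h1, h2⟩ := rpow_sub_rpow_pos_part_mem hβ0.le hβ1.le hε.1.le (sub_nonneg.2 ht.2)
      have hεβ : (0 : ℝ) < ε ^ β := Real.rpow_pos_of_pos hε.1 _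
      rw [norm_mul, Real.norm_eq_abs, Real.norm_eq_abs, abs_of_nonneg (div_nonneg h1 hεβ.le)]
      exact mul_le_of_le_one_right (abs_nonneg _) ((div_le_one hεβ).2 h2)
    · rw [uIoc_of_le hax.le] at ht
      rcases ht.2.eq_or_lt with htx | htx
      · simp [htx]
      have hp : 0 < x - t := sub_pos.2 htx
      have hz : Tendsto (fun ε : ℝ => ε ^ (1 - β) * (x - t) ^ (β - 1)) (𝓝[>] 0) (𝓝 0) := by
        have h1 : ContinuousAt (fun ε : ℝ => ε ^ (1 - β) * (x - t) ^ (β - 1)) 0 :=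
          (ContinuousAt.rpow_const continuousAt_id (Or.inr (by linarith))).mul_const _
        have h2 := h1.tendsto.mono_left (nhdsWithin_le_nhds (s := Ioi (0 : ℝ)))
        rwa [Real.zero_rpow (by linarith), zero_mul] at h2
      have hq : Tendsto (fun ε : ℝ => ((x - t) ^ β - max (x - t - ε) 0 ^ β) / ε ^ β) (𝓝[>] 0)
          (𝓝 0) := by
        refine squeeze_zero' ?_ ?_ hz
        · filter_upwards [hev] with ε hε
          exact div_nonneg (rpow_sub_rpow_pos_part_mem hβ0.le hβ1.le hε.1.le hp.le).1
            (Real.rpow_nonneg hε.1.le _)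
        · filter_upwards [Ioo_mem_nhdsGT hp] with ε hε
          have hεβ : (0 : ℝ) < ε ^ β := Real.rpow_pos_of_pos hε.1 _
          rw [max_eq_left (by linarith [hε.2]), div_le_iff₀ hεβ, mul_right_comm,
            ← Real.rpow_add hε.1, sub_add_cancel, Real.rpow_one]
          exact rpow_sub_rpow_le hβ1.le hε.1.le hε.2
      simpa using hq.const_mul (χ t / (x - t))
  rw [intervalIntegral.integral_zero] at hright
  have hright' := hright.const_mul (-(1 / β))
  rw [mul_zero] at hright'
  refine tendsto_nhds_unique (hleft.congr' ?_) hright'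
  filter_upwards [hev] with ε hε
  exact integral_rpow_mul_rlInt_sub hβ0 hac hcx hi hK hε.1 hε.2

theorem marchaud_rlInt {β : ℝ} (hβ0 : 0 < β) (hβ1 : β < 1) {ψ : ℝ → ℝ} {a c x K : ℝ}
    (hac : a < c) (hcx : c < x) (hi : IntervalIntegrable ψ volume a x)
    (hc : ContinuousOn ψ (Ioc a x))
    (hK : ∀ z ∈ Icc c x, ∀ z' ∈ Icc c x, |ψ z - ψ z'| ≤ K * |z - z'|) :
    marchaud β a (rlInt β a ψ) x = Real.Gamma β * Real.Gamma (-β) * ψ x := by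
  have hax : a < x := hac.trans hcx
  obtain ⟨c', hcc', hcx'⟩ := exists_between hcx
  set χ : ℝ → ℝ := fun t => ψ t - ψ x with hχ
  have hiχ : IntervalIntegrable χ volume a x := hi.sub intervalIntegrable_const
  have hmarchaud : ∀ φ : ℝ → ℝ, IntervalIntegrable φ volume a x →
      (∃ K, ∀ z ∈ Icc c x, ∀ z' ∈ Icc c x, |φ z - φ z'| ≤ K * |z - z'|) →
      IntervalIntegrable (fun u => (x - u) ^ (-β - 1) * (rlInt β a φ u - rlInt β a φ x))
        volume a x := by
    rintro φ hφ ⟨L, hL⟩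
    have hφc : IntervalIntegrable φ volume a c := hφ.mono_set (uIcc_subset_uIcc left_mem_uIcc (by
      rw [uIcc_of_le hax.le]; exact ⟨hac.le, hcx.le⟩))
    obtain ⟨M, hM⟩ := rlInt_lipschitz hβ0 hβ1 hac.le hcc' hφc hL
    exact intervalIntegrable_rpow_mul_sub hβ1 (hac.trans hcc').le hcx'
      (intervalIntegrable_rlInt hβ0 hax.le hφ) fun u hu => hM x ⟨hcx'.le, le_rfl⟩ u hu
  have h1 := hmarchaud (fun _ => 1) intervalIntegrable_const ⟨0, by simp⟩
  have h2 := hmarchaud χ hiχ ⟨K, by simpa [hχ] using hK⟩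
  have hdec : ∀ u ∈ Icc a x, rlInt β a ψ u = ψ x * rlInt β a (fun _ => 1) u + rlInt β a χ u := by
    intro u hu
    rcases hu.1.eq_or_lt with hau | hau
    · simp [rlInt, hau]
    obtain ⟨m, ham, hmu⟩ := exists_between hau
    have hslice : ∀ φ : ℝ → ℝ, IntervalIntegrable φ volume a x → ContinuousOn φ (Ioc a x) →
        IntervalIntegrable (fun t => (u - t) ^ (β - 1) * φ t) volume a u := by
      intro φ hφ hφc
      refine (intervalIntegrable_rpow_sub_mul_of_lt ham.le hmu (hφ.mono_set (uIcc_subset_uIcc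
        left_mem_uIcc ?_))).trans (intervalIntegrable_rpow_sub_mul hβ0 hmu.le
          (hφc.mono fun z hz => ⟨ham.trans_le hz.1, hz.2.trans hu.2⟩))
      rw [uIcc_of_le hax.le]
      exact ⟨ham.le, hmu.le.trans hu.2⟩
    rw [rlInt, rlInt, rlInt, ← intervalIntegral.integral_const_mul,
      ← intervalIntegral.integral_add ((hslice _ intervalIntegrable_const
        continuousOn_const).const_mul _) (hslice _ hiχ (hc.sub continuousOn_const))]
    congr 1 with t
    simp only [hχ]
    ring
  have hχ0 := marchaud_rlInt_of_abs_le hβ0 hβ1 hac.le hcx hiχ (K := K) (fun t ht => by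
    have h := hK t ht x ⟨hcx.le, le_rfl⟩
    rwa [abs_sub_comm t x, abs_of_nonneg (sub_nonneg.2 ht.2)] at h) h2
  have hone := marchaud_rlInt_one hβ0 hβ1 hax
  have hx : x ∈ Icc a x := ⟨hax.le, le_rfl⟩
  have hcongr : ∫ u in a..x, (x - u) ^ (-β - 1) * (rlInt β a ψ u - rlInt β a ψ x) =
      ψ x * (∫ u in a..x, (x - u) ^ (-β - 1) *
        (rlInt β a (fun _ => 1) u - rlInt β a (fun _ => 1) x)) +
      ∫ u in a..x, (x - u) ^ (-β - 1) * (rlInt β a χ u - rlInt β a χ x) := by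
    rw [← intervalIntegral.integral_const_mul, ← intervalIntegral.integral_add (h1.const_mul _) h2]
    refine intervalIntegral.integral_congr fun u hu => ?_
    rw [uIcc_of_le hax.le] at hu
    simp only [hdec u hu, hdec x hx]
    ring
  rw [marchaud] at hχ0 hone ⊢
  rw [hcongr, hdec x hx, ← hone]
  linear_combination hχ0

theorem JfracAB_eq_const_mul_rlInt (β a b : ℝ) (ψ : ℝ → ℝ) :
    JfracAB β a b ψ = fun x =>
      (b - a) ^ (-β) / ((2 : ℝ) ^ β * Real.Gamma β) * rlInt β a ψ x := rfl

/-- Solving `D_{α,a,b}(y) = ψ` on `(a,b)` with Dirichlet-type boundary conditions, for `α`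
non-integer with even integer part `2p` and `α' = α - 2p ∈ (0,1)`. -/
theorem fractional_ode_dirichlet_interval (α : ℝ) (p : ℕ) (hp : 1 ≤ p)
    (hfloor : ⌊α⌋ = 2 * (p : ℤ)) (hnotint : ∀ m : ℤ, α ≠ m)
    (a b : ℝ) (hab : a < b) (ψ : ℝ → ℝ)
    (hlip : ∀ c d : ℝ, a < c → c ≤ d → d < b →
      ∃ K : ℝ, ∀ z ∈ Set.Icc c d, ∀ z' ∈ Set.Icc c d, |ψ z - ψ z'| ≤ K * |z - z'|)
    (hO : ∃ γ : ℝ, 0 ≤ γ ∧ γ ≤ 1 - (α - 2 * p) ∧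
      ((fun h : ℝ => ψ (a + h)) =O[nhdsWithin 0 (Set.Ioi 0)] fun h : ℝ => h ^ (-γ)) ∧
      ((fun h : ℝ => ψ (b - h)) =O[nhdsWithin 0 (Set.Ioi 0)] fun h : ℝ => h ^ (-γ))) :
    (∀ j < p,
      iteratedDeriv j (JgreenAB p a b (JfracAB (α - 2 * p) a b ψ)) a = 0 ∧
      iteratedDeriv j (JgreenAB p a b (JfracAB (α - 2 * p) a b ψ)) b = 0) ∧
    (∀ x ∈ Set.Ioo a b,
      (b - a) ^ (2 * p) *
        iteratedDeriv (2 * p) (JgreenAB p a b (JfracAB (α - 2 * p) a b ψ)) x =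
      JfracAB (α - 2 * p) a b ψ x) ∧
    (∀ x ∈ Set.Ioo a b,
      (b - a) ^ (α - 2 * p) * ((2 : ℝ) ^ (α - 2 * p) / Real.Gamma (-(α - 2 * p))) *
        ((∫ u in a..x, (x - u) ^ (-(α - 2 * p) - 1) *
            (JfracAB (α - 2 * p) a b ψ u - JfracAB (α - 2 * p) a b ψ x)) -
          JfracAB (α - 2 * p) a b ψ x * ((x - a) ^ (-(α - 2 * p)) / (α - 2 * p))) = ψ x) := by
  obtain ⟨γ, -, hγ, hOa, hOb⟩ := hO
  obtain ⟨hβ0, hβ1⟩ : 0 < α - 2 * p ∧ α - 2 * p < 1 := by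
    have h1 := Int.floor_le α
    have h2 := Int.lt_floor_add_one α
    have h3 := hnotint (2 * (p : ℤ))
    rw [hfloor] at h1 h2
    push_cast at h1 h2 h3
    exact ⟨sub_pos.2 (h1.lt_of_ne h3.symm), by linarith⟩
  generalize α - 2 * p = β at *
  have hc : ContinuousOn ψ (Ioo a b) := by
    intro z hz
    obtain ⟨c, hac, hcz⟩ := exists_between hz.1
    obtain ⟨d, hzd, hdb⟩ := exists_between hz.2
    obtain ⟨K, hK⟩ := hlip c d hac (hcz.trans hzd).le hdb
    exact ((continuousOn_of_abs_sub_le hK).continuousAt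
      (Icc_mem_nhds hcz hzd)).continuousWithinAt
  have hi : IntervalIntegrable ψ volume a b :=
    intervalIntegrable_of_isBigO_rpow_endpoints (by linarith) hab hc hOa hOb
  obtain ⟨h1, h2⟩ := jgreenAB_boundary_and_iteratedDeriv hp hab (g := JfracAB β a b ψ)
    ((intervalIntegrable_rlInt hβ0 hab.le hi).const_mul _)
    (continuousOn_const.mul (continuousOn_rlInt hβ0 hβ1 hi hlip))
  refine ⟨h1, h2, fun x hx => ?_⟩
  obtain ⟨c, hac, hcx⟩ := exists_between hx.1
  obtain ⟨K, hK⟩ := hlip c x hac hcx.le hx.2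
  have hm := marchaud_rlInt hβ0 hβ1 hac hcx (hi.mono_set (uIcc_subset_uIcc left_mem_uIcc (by
    rw [uIcc_of_le hab.le]; exact ⟨hx.1.le, hx.2.le⟩)))
    (hc.mono fun z hz => ⟨hz.1, hz.2.trans_lt hx.2⟩) hK
  have hΓ : Real.Gamma β ≠ 0 := (Real.Gamma_pos_of_pos hβ0).ne'
  have hΓ' : Real.Gamma (-β) ≠ 0 := by
    intro h
    have h3 := Real.Gamma_add_one (neg_ne_zero.2 hβ0.ne')
    rw [h, mul_zero] at h3
    exact (Real.Gamma_pos_of_pos (by linarith : 0 < -β + 1)).ne' h3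
  have h2β : (2 : ℝ) ^ β ≠ 0 := (Real.rpow_pos_of_pos two_pos _).ne'
  have hL : (b - a) ^ β ≠ 0 := (Real.rpow_pos_of_pos (sub_pos.2 hab) _).ne'
  simp only [JfracAB_eq_const_mul_rlInt, ← mul_sub, mul_left_comm _ ((b - a) ^ (-β) / _)]
  rw [intervalIntegral.integral_const_mul, mul_assoc ((b - a) ^ (-β) / _), ← mul_sub]
  rw [marchaud] at hm
  rw [hm, Real.rpow_neg (sub_pos.2 hab).le]
  field_simp
end
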